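/- arXiv:2507.17739 — 4 statements merged into one kernel-verified Lean document; each statement's English description precedes it below -/
import Mathlib

section
/- Let r ≥ 2 be an integer with r ≠ 3. For all sufficiently large n with 2r | n, let m and s be positive integers with m < 2⁻⁶ r² n and s = 100 r² m, let G be an n-vertex graph with minimum degree δ(G) ≥ n/2 + 6r²m, and let χ : E(G) → [r] be an edge-coloring such that every Hamilton cycle H of G satisfies d_χ(H) < m. Then there exist a color k ∈ [r] and a partition V(G) = V₁ ∪ V₂ ∪ ⋯ ∪ V_r with |V_k| = (r+1)n/(2r) and |V_i| = n/(2r) for all i ≠ k, such that: (i) the induced subgraph G[V_k] is (s,k)-nearly monochromatic; (ii) for every i ≠ k, the bipartite subgraph G[V_i, V_k] is (s,i)-nearly monochromatic; (iii) the induced subgraph G[⋃_{i ∈ [r]∖{k}} V_i] is s-nearly empty. -/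
open SimpleGraph

/-- `HasMatchingOn s Q` says that there are `s` pairwise vertex-disjoint edges all
satisfying `Q`; a graph/edge set is `s`-nearly empty (resp. `(s,k)`-nearly monochromatic)
when the corresponding edge predicate admits no such matching. -/
def HasMatchingOn {V : Type*} (s : ℕ) (Q : Sym2 V → Prop) : Prop :=
  ∃ M : Finset (Sym2 V), M.card = s ∧ (∀ e ∈ M, Q e) ∧
    (M : Set (Sym2 V)).Pairwise fun e f => ∀ x, x ∈ e → x ∉ f

section ListWeight

variable {V M : Type*} [AddCommMonoid M]

/-- The sum of `f a b` over all pairs `a, b` of consecutive entries of a list. -/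
def pathSum (f : V → V → M) : List V → M
  | [] => 0
  | [_] => 0
  | a :: b :: l => f a b + pathSum f (b :: l)

/-- The contribution to `pathSum` of the place where two lists are joined. -/
def jointWeight (f : V → V → M) : Option V → Option V → M
  | some a, some b => f a b
  | _, _ => 0

@[simp] lemma pathSum_nil (f : V → V → M) : pathSum f [] = 0 := rfl

@[simp] lemma pathSum_singleton (f : V → V → M) (a : V) : pathSum f [a] = 0 := rfl

@[simp] lemma pathSum_cons_cons (f : V → V → M) (a b : V) (l : List V) :
    pathSum f (a :: b :: l) = f a b + pathSum f (b :: l) := rfl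

@[simp] lemma jointWeight_some_some (f : V → V → M) (a b : V) :
    jointWeight f (some a) (some b) = f a b := rfl

lemma pathSum_append (f : V → V → M) (l₁ l₂ : List V) :
    pathSum f (l₁ ++ l₂) =
      pathSum f l₁ + jointWeight f l₁.getLast? l₂.head? + pathSum f l₂ := by
  induction l₁ with
  | nil => simp [jointWeight]
  | cons a l ih =>
    cases l with
    | nil => cases l₂ <;> simp [jointWeight]
    | cons b l =>
      simp only [List.cons_append, pathSum_cons_cons, List.getLast?_cons_cons] at ih ⊢
      rw [ih]
      simp only [add_assoc]

lemma jointWeight_comm {f : V → V → M} (hf : ∀ a b, f a b = f b a) (a b : Option V) :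
    jointWeight f a b = jointWeight f b a := by
  cases a <;> cases b <;> simp [jointWeight, hf]

lemma pathSum_reverse {f : V → V → M} (hf : ∀ a b, f a b = f b a) (l : List V) :
    pathSum f l.reverse = pathSum f l := by
  induction l with
  | nil => rfl
  | cons a l ih =>
    have h := pathSum_append f [a] l
    rw [List.singleton_append] at h
    rw [List.reverse_cons, pathSum_append, ih, h]
    simp [jointWeight_comm hf (some a), add_comm]

end ListWeight

section HamiltonPath

variable {V : Type*} (G : SimpleGraph V) [DecidableRel G.Adj]

/-- The indicator of non-adjacency. -/
def nonAdj (a b : V) : ℕ := if G.Adj a b then 0 else 1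

lemma nonAdj_comm (a b : V) : nonAdj G a b = nonAdj G b a := by
  simp [nonAdj, G.adj_comm]

lemma isChain_of_pathSum_nonAdj_eq_zero {l : List V} (h : pathSum (nonAdj G) l = 0) :
    l.IsChain G.Adj := by
  induction l with
  | nil => simp
  | cons a l ih =>
    cases l with
    | nil => simp
    | cons b l =>
      simp only [pathSum_cons_cons, Nat.add_eq_zero_iff, nonAdj] at h
      rw [List.isChain_cons_cons]
      exact ⟨by by_contra hab; simp [hab] at h, ih h.2⟩

lemma exists_not_adj_of_pathSum_nonAdj_ne_zero {l : List V} (h : pathSum (nonAdj G) l ≠ 0) :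
    ∃ i, ∃ hi : i + 1 < l.length, ¬ G.Adj l[i] l[i + 1] := by
  by_contra! hc
  apply h
  induction l with
  | nil => rfl
  | cons a l ih =>
    cases l with
    | nil => rfl
    | cons b l =>
      have h0 := hc 0 (by simp)
      have : pathSum (nonAdj G) (b :: l) = 0 := by
        by_contra hne
        exact hne (ih hne fun i hi => hc (i + 1) (by simpa using hi))
      simp only [pathSum_cons_cons, this, nonAdj]
      simpa using h0

/-- Reversing a segment of a list exchanges the pairs of entries at its two ends. -/
lemma exists_reverse_segment {M : Type*} [AddCommMonoid M] {f : V → V → M}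
    (hf : ∀ a b, f a b = f b a) (l : List V) {i j : ℕ} (hij : i < j) (hj : j + 1 < l.length) :
    ∃ l' : List V, l'.Perm l ∧ l'.head? = l.head? ∧ l'.getLast? = l.getLast? ∧
      pathSum f l' + (f l[i] l[i + 1] + f l[j] l[j + 1]) =
        pathSum f l + (f l[i] l[j] + f l[i + 1] l[j + 1]) := by
  obtain ⟨A, B, C, rfl, hA, hB, hB', hC⟩ : ∃ A B C : List V, l = A ++ (B ++ C) ∧
      A.getLast? = some l[i] ∧ B.head? = some l[i + 1] ∧ B.getLast? = some l[j] ∧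
      C.head? = some l[j + 1] := by
    refine ⟨l.take (i + 1), (l.drop (i + 1)).take (j - i), (l.drop (i + 1)).drop (j - i),
      by simp, ?_, ?_, ?_, ?_⟩
    · rw [List.getLast?_take]; grind
    · rw [List.head?_take, List.head?_drop]; grind
    · rw [List.getLast?_take]; grind
    · rw [List.drop_drop, List.head?_drop]; grind
  generalize (A ++ (B ++ C))[i] = p at *
  generalize (A ++ (B ++ C))[i + 1] = q at *
  generalize (A ++ (B ++ C))[j] = r at *
  generalize (A ++ (B ++ C))[j + 1] = t at *
  refine ⟨A ++ (B.reverse ++ C), ?_, ?_, ?_, ?_⟩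
  · exact ((List.reverse_perm B).append_right C).append_left A
  · have : A ≠ [] := by rintro rfl; simp at hA
    simp [List.head?_append_of_ne_nil _ this]
  · have : C ≠ [] := by rintro rfl; simp at hC
    simp [List.getLast?_append_of_ne_nil _ this]
  · simp only [pathSum_append, pathSum_reverse hf, List.head?_append, List.head?_reverse,
      List.getLast?_reverse, hA, hB, hB', hC, Option.or_some, Option.getD_some,
      jointWeight_some_some]
    abel

/-- A graph on a vertex set `U` in which all degrees are at least `(|U| + 1) / 2` is
Hamilton-connected. -/
lemma exists_hamiltonPath [DecidableEq V] (U : Finset V) {u v : V} (hu : u ∈ U)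
    (hv : v ∈ U) (huv : u ≠ v)
    (hdeg : ∀ x ∈ U, U.card + 1 ≤ 2 * (U.filter (G.Adj x)).card) :
    ∃ l : List V, l.Nodup ∧ l.toFinset = U ∧ l.head? = some u ∧ l.getLast? = some v ∧
      l.IsChain G.Adj := by
  suffices key : ∀ k, ∀ l : List V, pathSum (nonAdj G) l = k → l.Nodup → l.toFinset = U →
      l.head? = some u → l.getLast? = some v →
      ∃ l : List V, l.Nodup ∧ l.toFinset = U ∧ l.head? = some u ∧ l.getLast? = some v ∧
        l.IsChain G.Adj by
    refine key _ (u :: (((U.erase u).erase v).toList ++ [v])) rfl ?_ ?_ rfl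
      (by rw [← List.cons_append]; exact List.getLast?_concat)
    · simp +contextual [List.nodup_append, Finset.nodup_toList, huv]
    · ext x
      simp only [List.toFinset_cons, List.toFinset_append, Finset.toList_toFinset,
        List.toFinset_nil, Finset.mem_insert, Finset.mem_union, Finset.mem_erase]
      grind
  intro k
  induction k using Nat.strong_induction_on with
  | _ k ih =>
  intro l hk hnd hU hhead hlast
  by_cases hk0 : k = 0
  · exact ⟨l, hnd, hU, hhead, hlast, isChain_of_pathSum_nonAdj_eq_zero G (hk.trans hk0)⟩
  obtain ⟨i, hi, hxy⟩ := exists_not_adj_of_pathSum_nonAdj_ne_zero G (hk.trans_ne hk0)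
  have hcard : U.card = l.length := by rw [← hU, List.toFinset_card_of_nodup hnd]
  have hmem : ∀ z, z ∈ U ↔ z ∈ l := fun z => by rw [← hU, List.mem_toFinset]
  have hinj : Set.InjOn (fun z => l.idxOf z) (U : Set V) := fun a ha b _ h =>
    (List.idxOf_inj ((hmem a).1 ha)).1 h
  obtain ⟨j, hjN, hji, hjx, hjy⟩ : ∃ j, ∃ hj : j + 1 < l.length, j ≠ i ∧
      G.Adj l[i] l[j] ∧ G.Adj l[i + 1] l[j + 1] := by
    set N := l.length with hN
    let A := (Finset.range (N - 1)).filter fun j => ∃ h : j < N, G.Adj l[i] l[j]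
    let B := (Finset.range (N - 1)).filter fun j => ∃ h : j + 1 < N, G.Adj l[i + 1] l[j + 1]
    have hA : (U.filter (G.Adj l[i])).card ≤ A.card + 1 := by
      refine (Finset.card_le_card_of_injOn (t := insert (N - 1) A) (fun z => l.idxOf z) ?_
        (hinj.mono (Finset.coe_subset.2 (Finset.filter_subset _ _)))).trans
        (Finset.card_insert_le _ _)
      intro z hz
      simp only [Finset.coe_filter, Set.mem_ofPred_eq, hmem] at hz
      have := List.idxOf_lt_length_iff.2 hz.1
      have hget : l[l.idxOf z] = z := List.getElem_idxOf this
      simp only [Finset.coe_insert, Set.mem_insert_iff, Finset.mem_coe, A, Finset.mem_filter,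
        Finset.mem_range]
      by_cases h : l.idxOf z = N - 1
      · exact Or.inl h
      · exact Or.inr ⟨by omega, this, by rw [hget]; exact hz.2⟩
    have hB : (U.filter (G.Adj l[i + 1])).card ≤ B.card + 1 := by
      refine (Finset.card_le_card_of_injOn (t := insert 0 (B.image Nat.succ))
        (fun z => l.idxOf z) ?_ (hinj.mono (Finset.coe_subset.2 (Finset.filter_subset _ _)))).trans
        ((Finset.card_insert_le _ _).trans (Nat.succ_le_succ Finset.card_image_le))
      intro z hz
      simp only [Finset.coe_filter, Set.mem_ofPred_eq, hmem] at hz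
      have := List.idxOf_lt_length_iff.2 hz.1
      have hget : l[l.idxOf z] = z := List.getElem_idxOf this
      simp only [Finset.coe_insert, Set.mem_insert_iff, Finset.mem_coe, B, Finset.mem_filter,
        Finset.mem_range, Finset.mem_image]
      rcases h : l.idxOf z with _ | q
      · exact Or.inl rfl
      · refine Or.inr ⟨q, ⟨by omega, by omega, ?_⟩, rfl⟩
        simp only [h] at hget
        rw [hget]; exact hz.2
    have hAB : A ∪ B ⊆ (Finset.range (N - 1)).erase i := by
      intro q hq
      simp only [A, B, Finset.mem_union, Finset.mem_filter, Finset.mem_range] at hq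
      rw [Finset.mem_erase, Finset.mem_range]
      refine ⟨?_, by omega⟩
      rintro rfl
      rcases hq with ⟨_, _, h⟩ | ⟨_, _, h⟩ <;> exact G.irrefl h
    have h1 := Finset.card_le_card hAB
    rw [Finset.card_erase_of_mem (by simp; omega), Finset.card_range] at h1
    have h2 := Finset.card_union_add_card_inter A B
    have h3 := hdeg l[i] ((hmem _).2 (List.getElem_mem _))
    have h4 := hdeg l[i + 1] ((hmem _).2 (List.getElem_mem _))
    have h5 : 0 < (A ∩ B).card := by omega
    obtain ⟨j, hj⟩ := Finset.card_pos.1 h5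
    have hji := (Finset.mem_erase.1 (hAB (Finset.mem_union_left _ (Finset.mem_inter.1 hj).1))).1
    simp only [A, B, Finset.mem_inter, Finset.mem_filter] at hj
    obtain ⟨⟨_, _, hjx⟩, _, hjN, hjy⟩ := hj
    exact ⟨j, hjN, hji, hjx, hjy⟩
  obtain ⟨l', hperm, hh, hl, hlt⟩ : ∃ l' : List V, l'.Perm l ∧ l'.head? = l.head? ∧
      l'.getLast? = l.getLast? ∧ pathSum (nonAdj G) l' < k := by
    rcases lt_or_gt_of_ne hji with h | h
    · obtain ⟨l', h1, h2, h3, h4⟩ := exists_reverse_segment (nonAdj_comm G) l h hi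
      refine ⟨l', h1, h2, h3, ?_⟩
      simp only [nonAdj, hjx.symm, hjy.symm, hxy, if_true, if_false] at h4 hk ⊢
      change pathSum (nonAdj G) l' + _ = pathSum (nonAdj G) l + _ at h4
      omega
    · obtain ⟨l', h1, h2, h3, h4⟩ := exists_reverse_segment (nonAdj_comm G) l h hjN
      refine ⟨l', h1, h2, h3, ?_⟩
      simp only [nonAdj, hjx, hjy, hxy, if_true, if_false] at h4 hk ⊢
      change pathSum (nonAdj G) l' + _ = pathSum (nonAdj G) l + _ at h4
      omega
  exact ih _ hlt l' rfl (hperm.nodup_iff.2 hnd) ((List.toFinset_eq_of_perm _ _ hperm).trans hU)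
    (hh.trans hhead) (hl.trans hlast)

end HamiltonPath

section Switching

variable {V : Type*} {G : SimpleGraph V}

/-- The sum of `f a b` over all pairs of cyclically consecutive entries of a list. -/
def cycleSum {M : Type*} [AddCommMonoid M] (f : V → V → M) (l : List V) : M :=
  jointWeight f l.getLast? l.head? + pathSum f l

variable (G) in
/-- A list of vertices whose entries, in cyclic order, form a Hamilton cycle. -/
structure IsHamiltonList (l : List V) : Prop where
  nodup : l.Nodup
  mem : ∀ v, v ∈ l
  isChain : l.IsChain G.Adj
  closed : ∀ a ∈ l.getLast?, ∀ b ∈ l.head?, G.Adj a b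

variable (G) in
/-- Two paths of `G` with the same vertex set and the same ends. -/
structure IsSwitch (p q : List V) : Prop where
  nodup : p.Nodup
  perm : q.Perm p
  head : q.head? = p.head?
  last : q.getLast? = p.getLast?
  isChain_left : p.IsChain G.Adj
  isChain_right : q.IsChain G.Adj

lemma IsSwitch.refl {p : List V} (hp : p.Nodup) (hc : p.IsChain G.Adj) : IsSwitch G p p :=
  ⟨hp, List.Perm.refl _, rfl, rfl, hc, hc⟩

lemma IsSwitch.symm {p q : List V} (h : IsSwitch G p q) : IsSwitch G q p :=
  ⟨h.perm.nodup_iff.2 h.nodup, h.perm.symm, h.head.symm, h.last.symm, h.isChain_right,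
    h.isChain_left⟩

/-- Concatenating two switches through a new vertex. -/
lemma IsSwitch.append {p q p' q' : List V} (h : IsSwitch G p q) (h' : IsSwitch G p' q') (y : V)
    (hy : y ∉ p) (hy' : y ∉ p') (hd : p.Disjoint p') (hl : ∀ a ∈ p.getLast?, G.Adj a y)
    (hr : ∀ a ∈ p'.head?, G.Adj y a) : IsSwitch G (p ++ y :: p') (q ++ y :: q') where
  nodup := by
    rw [List.nodup_append', List.nodup_cons, List.disjoint_cons_right]
    exact ⟨h.nodup, ⟨hy', h'.nodup⟩, hy, hd⟩
  perm := h.perm.append (h'.perm.cons y)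
  head := by simp [List.head?_append, h.head]
  last := by simp [List.getLast?_append, List.getLast?_cons, h'.last]
  isChain_left := by
    rw [List.isChain_append, List.isChain_cons]
    exact ⟨h.isChain_left, ⟨hr, h'.isChain_left⟩, by simpa using hl⟩
  isChain_right := by
    rw [List.isChain_append, List.isChain_cons, h.last, h'.head]
    exact ⟨h.isChain_right, ⟨hr, h'.isChain_right⟩, by simpa using hl⟩

lemma pathSum_append_cons {M : Type*} [AddCommMonoid M] (f : V → V → M) (p p' : List V) (y : V) :
    pathSum f (p ++ y :: p') = jointWeight f p.getLast? (some y) +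
      jointWeight f (some y) p'.head? + (pathSum f p + pathSum f p') := by
  have h := pathSum_append f [y] p'
  rw [List.singleton_append] at h
  rw [pathSum_append, h]
  simp
  abel

variable [Fintype V] [DecidableEq V]

section

variable [DecidableRel G.Adj]

lemma exists_common_neighbor {e : ℕ} (hdeg : ∀ x, Fintype.card V + e ≤ 2 * G.degree x)
    (x y : V) {F : Finset V} (hF : F.card < e) : ∃ z ∉ F, G.Adj x z ∧ G.Adj y z := by
  have h1 := Finset.card_union_add_card_inter (G.neighborFinset x) (G.neighborFinset y)
  have h2 : (G.neighborFinset x ∪ G.neighborFinset y).card ≤ Fintype.card V :=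
    Finset.card_le_univ _
  have hx := hdeg x
  have hy := hdeg y
  rw [← G.card_neighborFinset_eq_degree] at hx hy
  obtain ⟨z, hz, hzF⟩ := Finset.exists_mem_notMem_of_card_lt_card
    (s := F) (t := G.neighborFinset x ∩ G.neighborFinset y) (by omega)
  exact ⟨z, hzF, by simpa using hz⟩

/-- If the minimum degree is large compared with the length of a switch, then its two paths can
be completed to Hamilton cycles in the same way. -/
lemma IsSwitch.exists_isHamiltonList {p q : List V} (h : IsSwitch G p q) (hp : 2 ≤ p.length)
    (hdeg : ∀ x, Fintype.card V + p.length ≤ 2 * G.degree x) :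
    ∃ l l' : List V, IsHamiltonList G l ∧ IsHamiltonList G l' ∧
      ∀ f : V → V → ℕ, cycleSum f l + pathSum f q = cycleSum f l' + pathSum f p := by
  obtain ⟨u, p₁, rfl⟩ := List.exists_cons_of_length_pos (l := p) (by omega)
  have hp₁ : p₁ ≠ [] := by rintro rfl; simp at hp
  obtain ⟨A, v, rfl⟩ := List.eq_nil_or_concat' p₁ |>.resolve_left hp₁
  have hnd := h.nodup
  have huv : v ≠ u := by rintro rfl; simp at hnd
  have hA : A.toFinset.card = A.length := List.toFinset_card_of_nodup (by
    simp only [List.nodup_cons, List.nodup_append'] at hnd; exact hnd.2.1)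
  simp only [List.length_cons, List.length_append, List.length_nil] at hdeg
  have hU : (A.toFinsetᶜ).card = Fintype.card V - A.length := by rw [Finset.card_compl, hA]
  have hAV : A.length ≤ Fintype.card V := hA ▸ Finset.card_le_univ _
  obtain ⟨l, hl, hlU, hlh, hll, hlc⟩ := exists_hamiltonPath G A.toFinsetᶜ (u := v) (v := u)
    (by simp [List.nodup_append] at hnd ⊢; grind) (by simp at hnd ⊢; grind) huv (by
      intro x _
      have h1 : (G.neighborFinset x).card ≤
          ((A.toFinsetᶜ).filter (G.Adj x)).card + A.toFinset.card := by
        refine (Finset.card_le_card (t := (A.toFinsetᶜ).filter (G.Adj x) ∪ A.toFinset) ?_).trans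
          (Finset.card_union_le _ _)
        intro z hz
        by_cases z ∈ A <;> simp_all
      rw [G.card_neighborFinset_eq_degree] at h1
      have := hdeg x
      omega)
  obtain ⟨R, rfl⟩ : ∃ R, l = v :: (R ++ [u]) := by
    cases l with
    | nil => simp at hlh
    | cons a l =>
      obtain rfl : a = v := by simpa using hlh
      rcases List.eq_nil_or_concat' l with rfl | ⟨R, b, rfl⟩
      · simp at hll; exact absurd hll huv
      · rw [← List.cons_append, List.getLast?_concat] at hll
        obtain rfl : b = u := by simpa using hll
        exact ⟨R, rfl⟩
  have hlast : (u :: (A ++ [v])).getLast? = some v := by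
    rw [← List.cons_append, List.getLast?_concat]
  rw [← List.cons_append, List.isChain_append] at hlc
  have key : ∀ s : List V, s.Perm (u :: (A ++ [v])) → s.head? = some u → s.getLast? = some v →
      s.IsChain G.Adj → IsHamiltonList G (s ++ R) := by
    intro s hs hsh hsl hsc
    have hmem : ∀ x, x ∈ R ∨ x = v ∨ x = u ↔ x ∉ A := by
      intro x
      have := Finset.ext_iff.1 hlU x
      simp at this
      tauto
    refine ⟨?_, ?_, ?_, ?_⟩
    · rw [List.nodup_append', hs.nodup_iff]
      refine ⟨hnd, ?_, ?_⟩
      · simp only [List.nodup_cons, List.nodup_append'] at hl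
        exact hl.2.1
      · intro x hx hxR
        have := (hmem x).1 (Or.inl hxR)
        simp only [List.nodup_cons, List.nodup_append', List.mem_append] at hl
        have h2 := hs.mem_iff.1 hx
        simp at h2
        rcases h2 with rfl | h2 | rfl
        · exact hl.2.2.2 hxR (by simp)
        · exact this h2
        · exact hl.1 (Or.inl hxR)
    · intro x
      rw [List.mem_append, hs.mem_iff]
      have := hmem x
      simp
      tauto
    · rw [List.isChain_append, hsl]
      exact ⟨hsc, (List.isChain_cons.1 hlc.1).2, fun a ha b hb => by
        obtain rfl : v = a := by simpa using ha
        exact (List.isChain_cons.1 hlc.1).1 b hb⟩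
    · intro a ha b hb
      rw [List.head?_append, hsh] at hb
      obtain rfl : u = b := by simpa using hb
      refine hlc.2.2 a ?_ u (by simp)
      rw [List.getLast?_append, hsl] at ha
      simpa [List.getLast?_cons, Option.or_some] using ha
  refine ⟨_, _, key _ (List.Perm.refl _) rfl hlast h.isChain_left,
    key q h.perm (by simpa using h.head) (h.last.trans hlast) h.isChain_right, ?_⟩
  intro f
  simp only [cycleSum, pathSum_append f _ R, List.getLast?_append, List.head?_append, h.head,
    h.last]
  abel

end

/-- A Hamilton list is traversed by a Hamilton cycle. -/
lemma IsHamiltonList.exists_isHamiltonianCycle {l : List V} (h : IsHamiltonList G l)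
    (hV : 3 ≤ Fintype.card V) : ∃ (v : V) (H : G.Walk v v), H.IsHamiltonianCycle ∧
      ∀ p : Sym2 V → Prop, ∀ [DecidablePred p],
        (H.edges.filter (fun e => p e)).length =
          cycleSum (fun a b => if p s(a, b) then 1 else 0) l := by
  have hlen : l.length = Fintype.card V := by
    rw [← List.toFinset_card_of_nodup h.nodup, ← Finset.card_univ]
    congr 1
    ext v
    simp [h.mem v]
  have hne : l ≠ [] := by rintro rfl; simp at hlen; omega
  have hadj : G.Adj (l.getLast hne) (l.head hne) :=
    h.closed _ (List.getLast_mem_getLast? hne) _ (List.head_mem_head? hne)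
  have hsupp := SimpleGraph.Walk.support_ofSupport hne h.isChain
  have hedge : ∀ (l : List V) (hne : l ≠ []) (hc : l.IsChain G.Adj) (p : Sym2 V → Prop)
      [DecidablePred p], ((SimpleGraph.Walk.ofSupport l hne hc).edges.filter
        (fun e => p e)).length = pathSum (fun a b => if p s(a, b) then 1 else 0) l := by
    intro l hne hc p _
    induction l with
    | nil => exact absurd rfl hne
    | cons a l ih =>
      cases l with
      | nil => rfl
      | cons b l =>
        have := ih (by simp) hc.of_cons
        rw [SimpleGraph.Walk.ofSupport_cons_cons, pathSum_cons_cons, ← this]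
        erw [SimpleGraph.Walk.edges_cons]
        rw [List.filter_cons]
        split_ifs with h1 h2 h2 <;> simp_all [add_comm]
  refine ⟨_, SimpleGraph.Walk.cons hadj (SimpleGraph.Walk.ofSupport l hne h.isChain), ?_, ?_⟩
  · rw [SimpleGraph.Walk.isHamiltonianCycle_iff_isCycle_and_length_eq,
      SimpleGraph.Walk.isCycle_iff_isPath_tail_and_le_length]
    have hl := SimpleGraph.Walk.length_support (SimpleGraph.Walk.ofSupport l hne h.isChain)
    rw [hsupp] at hl
    rw [SimpleGraph.Walk.length_cons]
    refine ⟨⟨?_, by omega⟩, by omega⟩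
    rw [SimpleGraph.Walk.isPath_def,
      SimpleGraph.Walk.support_tail_of_not_nil _ SimpleGraph.Walk.not_nil_cons,
      SimpleGraph.Walk.support_cons, List.tail_cons, hsupp]
    exact h.nodup
  · intro p _
    rw [SimpleGraph.Walk.edges_cons, List.filter_cons, cycleSum, List.getLast?_eq_some_getLast hne,
      List.head?_eq_some_head hne, jointWeight_some_some, ← hedge l hne h.isChain p]
    split_ifs with h1 h2 h2 <;> simp_all [add_comm]

/-- The indicator of the edges of color `c`. -/
def colorInd {r : ℕ} (χ : Sym2 V → Fin r) (c : Fin r) (a b : V) : ℕ :=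
  if χ s(a, b) = c then 1 else 0

/-- If no two Hamilton cycles differ by `2 * m` or more in their number of edges of color `c`,
then after the deletion of at most `14 * m` vertices no short switch changes this number. -/
lemma exists_switch_free {r e m : ℕ} {χ : Sym2 V → Fin r} {c : Fin r} [Nonempty V]
    [DecidableRel G.Adj]
    (hdeg : ∀ x, Fintype.card V + e ≤ 2 * G.degree x) (hm : 1 ≤ m) (he : 15 * m ≤ e)
    (hbias : ∀ l l' : List V, IsHamiltonList G l → IsHamiltonList G l' →
      cycleSum (colorInd χ c) l < cycleSum (colorInd χ c) l' + 2 * m) :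
    ∃ W : Finset V, W.card ≤ 14 * m ∧ ∀ p q : List V, IsSwitch G p q → p.length ≤ 6 →
      (∀ x ∈ p, x ∉ W) → pathSum (colorInd χ c) p ≤ pathSum (colorInd χ c) q := by
  by_contra! hcon
  have key : ∀ t ≤ 2 * m, ∃ p q, IsSwitch G p q ∧ p ≠ [] ∧ p.length ≤ 7 * t + 1 ∧
      t + pathSum (colorInd χ c) q ≤ pathSum (colorInd χ c) p := by
    intro t
    induction t with
    | zero =>
      intro _
      obtain ⟨v⟩ := ‹Nonempty V›
      exact ⟨[v], [v], IsSwitch.refl (by simp) (by simp), by simp, by simp, by simp⟩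
    | succ t ih =>
      intro ht
      obtain ⟨p, q, hpq, hne, hlen, hsum⟩ := ih (by omega)
      have hpc : p.toFinset.card ≤ p.length := p.toFinset_card_le
      obtain ⟨p', q', hpq', hlen', hdisj, hsum'⟩ := hcon p.toFinset (by omega)
      have hne' : p' ≠ [] := by
        rintro rfl
        simp at hsum'
      obtain ⟨y, hy, h1, h2⟩ := exists_common_neighbor hdeg (p.getLast hne) (p'.head hne')
        (F := p.toFinset ∪ p'.toFinset) (by
          have h1 := Finset.card_union_le p.toFinset p'.toFinset
          have h2 : p'.toFinset.card ≤ p'.length := p'.toFinset_card_le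
          omega)
      simp only [Finset.mem_union, List.mem_toFinset, not_or] at hy hdisj
      refine ⟨_, _, hpq.append hpq' y hy.1 hy.2 (fun a ha ha' => hdisj a ha' ha) ?_ ?_, by simp,
        ?_, ?_⟩
      · intro a ha
        rw [List.getLast?_eq_some_getLast hne] at ha
        obtain rfl : p.getLast hne = a := by simpa using ha
        exact h1
      · intro a ha
        rw [List.head?_eq_some_head hne'] at ha
        obtain rfl : p'.head hne' = a := by simpa using ha
        exact h2.symm
      · simp only [List.length_append, List.length_cons]
        omega
      · rw [pathSum_append_cons, pathSum_append_cons, hpq.last, hpq'.head]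
        omega
  obtain ⟨p, q, hpq, hne, hlen, hsum⟩ := key (2 * m) le_rfl
  have hlen2 : 2 ≤ p.length := by
    match p, hne, hsum with
    | [a], _, hsum => simp at hsum; omega
    | _ :: _ :: _, _, _ => simp
  obtain ⟨l, l', hl, hl', hll'⟩ := hpq.exists_isHamiltonList hlen2 (fun x => by
    have := hdeg x
    omega)
  have h1 := hbias l l' hl hl'
  have h2 := hll' (colorInd χ c)
  omega

end Switching

section Potential

variable {V : Type*} {G : SimpleGraph V} {r : ℕ}
  {χ : Sym2 V → Fin r} {c : Fin r} {W : Finset V}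

lemma colorInd_comm (χ : Sym2 V → Fin r) (c : Fin r) (a b : V) :
    colorInd χ c a b = colorInd χ c b a := by
  simp [colorInd, Sym2.eq_swap]

section

variable [DecidableEq V]

/-- In the absence of short switches, the two pairs of opposite edges of a 4-cycle have the same
number of edges of each color. -/
lemma colorInd_fourCycle
    (hcn : ∀ x y : V, ∀ F : Finset V, F.card ≤ 4 → ∃ z ∉ F, z ∉ W ∧ G.Adj x z ∧ G.Adj y z)
    (hfree : ∀ p q : List V, IsSwitch G p q → p.length ≤ 6 → (∀ x ∈ p, x ∉ W) →
      pathSum (colorInd χ c) p = pathSum (colorInd χ c) q)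
    {a b d x : V} (ha : a ∉ W) (hb : b ∉ W) (hd : d ∉ W) (hx : x ∉ W)
    (hab : G.Adj a b) (hxd : G.Adj x d) (hxb : G.Adj x b) (had : G.Adj a d) :
    colorInd χ c a b + colorInd χ c d x = colorInd χ c a d + colorInd χ c b x := by
  by_cases hax : a = x
  · subst hax
    rw [colorInd_comm χ c d a, colorInd_comm χ c b a, add_comm]
  by_cases hbd : b = d
  · subst hbd
    rfl
  obtain ⟨y, hy, hyW, hby, hdy⟩ := hcn b d {a, b, d, x} Finset.card_le_four
  simp only [Finset.mem_insert, Finset.mem_singleton, not_or] at hy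
  have hs : IsSwitch G [a, b, y, d, x] [a, d, y, b, x] := by
    refine ⟨?_, ?_, rfl, rfl, ?_, ?_⟩
    · have := hab.ne; have := hxd.ne; have := hxb.ne; have := had.ne
      simp only [List.nodup_cons, List.mem_cons, List.not_mem_nil, List.nodup_nil]
      grind
    · rw [List.perm_iff_count]
      intro z
      simp only [List.count_cons, List.count_nil]
      omega
    · simp [hab, hby, hdy.symm, hxd.symm]
    · simp [had, hdy, hby.symm, hxb.symm]
  have h := hfree _ _ hs (by simp) (by simp [ha, hb, hd, hx, hyW])
  simp only [pathSum_cons_cons, pathSum_singleton] at h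
  rw [colorInd_comm χ c y d, colorInd_comm χ c y b] at h
  omega

/-- In the absence of short switches, the alternating sum of a triangle at one of its vertices
does not depend on the triangle. -/
lemma colorInd_triangles
    (hcn : ∀ x y : V, ∀ F : Finset V, F.card ≤ 4 → ∃ z ∉ F, z ∉ W ∧ G.Adj x z ∧ G.Adj y z)
    (hfree : ∀ p q : List V, IsSwitch G p q → p.length ≤ 6 → (∀ x ∈ p, x ∉ W) →
      pathSum (colorInd χ c) p = pathSum (colorInd χ c) q)
    {x a b d e : V} (hx : x ∉ W) (ha : a ∉ W) (hb : b ∉ W) (hd : d ∉ W) (he : e ∉ W)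
    (hxa : G.Adj x a) (hxb : G.Adj x b) (hab : G.Adj a b)
    (hxd : G.Adj x d) (hxe : G.Adj x e) (hde : G.Adj d e) :
    colorInd χ c x a + colorInd χ c x b + colorInd χ c d e =
      colorInd χ c a b + colorInd χ c x d + colorInd χ c x e := by
  have share : ∀ {a b d : V}, a ∉ W → b ∉ W → d ∉ W → G.Adj x a → G.Adj x b → G.Adj x d →
      G.Adj a b → G.Adj a d →
      colorInd χ c x b + colorInd χ c a d = colorInd χ c a b + colorInd χ c x d := by
    intro a b d ha hb hd hxa hxb hxd hab had
    have h := colorInd_fourCycle hcn hfree ha hb hd hx hab hxd hxb had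
    rw [colorInd_comm χ c d x, colorInd_comm χ c b x] at h
    omega
  have e1 := colorInd_comm χ c a b
  have e2 := colorInd_comm χ c d e
  by_cases h1 : a = d
  · subst h1
    have := share ha hb he hxa hxb hxe hab hde
    omega
  by_cases h2 : a = e
  · subst h2
    have := share ha hb hd hxa hxb hxd hab hde.symm
    omega
  by_cases h3 : b = d
  · subst h3
    have := share hb ha he hxb hxa hxe hab.symm hde
    omega
  by_cases h4 : b = e
  · subst h4
    have := share hb ha hd hxb hxa hxd hab.symm hde.symm
    omega
  obtain ⟨y, hy, hyW, hby, hdy⟩ := hcn b d {a, e, x} (Finset.card_le_three.trans (by norm_num))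
  simp only [Finset.mem_insert, Finset.mem_singleton, not_or] at hy
  have hs : IsSwitch G [a, x, b, y, d, e] [a, b, y, d, x, e] := by
    refine ⟨?_, ?_, rfl, rfl, ?_, ?_⟩
    · have := hab.ne; have := hxa.ne; have := hxb.ne; have := hxd.ne; have := hxe.ne
      have := hde.ne; have := hby.ne; have := hdy.ne
      simp only [List.nodup_cons, List.mem_cons, List.not_mem_nil, List.nodup_nil]
      grind
    · rw [List.perm_iff_count]
      intro z
      simp only [List.count_cons, List.count_nil]
      omega
    · simp [hxa.symm, hxb, hby, hdy.symm, hde]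
    · simp [hab, hby, hdy.symm, hxd.symm, hxe]
  have h := hfree _ _ hs (by simp) (by simp [ha, hb, hd, hx, he, hyW])
  simp only [pathSum_cons_cons, pathSum_singleton] at h
  rw [colorInd_comm χ c a x, colorInd_comm χ c d x] at h
  omega

end

/-- `τ` is a potential for the edges of color `c` of `G - W`: up to a factor of two, the
indicator of color `c` is the sum of `τ` over the two ends of an edge. -/
structure IsPotential (G : SimpleGraph V) (W : Finset V) (χ : Sym2 V → Fin r) (c : Fin r)
    (τ : V → ℤ) : Prop where
  zero : ∀ x ∈ W, τ x = 0
  triangle : ∀ x a b, x ∉ W → a ∉ W → b ∉ W → G.Adj x a → G.Adj x b → G.Adj a b →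
    τ x = colorInd χ c x a + colorInd χ c x b - colorInd χ c a b

/-- In the absence of short switches, every color has a potential. -/
lemma exists_isPotential [DecidableEq V]
    (hcn : ∀ x y : V, ∀ F : Finset V, F.card ≤ 4 → ∃ z ∉ F, z ∉ W ∧ G.Adj x z ∧ G.Adj y z)
    (hfree : ∀ p q : List V, IsSwitch G p q → p.length ≤ 6 → (∀ x ∈ p, x ∉ W) →
      pathSum (colorInd χ c) p = pathSum (colorInd χ c) q) :
    ∃ τ : V → ℤ, IsPotential G W χ c τ := by
  have h : ∀ x, ∃ t : ℤ, (x ∈ W → t = 0) ∧ ∀ a b, x ∉ W → a ∉ W → b ∉ W → G.Adj x a →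
      G.Adj x b → G.Adj a b → t = colorInd χ c x a + colorInd χ c x b - colorInd χ c a b := by
    intro x
    by_cases hx : x ∈ W
    · exact ⟨0, fun _ => rfl, fun a b h => absurd hx h⟩
    obtain ⟨a, -, ha, hxa, -⟩ := hcn x x ∅ (by simp)
    obtain ⟨b, -, hb, hxb, hab⟩ := hcn x a ∅ (by simp)
    refine ⟨colorInd χ c x a + colorInd χ c x b - colorInd χ c a b, fun h => absurd h hx, ?_⟩
    intro d e _ hd he hxd hxe hde
    have := colorInd_triangles hcn hfree hx ha hb hd he hxa hxb hab hxd hxe hde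
    omega
  choose τ h1 h2 using h
  exact ⟨τ, h1, h2⟩

lemma IsPotential.add_eq (hcn : ∀ x y : V, ∃ z ∉ W, G.Adj x z ∧ G.Adj y z)
    {τ : V → ℤ} (h : IsPotential G W χ c τ) {x y : V} (hx : x ∉ W) (hy : y ∉ W) (hxy : G.Adj x y) :
    τ x + τ y = 2 * colorInd χ c x y := by
  obtain ⟨z, hz, hxz, hyz⟩ := hcn x y
  have h1 := h.triangle x y z hx hy hz hxy hxz hyz
  have h2 := h.triangle y x z hy hx hz hxy.symm hyz hxz
  rw [colorInd_comm χ c y x] at h2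
  omega

lemma IsPotential.mem_Icc (hcn : ∀ x y : V, ∃ z ∉ W, G.Adj x z ∧ G.Adj y z)
    {τ : V → ℤ} (h : IsPotential G W χ c τ) (x : V) :
    -1 ≤ τ x ∧ τ x ≤ 2 := by
  by_cases hx : x ∈ W
  · rw [h.zero x hx]; omega
  obtain ⟨a, ha, hxa, -⟩ := hcn x x
  obtain ⟨b, hb, hxb, hab⟩ := hcn x a
  have := h.triangle x a b hx ha hb hxa hxb hab
  simp only [colorInd] at this
  split_ifs at this <;> omega

lemma IsPotential.even_sub (hcn : ∀ x y : V, ∃ z ∉ W, G.Adj x z ∧ G.Adj y z)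
    {τ : V → ℤ} (h : IsPotential G W χ c τ) {x y : V} (hx : x ∉ W) (hy : y ∉ W) :
    Even (τ x - τ y) := by
  obtain ⟨z, hz, hxz, hyz⟩ := hcn x y
  have h1 := h.add_eq hcn hx hz hxz
  have h2 := h.add_eq hcn hy hz hyz
  exact ⟨colorInd χ c x z - colorInd χ c y z, by omega⟩

lemma sum_potential_eq_one (hcn : ∀ x y : V, ∃ z ∉ W, G.Adj x z ∧ G.Adj y z)
    {τ : Fin r → V → ℤ} (h : ∀ i, IsPotential G W χ i (τ i)) {x : V} (hx : x ∉ W) :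
    ∑ i, τ i x = 1 := by
  obtain ⟨a, ha, hxa, -⟩ := hcn x x
  obtain ⟨b, hb, hxb, hab⟩ := hcn x a
  rw [Finset.sum_congr rfl fun i _ => (h i).triangle x a b hx ha hb hxa hxb hab]
  simp [Finset.sum_add_distrib, Finset.sum_sub_distrib, colorInd]

/-- Either some color does not occur in `G - W`, or there is a unique color with odd
potential. -/
lemma exists_even_potential [DecidableEq V] [Nonempty V]
    (hcn : ∀ x y : V, ∃ z ∉ W, G.Adj x z ∧ G.Adj y z) (hr3 : r ≠ 3)
    {τ : Fin r → V → ℤ} (h : ∀ i, IsPotential G W χ i (τ i)) :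
    (∃ i, ∀ x, τ i x = 0) ∨ ∃ k, (∀ x ∉ W, Odd (τ k x)) ∧
      ∀ i ≠ k, ∀ x, τ i x = 0 ∨ τ i x = 2 := by
  obtain ⟨x₀⟩ := ‹Nonempty V›
  obtain ⟨x, hx, -⟩ := hcn x₀ x₀
  let O : Finset (Fin r) := Finset.univ.filter fun i => Odd (τ i x)
  have hodd : ∀ i ∈ O, ∀ y ∉ W, Odd (τ i y) := by
    intro i hi y hy
    obtain ⟨p, hp⟩ := (h i).even_sub hcn hy hx
    obtain ⟨q, hq⟩ := (Finset.mem_filter.1 hi).2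
    exact ⟨p + q, by omega⟩
  have heven : ∀ i ∉ O, ∀ y, τ i y = 0 ∨ τ i y = 2 := by
    intro i hi y
    by_cases hy : y ∈ W
    · exact Or.inl ((h i).zero y hy)
    obtain ⟨p, hp⟩ := (h i).even_sub hcn hy hx
    have hi' : ¬ Odd (τ i x) := fun ho => hi (Finset.mem_filter.2 ⟨Finset.mem_univ _, ho⟩)
    obtain ⟨q, hq⟩ := Int.not_odd_iff_even.1 hi'
    have := (h i).mem_Icc hcn y
    omega
  have htri : ∀ y z w, y ∉ W → z ∉ W → w ∉ W → G.Adj y z → G.Adj y w → G.Adj z w →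
      ∀ i, (if i ∈ O then 1 else 0) ≤ τ i y + τ i z + τ i w := by
    intro y z w hy hz hw hyz hyw hzw i
    split_ifs with hi
    · have h1 := (h i).add_eq hcn hy hz hyz
      have h2 := (h i).add_eq hcn hy hw hyw
      have h3 := (h i).add_eq hcn hz hw hzw
      obtain ⟨p, hp⟩ := hodd i hi y hy
      obtain ⟨q, hq⟩ := hodd i hi z hz
      obtain ⟨t, ht⟩ := hodd i hi w hw
      omega
    · have := heven i hi y
      have := heven i hi z
      have := heven i hi w
      omega
  have hsum : ∀ y z w, y ∉ W → z ∉ W → w ∉ W →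
      ∑ i, (τ i y + τ i z + τ i w) = 3 := by
    intro y z w hy hz hw
    rw [Finset.sum_add_distrib, Finset.sum_add_distrib, sum_potential_eq_one hcn h hy,
      sum_potential_eq_one hcn h hz, sum_potential_eq_one hcn h hw]
    norm_num
  have hO : ∑ i, (if i ∈ O then (1 : ℤ) else 0) = O.card := by simp
  have hO3 : O.card ≤ 3 := by
    obtain ⟨z, hz, hxz, -⟩ := hcn x x
    obtain ⟨w, hw, hxw, hzw⟩ := hcn x z
    have := Finset.sum_le_sum fun i (_ : i ∈ Finset.univ) => htri x z w hx hz hw hxz hxw hzw i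
    rw [hO, hsum x z w hx hz hw] at this
    exact_mod_cast this
  have hOodd : Odd O.card := by
    have h2 : (2 : ℤ) ∣ ∑ i, (τ i x - if i ∈ O then 1 else 0) := by
      refine Finset.dvd_sum fun i _ => ?_
      split_ifs with hi
      · obtain ⟨p, hp⟩ := hodd i hi x hx
        omega
      · have := heven i hi x
        omega
    rw [Finset.sum_sub_distrib, sum_potential_eq_one hcn h hx, hO] at h2
    rw [Nat.odd_iff]
    omega
  have hO13 : O.card = 1 ∨ O.card = 3 := by
    obtain ⟨p, hp⟩ := hOodd
    omega
  rcases hO13 with h1 | h3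
  · right
    obtain ⟨k, hk⟩ := Finset.card_eq_one.1 h1
    refine ⟨k, fun y hy => hodd k (by simp [hk]) y hy, fun i hi => heven i (by simp [hk, hi])⟩
  · left
    have hlt : O.card < (Finset.univ : Finset (Fin r)).card := by
      have : O.card ≤ r := by simpa using Finset.card_le_univ O
      simp
      omega
    obtain ⟨i, -, hi⟩ := Finset.exists_mem_notMem_of_card_lt_card hlt
    refine ⟨i, fun y => ?_⟩
    by_cases hy : y ∈ W
    · exact (h i).zero y hy
    obtain ⟨z, hz, hyz, -⟩ := hcn y y
    obtain ⟨w, hw, hyw, hzw⟩ := hcn y z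
    have heq := (Finset.sum_eq_sum_iff_of_le
      fun i (_ : i ∈ Finset.univ) => htri y z w hy hz hw hyz hyw hzw i).1
      (by rw [hO, hsum y z w hy hz hw, h3]; norm_num) i (Finset.mem_univ _)
    rw [if_neg hi] at heq
    have := heven i hi y
    have := heven i hi z
    have := heven i hi w
    omega

/-- If all potentials except that of `k` are even, they determine the color of an edge of `G - W`,
and no edge has two ends with nonzero even potentials. -/
lemma color_eq_of_potential {W : Finset V} (hcn : ∀ x y : V, ∃ z ∉ W, G.Adj x z ∧ G.Adj y z)
    {τ : Fin r → V → ℤ} (hτ : ∀ i, IsPotential G W χ i (τ i)) {k : Fin r}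
    (heven : ∀ i ≠ k, ∀ x, τ i x = 0 ∨ τ i x = 2) {u w : V} (hu : u ∉ W) (hw : w ∉ W)
    (huw : G.Adj u w) :
    ((∀ i ≠ k, τ i u ≠ 2) → (∀ i ≠ k, τ i w ≠ 2) → χ s(u, w) = k) ∧
    (∀ i ≠ k, τ i u = 2 → (∀ i ≠ k, τ i w ≠ 2) → χ s(u, w) = i) ∧
    ∀ i ≠ k, ∀ j ≠ k, τ i u = 2 → τ j w ≠ 2 := by
  have hzero : ∀ x, (∀ i ≠ k, τ i x ≠ 2) → ∀ i ≠ k, τ i x = 0 := fun x hx i hi =>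
    (heven i hi x).resolve_right (hx i hi)
  have hcol : ∀ i, 1 ≤ τ i u + τ i w → χ s(u, w) = i := by
    intro i hi
    by_contra hne
    have := (hτ i).add_eq hcn hu hw huw
    simp only [colorInd, if_neg hne] at this
    omega
  have hone : ∀ x ∉ W, (∀ i ≠ k, τ i x ≠ 2) → τ k x = 1 := by
    intro x hx hx2
    rw [← sum_potential_eq_one hcn hτ hx, Finset.sum_eq_single k (fun i _ hi => hzero x hx2 i hi)
      (by simp)]
  have hneg : ∀ x ∉ W, ∀ i ≠ k, τ i x = 2 → τ k x < 0 := by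
    intro x hx i hi h2
    have h1 := sum_potential_eq_one hcn hτ hx
    rw [← Finset.add_sum_erase _ _ (Finset.mem_univ k)] at h1
    have := Finset.single_le_sum (f := fun i => τ i x) (s := Finset.univ.erase k)
      (fun j hj => by rcases heven j (by simpa using hj) x with h | h <;> simp [h])
      (Finset.mem_erase.2 ⟨hi, Finset.mem_univ _⟩)
    omega
  refine ⟨fun h1 h2 => hcol k ?_, fun i hi h1 h2 => hcol i ?_, fun i hi j hj h1 h2 => ?_⟩
  · rw [hone u hu h1, hone w hw h2]
    norm_num
  · rw [h1, hzero w h2 i hi]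
    norm_num
  · have := (hτ k).add_eq hcn hu hw huw
    have := hneg u hu i hi h1
    have := hneg w hw j hj h2
    omega

end Potential

section Counting

variable {V : Type*} {G : SimpleGraph V}

lemma pathSum_add_ends (g : V → ℤ) (a : V) (l : List V) :
    pathSum (fun a b => g a + g b) (a :: l) + g ((a :: l).getLast (by simp)) + g a =
      2 * ((a :: l).map g).sum := by
  induction l generalizing a with
  | nil => simp; ring
  | cons b l ih =>
    have := ih b
    simp only [pathSum_cons_cons, List.map_cons, List.sum_cons, List.getLast_cons_cons] at this ⊢
    linarith

lemma two_mul_pathSum_le {f : V → V → ℤ} {g : V → ℤ}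
    (h : ∀ a b, G.Adj a b → 2 * f a b ≤ g a + g b) {l : List V} (hl : l.IsChain G.Adj) :
    2 * pathSum f l ≤ pathSum (fun a b => g a + g b) l := by
  induction l with
  | nil => simp
  | cons a l ih =>
    cases l with
    | nil => simp
    | cons b l =>
      have := ih hl.of_cons
      have := h a b hl.rel
      simp only [pathSum_cons_cons]
      linarith

lemma pathSum_map {M N : Type*} [AddCommMonoid M] [AddCommMonoid N] (φ : M →+ N)
    (f : V → V → M) (l : List V) : pathSum (fun a b => φ (f a b)) l = φ (pathSum f l) := by
  induction l with
  | nil => simp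
  | cons a l ih =>
    cases l with
    | nil => simp
    | cons b l => simp only [pathSum_cons_cons, map_add, ih]

lemma cycleSum_map {M N : Type*} [AddCommMonoid M] [AddCommMonoid N] (φ : M →+ N)
    (f : V → V → M) (l : List V) : cycleSum (fun a b => φ (f a b)) l = φ (cycleSum f l) := by
  rw [cycleSum, cycleSum, map_add, pathSum_map]
  congr 1
  cases l.getLast? <;> cases l.head? <;> simp [jointWeight]

variable [Fintype V]

/-- A bound for the sum of edge weights along a Hamilton cycle by a sum of vertex weights. -/
lemma IsHamiltonList.cycleSum_le [Nonempty V] {l : List V} (hl : IsHamiltonList G l)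
    {f : V → V → ℤ} {g : V → ℤ} (h : ∀ a b, G.Adj a b → 2 * f a b ≤ g a + g b) :
    cycleSum f l ≤ ∑ x, g x := by
  classical
  have hsum : ∑ x, g x = (l.map g).sum := by
    rw [← List.sum_toFinset _ hl.nodup]
    exact Finset.sum_congr (by ext x; simp [hl.mem x]) fun _ _ => rfl
  obtain ⟨v⟩ := ‹Nonempty V›
  cases l with
  | nil => exact absurd (hl.mem v) (by simp)
  | cons a l =>
    have h1 := pathSum_add_ends g a l
    have h2 := two_mul_pathSum_le h hl.isChain
    have h3 := h _ _ (hl.closed _ (List.getLast_mem_getLast? (by simp)) a (by simp))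
    rw [hsum, cycleSum, List.getLast?_eq_some_getLast (by simp), List.head?_cons,
      jointWeight_some_some]
    linarith

variable [DecidableEq V] {r : ℕ} {χ : Sym2 V → Fin r} {c : Fin r} {W : Finset V}

/-- The number of edges of color `c` in a Hamilton cycle is nearly determined by a potential. -/
lemma IsPotential.abs_cycleSum_sub_le [Nonempty V]
    (hcn : ∀ x y : V, ∃ z ∉ W, G.Adj x z ∧ G.Adj y z) {τ : V → ℤ} (h : IsPotential G W χ c τ)
    {l : List V} (hl : IsHamiltonList G l) :
    |((cycleSum (colorInd χ c) l : ℕ) : ℤ) - ∑ x, τ x| ≤ 3 * W.card := by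
  have hsum : ∑ x, (if x ∈ W then (3 : ℤ) else 0) = 3 * W.card := by
    simp [mul_comm]
  have hle : ∀ a b, G.Adj a b →
      2 * (colorInd χ c a b : ℤ) ≤
        (τ a + if a ∈ W then 3 else 0) + (τ b + if b ∈ W then 3 else 0) ∧
      2 * (-colorInd χ c a b : ℤ) ≤
        (-τ a + if a ∈ W then 3 else 0) + (-τ b + if b ∈ W then 3 else 0) := by
    intro a b hab
    have h1 := h.mem_Icc hcn a
    have h2 := h.mem_Icc hcn b
    have h3 : (colorInd χ c a b : ℤ) = 0 ∨ (colorInd χ c a b : ℤ) = 1 := by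
      unfold colorInd; split_ifs <;> simp
    by_cases ha : a ∈ W <;> by_cases hb : b ∈ W
    · have := h.zero a ha; have := h.zero b hb
      simp only [ha, hb, if_true]; omega
    · have := h.zero a ha
      simp only [ha, hb, if_true, if_false]; omega
    · have := h.zero b hb
      simp only [ha, hb, if_true, if_false]; omega
    · have := h.add_eq hcn ha hb hab
      simp only [ha, hb, if_false]; omega
  have h1 := hl.cycleSum_le fun a b hab => (hle a b hab).1
  have h2 := hl.cycleSum_le fun a b hab => (hle a b hab).2
  rw [Finset.sum_add_distrib, hsum] at h1 h2
  rw [Finset.sum_neg_distrib] at h2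
  have e1 := cycleSum_map (Nat.castAddMonoidHom ℤ) (colorInd χ c) l
  have e2 := cycleSum_map (-Nat.castAddMonoidHom ℤ) (colorInd χ c) l
  simp only [AddMonoidHom.neg_apply, Nat.coe_castAddMonoidHom] at e1 e2
  rw [e1] at h1
  rw [e2] at h2
  rw [abs_le]
  constructor <;> linarith

end Counting

section Partition

/-- A matching is at most as large as any vertex cover. -/
lemma HasMatchingOn.le_card {V : Type*} {s : ℕ} {Q : Sym2 V → Prop} (hs : HasMatchingOn s Q)
    {X : Finset V} (hX : ∀ e, Q e → ∃ x ∈ X, x ∈ e) : s ≤ X.card := by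
  obtain ⟨M, rfl, hQ, hM⟩ := hs
  have : ∀ e, ∃ x, Q e → x ∈ X ∧ x ∈ e := fun e => by
    by_cases he : Q e
    · obtain ⟨x, hx⟩ := hX e he
      exact ⟨x, fun _ => hx⟩
    · exact ⟨e.out.1, fun h => absurd h he⟩
  choose g hg using this
  refine Finset.card_le_card_of_injOn g (fun e he => (hg e (hQ e he)).1) fun e he e' he' heq => ?_
  by_contra hne
  exact hM he he' hne (g e) (hg e (hQ e he)).2 (heq ▸ (hg e' (hQ e' he')).2)

variable {V : Type*} [Fintype V] [DecidableEq V] {r h : ℕ}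

/-- Disjoint sets of size at most `h` can be enlarged to disjoint sets of size `h`. -/
lemma exists_disjoint_extension (hV : Fintype.card V = 2 * r * h) (k : Fin r)
    {A : Fin r → Finset V} (hA : ∀ i ≠ k, ∀ j ≠ k, i ≠ j → Disjoint (A i) (A j))
    (hAh : ∀ i ≠ k, (A i).card ≤ h) :
    ∃ P : Fin r → Finset V, (∀ i ≠ k, ∀ j ≠ k, i ≠ j → Disjoint (P i) (P j)) ∧
      ∀ i ≠ k, A i ⊆ P i ∧ (P i).card = h := by
  suffices key : ∀ J : Finset (Fin r), k ∉ J → ∃ P : Fin r → Finset V,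
      (∀ i ≠ k, ∀ j ≠ k, i ≠ j → Disjoint (P i) (P j)) ∧
      (∀ i ≠ k, A i ⊆ P i ∧ (P i).card ≤ h) ∧ ∀ i ∈ J, (P i).card = h by
    obtain ⟨P, h1, h2, h3⟩ := key (Finset.univ.erase k) (by simp)
    exact ⟨P, h1, fun i hi => ⟨(h2 i hi).1, h3 i (by simp [hi])⟩⟩
  intro J
  induction J using Finset.induction_on with
  | empty => exact fun _ => ⟨A, hA, fun i hi => ⟨subset_rfl, hAh i hi⟩, by simp⟩
  | insert j J hj ih =>
    intro hk
    simp only [Finset.mem_insert, not_or] at hk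
    obtain ⟨P, h1, h2, h3⟩ := ih hk.2
    have hjk : j ≠ k := Ne.symm hk.1
    let B := (Finset.univ.erase k).biUnion P
    have hB : B.card ≤ r * h := by
      refine (Finset.card_biUnion_le_card_mul _ _ h fun i hi => (h2 i (by simpa using hi)).2).trans
        (Nat.mul_le_mul_right _ ?_)
      simp
    have hr : 1 ≤ r := k.pos
    have hBc : h ≤ (Bᶜ).card := by
      rw [Finset.card_compl, hV]
      nlinarith [Nat.sub_add_cancel (show B.card ≤ 2 * r * h by nlinarith)]
    obtain ⟨C, hCB, hC⟩ := Finset.exists_subset_card_eq (show h - (P j).card ≤ (Bᶜ).card by omega)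
    have hCP : ∀ i ≠ k, Disjoint C (P i) := fun i hi => by
      refine (Finset.disjoint_of_subset_left hCB ?_)
      exact (disjoint_compl_left.mono_right
        (Finset.subset_biUnion_of_mem P (by simp [hi]) : P i ⊆ B))
    have hcard : (P j ∪ C).card = h := by
      rw [Finset.card_union_of_disjoint (hCP j hjk).symm, hC]
      have := (h2 j hjk).2
      omega
    refine ⟨Function.update P j (P j ∪ C), ?_, ?_, ?_⟩
    · intro i hi i' hi' hii'
      by_cases e : i = j
      · subst e
        rw [Function.update_self, Function.update_of_ne hii'.symm, Finset.disjoint_union_left]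
        exact ⟨h1 _ hi _ hi' hii', hCP _ hi'⟩
      by_cases e' : i' = j
      · subst e'
        rw [Function.update_self, Function.update_of_ne hii', Finset.disjoint_union_right]
        exact ⟨h1 _ hi _ hi' hii', (hCP _ hi).symm⟩
      rw [Function.update_of_ne e, Function.update_of_ne e']
      exact h1 _ hi _ hi' hii'
    · intro i hi
      by_cases e : i = j
      · subst e
        rw [Function.update_self]
        exact ⟨(h2 i hi).1.trans Finset.subset_union_left, hcard.le⟩
      · rw [Function.update_of_ne e]
        exact h2 i hi
    · intro i hi
      by_cases e : i = j
      · subst e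
        rwa [Function.update_self]
      · rw [Function.update_of_ne e]
        exact h3 i ((Finset.mem_insert.1 hi).resolve_left e)

/-- Disjoint sets can be turned into a partition with prescribed sizes by few changes. -/
lemma exists_partition_near (hV : Fintype.card V = 2 * r * h) (k : Fin r)
    {S : Fin r → Finset V} (hS : ∀ i ≠ k, ∀ j ≠ k, i ≠ j → Disjoint (S i) (S j)) :
    ∃ P : Fin r → Finset V, (∀ i j, i ≠ j → Disjoint (P i) (P j)) ∧
      Finset.univ.biUnion P = Finset.univ ∧ (P k).card = (r + 1) * h ∧
      ∀ i ≠ k, (P i).card = h ∧ (S i \ P i).card ≤ (S i).card - h ∧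
        (P i \ S i).card ≤ h - (S i).card := by
  have hex : ∀ i, ∃ A ⊆ S i, A.card = min h (S i).card := fun i =>
    Finset.exists_subset_card_eq (min_le_right _ _)
  choose A hAS hA using hex
  obtain ⟨P, h1, h2⟩ := exists_disjoint_extension hV k (A := A)
    (fun i hi j hj hij => (hS i hi j hj hij).mono (hAS i) (hAS j))
    (fun i _ => (hA i).trans_le (min_le_left _ _))
  let B := (Finset.univ.erase k).biUnion P
  have hPB : ∀ i ≠ k, P i ⊆ B := fun i hi => Finset.subset_biUnion_of_mem P (by simp [hi])
  have hB : B.card = (r - 1) * h := by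
    rw [Finset.card_biUnion, Finset.sum_congr rfl fun i hi => (h2 i (by simpa using hi)).2]
    · simp
    · intro i hi j hj hij
      exact h1 i (by simpa using hi) j (by simpa using hj) hij
  have hval : ∀ i ≠ k, Function.update P k Bᶜ i = P i := fun i hi => Function.update_of_ne hi _ _
  refine ⟨Function.update P k Bᶜ, ?_, ?_, ?_, ?_⟩
  · intro i j hij
    by_cases hi : i = k
    · subst hi
      rw [Function.update_self, hval j hij.symm]
      exact disjoint_compl_left.mono_right (hPB j hij.symm)
    by_cases hj : j = k
    · subst hj
      rw [Function.update_self, hval i hi]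
      exact disjoint_compl_right.mono_left (hPB i hi)
    rw [hval i hi, hval j hj]
    exact h1 i hi j hj hij
  · refine Finset.eq_univ_of_forall fun x => ?_
    by_cases hx : x ∈ B
    · obtain ⟨i, hi, hxi⟩ := Finset.mem_biUnion.1 hx
      exact Finset.mem_biUnion.2 ⟨i, Finset.mem_univ _, by rwa [hval i (by simpa using hi)]⟩
    · exact Finset.mem_biUnion.2 ⟨k, Finset.mem_univ _, by simpa using hx⟩
  · rw [Function.update_self, Finset.card_compl, hV, hB]
    obtain ⟨t, rfl⟩ : ∃ t, r = t + 1 := ⟨r - 1, by have := k.pos; omega⟩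
    rw [Nat.add_sub_cancel]
    apply Nat.sub_eq_of_eq_add
    ring
  · intro i hi
    rw [hval i hi]
    obtain ⟨hAP, hPi⟩ := h2 i hi
    refine ⟨hPi, ?_, ?_⟩
    · refine (Finset.card_le_card (Finset.sdiff_subset_sdiff subset_rfl hAP)).trans ?_
      rw [Finset.card_sdiff_of_subset (hAS i), hA]
      omega
    · refine (Finset.card_le_card (Finset.sdiff_subset_sdiff subset_rfl (hAS i))).trans ?_
      rw [Finset.card_sdiff_of_subset hAP, hA, hPi]
      omega

end Partition

section Structure

variable {V : Type*} [Fintype V] [DecidableEq V] [Nonempty V] {G : SimpleGraph V}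
  [DecidableRel G.Adj] {r m h : ℕ} {χ : Sym2 V → Fin r}

/-- A bounded vertex set can be deleted so that no short switch changes any color count. -/
lemma exists_forall_switch_eq (hr : 2 ≤ r) (hm : 1 ≤ m)
    (hdeg : ∀ x, Fintype.card V + 12 * r ^ 2 * m ≤ 2 * G.degree x)
    (hbias : ∀ l, IsHamiltonList G l → ∀ c,
      |((cycleSum (colorInd χ c) l : ℕ) : ℤ) - 2 * h| < m) :
    ∃ W : Finset V, W.card ≤ 14 * r * m ∧ ∀ (c : Fin r) (p q : List V), IsSwitch G p q →
      p.length ≤ 6 → (∀ x ∈ p, x ∉ W) →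
      pathSum (colorInd χ c) p = pathSum (colorInd χ c) q := by
  have hex : ∀ c : Fin r, ∃ W : Finset V, W.card ≤ 14 * m ∧ ∀ p q : List V, IsSwitch G p q →
      p.length ≤ 6 → (∀ x ∈ p, x ∉ W) →
      pathSum (colorInd χ c) p ≤ pathSum (colorInd χ c) q := fun c => by
    refine exists_switch_free hdeg hm (by nlinarith [Nat.mul_le_mul hr hr]) fun l l' hl hl' => ?_
    have h1 := abs_lt.1 (hbias l hl c)
    have h2 := abs_lt.1 (hbias l' hl' c)
    omega
  choose W hW hfree using hex
  refine ⟨Finset.univ.biUnion W, ?_, fun c p q hpq hp hpW => ?_⟩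
  · refine (Finset.card_biUnion_le_card_mul _ _ _ fun c _ => hW c).trans (le_of_eq ?_)
    simp
    ring
  · have hpW' : ∀ x ∈ p, x ∉ W c := fun x hx hxW =>
      hpW x hx (Finset.mem_biUnion.2 ⟨c, Finset.mem_univ _, hxW⟩)
    refine le_antisymm (hfree c p q hpq hp hpW') (hfree c q p hpq.symm ?_ fun x hx => ?_)
    · rwa [hpq.perm.length_eq]
    · exact hpW' x (hpq.perm.mem_iff.1 hx)

/-- If all Hamilton cycles are nearly color-balanced, then up to a small vertex set `X` the
coloring is the extremal one. -/
lemma exists_partition_of_bias (hr : 2 ≤ r) (hr3 : r ≠ 3) (hm : 1 ≤ m)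
    (hV : Fintype.card V = 2 * r * h)
    (hdeg : ∀ x, Fintype.card V + 12 * r ^ 2 * m ≤ 2 * G.degree x)
    (hbias : ∀ l, IsHamiltonList G l → ∀ c,
      |((cycleSum (colorInd χ c) l : ℕ) : ℤ) - 2 * h| < m) :
    ∃ (k : Fin r) (P : Fin r → Finset V) (X : Finset V),
      (∀ i j, i ≠ j → Disjoint (P i) (P j)) ∧ Finset.univ.biUnion P = Finset.univ ∧
      (P k).card = (r + 1) * h ∧ (∀ i ≠ k, (P i).card = h) ∧ X.card < 100 * r ^ 2 * m ∧
      ∀ u ∉ X, ∀ w ∉ X, G.Adj u w →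
        (u ∈ P k → w ∈ P k → χ s(u, w) = k) ∧
        (∀ i ≠ k, u ∈ P i → w ∈ P k → χ s(u, w) = i) ∧
        ∀ i ≠ k, ∀ j ≠ k, u ∈ P i → w ∉ P j := by
  by_cases hn : Fintype.card V < 100 * r ^ 2 * m
  · obtain ⟨P, h1, h2, h3, h4⟩ := exists_partition_near hV ⟨0, by omega⟩ (S := fun _ => ∅)
      (by simp)
    exact ⟨_, P, Finset.univ, h1, h2, h3, fun i hi => (h4 i hi).1, by simpa using hn, by simp⟩
  have hrm : 4 ≤ r ^ 2 * m := by nlinarith [Nat.mul_le_mul hr hr]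
  have hrm2 : 2 * (r * m) ≤ r ^ 2 * m := by nlinarith
  have hrm1 : 2 ≤ r * m := by nlinarith
  obtain ⟨W, hW, hfree⟩ := exists_forall_switch_eq hr hm hdeg hbias
  have hcn4 : ∀ x y : V, ∀ F : Finset V, F.card ≤ 4 →
      ∃ z ∉ F, z ∉ W ∧ G.Adj x z ∧ G.Adj y z := by
    intro x y F hF
    obtain ⟨z, hz, h1, h2⟩ := exists_common_neighbor hdeg x y (F := F ∪ W) (by
      have := Finset.card_union_le F W
      nlinarith)
    simp only [Finset.mem_union, not_or] at hz
    exact ⟨z, hz.1, hz.2, h1, h2⟩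
  have hcn : ∀ x y : V, ∃ z ∉ W, G.Adj x z ∧ G.Adj y z := fun x y => by
    obtain ⟨z, -, h⟩ := hcn4 x y ∅ (by simp)
    exact ⟨z, h⟩
  have hex : ∀ c, ∃ τ : V → ℤ, IsPotential G W χ c τ := fun c => exists_isPotential hcn4 (hfree c)
  choose τ hτ using hex
  obtain ⟨l, hl⟩ : ∃ l, IsHamiltonList G l := by
    obtain ⟨v⟩ := ‹Nonempty V›
    obtain ⟨w, -, hvw, -⟩ := hcn v v
    obtain ⟨l, -, hl, -⟩ := (IsSwitch.refl (G := G) (p := [v, w]) (by simp [hvw.ne])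
      (by simp [hvw])).exists_isHamiltonList (by simp) (fun x => by
        have := hdeg x
        simp only [List.length_cons, List.length_nil]
        nlinarith)
    exact ⟨l, hl⟩
  have hsum : ∀ c, |∑ x, τ c x - 2 * h| < (43 * r * m : ℕ) := by
    intro c
    have h1 := abs_le.1 ((hτ c).abs_cycleSum_sub_le hcn hl)
    have h2 := abs_lt.1 (hbias l hl c)
    have h3 : 3 * (W.card : ℤ) + m ≤ (43 * r * m : ℕ) := by
      have : 3 * W.card + m ≤ 43 * r * m := by nlinarith
      exact_mod_cast this
    rw [abs_lt]
    constructor <;> linarith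
  rcases exists_even_potential hcn hr3 hτ with ⟨i, hi⟩ | ⟨k, -, heven⟩
  · exfalso
    have h1 := hsum i
    simp only [hi, Finset.sum_const_zero, zero_sub, abs_neg] at h1
    rw [abs_of_nonneg (by positivity)] at h1
    have h2 : 2 * h < 43 * r * m := by exact_mod_cast h1
    rw [hV] at hn
    nlinarith [Nat.mul_lt_mul_of_pos_left h2 (show 0 < r by omega)]
  let S : Fin r → Finset V := fun i => Finset.univ.filter fun x => τ i x = 2
  have hS : ∀ i x, x ∈ S i ↔ τ i x = 2 := fun i x => by simp [S]
  have hSsum : ∀ i ≠ k, ∑ x, τ i x = 2 * (S i).card := by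
    intro i hi
    rw [Finset.card_filter, Nat.cast_sum, Finset.mul_sum]
    refine Finset.sum_congr rfl fun x _ => ?_
    rcases heven i hi x with h | h <;> simp [h]
  have hSdisj : ∀ i ≠ k, ∀ j ≠ k, i ≠ j → Disjoint (S i) (S j) := by
    intro i hi j hj hij
    rw [Finset.disjoint_left]
    intro x hxi hxj
    rw [hS] at hxi hxj
    have hx : x ∉ W := fun hx => by
      rw [(hτ i).zero x hx] at hxi
      omega
    have h1 := sum_potential_eq_one hcn hτ hx
    have hjm : j ∈ (Finset.univ.erase k).erase i := by simp [hj, hij.symm]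
    rw [← Finset.add_sum_erase _ _ (Finset.mem_univ k), ← Finset.add_sum_erase _ _
      (Finset.mem_erase.2 ⟨hi, Finset.mem_univ i⟩)] at h1
    have h2 := Finset.single_le_sum (f := fun i => τ i x) (s := (Finset.univ.erase k).erase i)
      (fun j hj => by
        rcases heven j (by simp at hj; exact hj.2) x with h | h <;> simp [h]) hjm
    have := ((hτ k).mem_Icc hcn x).1
    omega
  obtain ⟨P, h1, h2, h3, h4⟩ := exists_partition_near hV k hSdisj
  let D : Finset V := (Finset.univ.erase k).biUnion fun i => (S i \ P i) ∪ (P i \ S i)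
  have hD : D.card ≤ r * (22 * r * m) := by
    refine (Finset.card_biUnion_le_card_mul _ _ (22 * r * m) fun i hi => ?_).trans
      (Nat.mul_le_mul_right _ (by simp))
    have hik : i ≠ k := by simpa using hi
    have h5 := abs_lt.1 (hsum i)
    rw [hSsum i hik] at h5
    obtain ⟨-, h6, h7⟩ := h4 i hik
    refine (Finset.card_union_le _ _).trans ?_
    have e1 : 43 * r * m = 43 * (r * m) := by ring
    have e2 : 22 * r * m = 22 * (r * m) := by ring
    rw [e1] at h5
    rw [e2]
    omega
  have hPS : ∀ x ∉ D, ∀ i ≠ k, (x ∈ P i ↔ τ i x = 2) := by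
    intro x hx i hi
    rw [← hS]
    have : x ∉ (S i \ P i) ∪ (P i \ S i) := fun h =>
      hx (Finset.mem_biUnion.2 ⟨i, by simp [hi], h⟩)
    simp only [Finset.mem_union, Finset.mem_sdiff] at this
    tauto
  have hPk : ∀ x ∉ D, x ∈ P k → ∀ i ≠ k, τ i x ≠ 2 := fun x hx hxk i hi h =>
    Finset.disjoint_left.1 (h1 k i hi.symm) hxk ((hPS x hx i hi).2 h)
  refine ⟨k, P, W ∪ D, h1, h2, h3, fun i hi => (h4 i hi).1, ?_, ?_⟩
  · have := Finset.card_union_le W D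
    nlinarith
  intro u hu w hw huw
  simp only [Finset.mem_union, not_or] at hu hw
  obtain ⟨c1, c2, c3⟩ := color_eq_of_potential hcn hτ heven hu.1 hw.1 huw
  refine ⟨fun hu' hw' => c1 (hPk u hu.2 hu') (hPk w hw.2 hw'), fun i hi hu' hw' =>
    c2 i hi ((hPS u hu.2 i hi).1 hu') (hPk w hw.2 hw'), fun i hi j hj hu' hw' =>
    c3 i hi j hj ((hPS u hu.2 i hi).1 hu') ((hPS w hw.2 j hj).1 hw')⟩

end Structure

/-- Main stability theorem for `r ≥ 2`, `r ≠ 3`: for sufficiently large `n` with `2r ∣ n`,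
if `G` is an `n`-vertex graph with `δ(G) ≥ n/2 + 6r²m` (where `m < 2⁻⁶r²n`, `s = 100r²m`)
and every Hamilton cycle of `G` has color-bias less than `m`, then there are a color `k` and
a partition `V(G) = V₁ ∪ ⋯ ∪ V_r` with `|V_k| = (r+1)n/(2r)` and `|V_i| = n/(2r)` for
`i ≠ k`, such that `G[V_k]` is `(s,k)`-nearly monochromatic, `G[V_i, V_k]` is `(s,i)`-nearly
monochromatic for each `i ≠ k`, and `G[⋃_{i ≠ k} V_i]` is `s`-nearly empty. -/
theorem statement1 (r : ℕ) (hr : 2 ≤ r) (hr3 : r ≠ 3) :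
    ∃ N : ℕ, ∀ (V : Type) [Fintype V] [DecidableEq V], ∀ n m s : ℕ,
      n = Fintype.card V → N ≤ n → 2 * r ∣ n →
      1 ≤ m → 2 ^ 6 * m < r ^ 2 * n → s = 100 * r ^ 2 * m →
      ∀ (G : SimpleGraph V) [DecidableRel G.Adj],
        (n : ℚ) / 2 + 6 * r ^ 2 * m ≤ (G.minDegree : ℚ) →
        ∀ χ : Sym2 V → Fin r,
          (∀ (v : V) (H : G.Walk v v), H.IsHamiltonianCycle →
            ∀ i : Fin r,
              |((H.edges.filter (fun e => χ e = i)).length : ℚ) - (n : ℚ) / r| < m) →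
          ∃ (k : Fin r) (P : Fin r → Finset V),
            (∀ i j : Fin r, i ≠ j → Disjoint (P i) (P j)) ∧
            Finset.univ.biUnion P = Finset.univ ∧
            2 * r * (P k).card = (r + 1) * n ∧
            (∀ i : Fin r, i ≠ k → 2 * r * (P i).card = n) ∧
            ¬ HasMatchingOn s
              (fun ed => ed ∈ G.edgeSet ∧ (∀ x ∈ ed, x ∈ P k) ∧ χ ed ≠ k) ∧
            (∀ i : Fin r, i ≠ k → ¬ HasMatchingOn s
              (fun ed => (∃ u w : V, ed = s(u, w) ∧ G.Adj u w ∧ u ∈ P i ∧ w ∈ P k) ∧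
                χ ed ≠ i)) ∧
            ¬ HasMatchingOn s
              (fun ed => ed ∈ G.edgeSet ∧ ∀ x ∈ ed, ∃ i : Fin r, i ≠ k ∧ x ∈ P i) := by
  refine ⟨1, ?_⟩
  rintro V _ _ n m s rfl hN ⟨h, hV⟩ hm - rfl G _ hdelta χ hbias
  have hne : Nonempty V := Fintype.card_pos_iff.1 hN
  have hdeg : ∀ x, Fintype.card V + 12 * r ^ 2 * m ≤ 2 * G.degree x := by
    intro x
    have h1 : (G.minDegree : ℚ) ≤ G.degree x := by exact_mod_cast G.minDegree_le_degree x
    have h2 : ((Fintype.card V + 12 * r ^ 2 * m : ℕ) : ℚ) ≤ (2 * G.degree x : ℕ) := by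
      push_cast
      linarith
    exact_mod_cast h2
  have hV3 : 3 ≤ Fintype.card V := by
    obtain ⟨v⟩ := hne
    have := hdeg v
    have := G.degree_lt_card_verts v
    nlinarith [Nat.mul_le_mul hr hr]
  have hbias' : ∀ l, IsHamiltonList G l → ∀ c,
      |((cycleSum (colorInd χ c) l : ℕ) : ℤ) - 2 * h| < m := by
    intro l hl c
    obtain ⟨v, H, hH, hcount⟩ := hl.exists_isHamiltonianCycle hV3
    have h1 := hbias v H hH c
    have h2 : ((H.edges.filter fun e => χ e = c).length) = cycleSum (colorInd χ c) l :=
      hcount fun e => χ e = c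
    have h3 : ((Fintype.card V : ℕ) : ℚ) / r = 2 * h := by
      rw [hV]
      push_cast
      field_simp
    rw [h2, h3] at h1
    exact_mod_cast h1
  obtain ⟨k, P, X, hdisj, hcover, hk, hi, hX, hcol⟩ :=
    exists_partition_of_bias hr hr3 hm hV hdeg hbias'
  have key : ∀ Q : Sym2 V → Prop, (∀ e, Q e → ∃ x ∈ X, x ∈ e) →
      ¬ HasMatchingOn (100 * r ^ 2 * m) Q := fun Q hQ hM =>
    (hM.le_card hQ).not_gt hX
  have key' : ∀ Q : Sym2 V → Prop, (∀ u ∉ X, ∀ w ∉ X, ¬ Q s(u, w)) →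
      ¬ HasMatchingOn (100 * r ^ 2 * m) Q := by
    refine fun Q hQ => key Q fun e => e.ind fun u w he => ?_
    by_contra! hcon
    exact hQ u (fun hu => hcon u hu (Sym2.mem_mk_left u w)) w
      (fun hw => hcon w hw (Sym2.mem_mk_right u w)) he
  refine ⟨k, P, hdisj, hcover, ?_, fun i hik => ?_, key' _ ?_, fun i hik => key _ ?_, key' _ ?_⟩
  · rw [hk, hV]
    ring
  · rw [hi i hik, hV]
  · rintro u hu w hw ⟨huw, hP, hc⟩
    exact hc ((hcol u hu w hw huw).1 (hP u (Sym2.mem_mk_left u w)) (hP w (Sym2.mem_mk_right u w)))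
  · rintro _ ⟨⟨u, w, rfl, huw, hu, hw⟩, hc⟩
    by_contra! hcon
    exact hc ((hcol u (fun h => hcon u h (Sym2.mem_mk_left u w)) w
      (fun h => hcon w h (Sym2.mem_mk_right u w)) huw).2.1 i hik hu hw)
  · rintro u hu w hw ⟨huw, hP⟩
    obtain ⟨i, hik, hui⟩ := hP u (Sym2.mem_mk_left u w)
    obtain ⟨j, hjk, hwj⟩ := hP w (Sym2.mem_mk_right u w)
    exact (hcol u hu w hw huw).2.2 i hik j hjk hui hwj
end

section
/- For all sufficiently large n with 6 | n, let m and s be positive integers with m < 2⁻⁶ · 9 · n and s = 900m, let G be an n-vertex graph with minimum degree δ(G) ≥ n/2 + 54m, and let χ : E(G) → [3] be an edge-coloring such that every Hamilton cycle H of G satisfies d_χ(H) < m. Then one of the following occurs. (1) There is a partition V(G) = V₁ ∪ V₂ ∪ V₃ with |V₁| = |V₂| = |V₃| = n/3 such that for all distinct i, j, k ∈ [3]: the subgraph G[V_i] is s-nearly empty, and the bipartite subgraph G[V_i, V_j] is (s,k)-nearly monochromatic. (2) There are a color k ∈ [3] and a partition V(G) = V₁ ∪ V₂ ∪ V₃ with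 |V_k| = 2n/3 and |V_i| = n/6 for both i ∈ [3]∖{k}, such that: G[V_k] is (s,k)-nearly monochromatic; for each i ≠ k, G[V_i, V_k] is (s,i)-nearly monochromatic; and G[⋃_{i ∈ [3]∖{k}} V_i] is s-nearly empty. -/
open SimpleGraph

section HamiltonCycles

variable {V : Type} [DecidableEq V] {G : SimpleGraph V} [DecidableRel G.Adj]

omit [DecidableEq V] in
lemma exists_consecutive (p q : V → Prop) [DecidablePred p] [DecidablePred q] :
    ∀ l : List V, l.length < l.countP (p ·) + l.tail.countP (q ·) →
      ∃ l₁ u v l₂, l = l₁ ++ u :: v :: l₂ ∧ p u ∧ q v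
  | [] => by simp
  | [x] => by
      intro h
      have := List.countP_le_length (p := (p ·)) (l := [x])
      simp only [List.tail_cons, List.countP_nil] at h
      omega
  | x :: y :: t => by
      intro h
      by_cases hxy : p x ∧ q y
      · exact ⟨[], x, y, t, rfl, hxy⟩
      · have : (y :: t).length < (y :: t).countP (p ·) + (y :: t).tail.countP (q ·) := by
          rw [List.countP_cons (a := x), List.tail_cons,
            List.countP_cons (a := y) (p := (q ·))] at h
          simp only [List.length_cons, List.tail_cons, decide_eq_true_eq] at h ⊢
          by_cases hx : p x <;> by_cases hy : q y <;> simp [hx, hy] at h hxy <;> omega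
        obtain ⟨l₁, u, v, l₂, e, hu, hv⟩ := exists_consecutive p q (y :: t) this
        exact ⟨x :: l₁, u, v, l₂, by rw [e]; rfl, hu, hv⟩

lemma countP_eq_card_filter (p : V → Prop) [DecidablePred p] {l : List V} (hl : l.Nodup)
    {S : Finset V} (hS : ∀ v ∈ S, p v → v ∈ l) (hS' : ∀ v ∈ l, v ∈ S) :
    l.countP (p ·) = (S.filter p).card := by
  rw [List.countP_eq_length_filter, ← List.toFinset_card_of_nodup (hl.filter _)]
  congr 1
  ext v
  simp only [List.mem_toFinset, List.mem_filter, decide_eq_true_eq, Finset.mem_filter]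
  exact ⟨fun h => ⟨hS' v h.1, h.2⟩, fun h => ⟨hS v h.1 h.2, h.2⟩⟩

/-- Pósa's rotation: a path inside `S` all of whose extensions inside `S` are blocked
closes up to a cycle. -/
lemma exists_closed_of_path {S : Finset V}
    (hdeg : ∀ v ∈ S, S.card + 2 ≤ 2 * (S.filter (G.Adj v)).card)
    {P : List V} (hP : P.Nodup) (hPS : ∀ v ∈ P, v ∈ S) (hc : P.IsChain G.Adj)
    {a z : V} (ha : a ∈ P.head?) (hz : z ∈ P.getLast?)
    (haP : ∀ v ∈ S, G.Adj a v → v ∈ P) (hzP : ∀ v ∈ S, G.Adj z v → v ∈ P) :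
    ∃ L : List V, L.Perm P ∧ (L ++ L).IsChain G.Adj := by
  have haS := hPS a (List.mem_of_mem_head? ha)
  have hzS := hPS z (List.mem_of_mem_getLast? hz)
  have hlen : P.length ≤ S.card := by
    rw [← List.toFinset_card_of_nodup hP]
    exact Finset.card_le_card fun v hv => hPS v (List.mem_toFinset.1 hv)
  have h1 := countP_eq_card_filter (G.Adj a) hP haP hPS
  have h2 := countP_eq_card_filter (G.Adj z) hP hzP hPS
  have h3 : P.tail.countP (G.Adj a ·) = P.countP (G.Adj a ·) := by
    cases P with
    | nil => rfl
    | cons b t =>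
      obtain rfl : b = a := by simpa using ha
      simp
  obtain ⟨l₁, u, v, l₂, rfl, hu, hv⟩ := exists_consecutive (G.Adj z) (G.Adj a) P (by
    have := hdeg a haS
    have := hdeg z hzS
    omega)
  refine ⟨l₁ ++ u :: (v :: l₂).reverse, ?_, ?_⟩
  · exact ((List.reverse_perm _).cons u).append_left l₁
  · have hz' : z ∈ (v :: l₂).getLast? := by
      simpa [List.getLast?_append, List.getLast?_cons_cons] using hz
    have hsplit : (l₁ ++ [u]).IsChain G.Adj ∧ (v :: l₂).IsChain G.Adj := by
      rw [show l₁ ++ u :: v :: l₂ = (l₁ ++ [u]) ++ v :: l₂ by simp] at hc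
      exact ⟨hc.left_of_append, hc.right_of_append⟩
    have hrev : (v :: l₂).reverse.IsChain G.Adj := by
      rw [List.isChain_reverse]
      exact hsplit.2.imp fun _ _ h => h.symm
    have ha' : a ∈ (l₁ ++ [u]).head? := by
      cases l₁ <;> simpa using ha
    have hL : ((l₁ ++ [u]) ++ (v :: l₂).reverse).IsChain G.Adj := by
      refine hsplit.1.append hrev ?_
      intro x hx y hy
      rw [List.head?_reverse] at hy
      obtain rfl : u = x := by simpa using hx
      obtain rfl : z = y := Option.mem_unique hz' hy
      exact hu.symm
    rw [show l₁ ++ u :: (v :: l₂).reverse = (l₁ ++ [u]) ++ (v :: l₂).reverse by simp]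
    refine hL.append hL ?_
    intro x hx y hy
    obtain rfl : v = x := by simpa [List.getLast?_append, List.getLast?_cons] using hx
    obtain rfl : a = y := by
      rw [List.head?_append_of_ne_nil _ (by simp)] at hy
      simpa using ha'.symm.trans hy
    exact hv.symm

lemma exists_longer_path {S : Finset V}
    (hdeg : ∀ v ∈ S, S.card + 2 ≤ 2 * (S.filter (G.Adj v)).card)
    {P : List V} (hne : P ≠ []) (hP : P.Nodup) (hPS : ∀ v ∈ P, v ∈ S) (hc : P.IsChain G.Adj)
    (hlt : P.length < S.card) :
    ∃ Q : List V, Q.length = P.length + 1 ∧ Q.Nodup ∧ (∀ v ∈ Q, v ∈ S) ∧ Q.IsChain G.Adj := by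
  obtain ⟨a, ha⟩ : ∃ a, a ∈ P.head? := ⟨P.head hne, List.head?_eq_some_head hne⟩
  obtain ⟨z, hz⟩ : ∃ z, z ∈ P.getLast? := ⟨P.getLast hne, List.getLast?_eq_some_getLast hne⟩
  by_cases haP : ∀ v ∈ S, G.Adj a v → v ∈ P
  swap
  · push Not at haP
    obtain ⟨v, hvS, hav, hvP⟩ := haP
    refine ⟨v :: P, by simp, List.nodup_cons.2 ⟨hvP, hP⟩, ?_, ?_⟩
    · simpa using ⟨hvS, hPS⟩
    · refine List.isChain_cons.2 ⟨fun y hy => ?_, hc⟩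
      obtain rfl : a = y := by simpa using ha.symm.trans hy
      exact hav.symm
  by_cases hzP : ∀ v ∈ S, G.Adj z v → v ∈ P
  swap
  · push Not at hzP
    obtain ⟨v, hvS, hzv, hvP⟩ := hzP
    refine ⟨P ++ [v], by simp, ?_, ?_, ?_⟩
    · rw [List.nodup_append]
      refine ⟨hP, by simp, ?_⟩
      intro x hx y hy hxy
      simp only [List.mem_singleton] at hy
      exact hvP (hy ▸ hxy ▸ hx)
    · intro x hx
      rcases List.mem_append.1 hx with h | h
      · exact hPS x h
      · rw [List.mem_singleton.1 h]; exact hvS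
    · refine hc.append (by simp) ?_
      intro x hx y hy
      obtain rfl : z = x := by simpa using hz.symm.trans hx
      obtain rfl : v = y := by simpa using hy
      exact hzv
  obtain ⟨L, hLP, hLL⟩ := exists_closed_of_path hdeg hP hPS hc ha hz haP hzP
  have haS := hPS a (List.mem_of_mem_head? ha)
  have hPcard := List.toFinset_card_of_nodup hP
  have hPsub : P.toFinset ⊆ S := fun v hv => hPS v (List.mem_toFinset.1 hv)
  obtain ⟨w, hwS, hwP⟩ : ∃ w ∈ S, w ∉ P.toFinset :=
    Finset.exists_mem_notMem_of_card_lt_card (by omega)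
  obtain ⟨u, huP, hwu⟩ : ∃ u ∈ P, G.Adj w u := by
    by_contra! hno
    have h1 : (S.filter (G.Adj w)).card ≤ (S \ P.toFinset).card := by
      refine Finset.card_le_card fun v hv => ?_
      rw [Finset.mem_filter] at hv
      exact Finset.mem_sdiff.2 ⟨hv.1, fun h => hno v (List.mem_toFinset.1 h) hv.2⟩
    have h2 : (S.filter (G.Adj a)).card ≤ P.toFinset.card := by
      refine Finset.card_le_card fun v hv => ?_
      rw [Finset.mem_filter] at hv
      exact List.mem_toFinset.2 (haP v hv.1 hv.2)
    rw [Finset.card_sdiff_of_subset hPsub] at h1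
    have := hdeg a haS
    have := hdeg w hwS
    omega
  obtain ⟨l₁, l₂, rfl⟩ := List.append_of_mem (hLP.mem_iff.2 huP)
  have hperm : (u :: l₂ ++ l₁).Perm P := List.perm_append_comm.trans hLP
  refine ⟨w :: (u :: l₂ ++ l₁), by simp [← hperm.length_eq], ?_, ?_, ?_⟩
  · refine List.nodup_cons.2 ⟨?_, hperm.nodup_iff.2 hP⟩
    rw [hperm.mem_iff, ← List.mem_toFinset]
    exact hwP
  · intro x hx
    rcases List.mem_cons.1 hx with rfl | h
    · exact hwS
    · exact hPS x (hperm.mem_iff.1 h)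
  · refine List.isChain_cons.2 ⟨by simpa using hwu, ?_⟩
    rw [show (l₁ ++ u :: l₂) ++ (l₁ ++ u :: l₂) = l₁ ++ ((u :: l₂ ++ l₁) ++ u :: l₂) by simp] at hLL
    exact hLL.right_of_append.left_of_append

/-- Dirac's theorem inside a vertex set `S`: the list `L` is a Hamilton cycle of `G[S]`. -/
lemma exists_closed_list {S : Finset V} (hS : S.Nonempty)
    (hdeg : ∀ v ∈ S, S.card + 2 ≤ 2 * (S.filter (G.Adj v)).card) :
    ∃ L : List V, L.Nodup ∧ (∀ v, v ∈ L ↔ v ∈ S) ∧ (L ++ L).IsChain G.Adj := by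
  have key : ∀ k < S.card, ∃ P : List V, P.length = k + 1 ∧ P.Nodup ∧ (∀ v ∈ P, v ∈ S) ∧
      P.IsChain G.Adj := by
    intro k
    induction k with
    | zero =>
      intro _
      obtain ⟨x, hx⟩ := hS
      exact ⟨[x], by simp, by simp, by simpa using hx, by simp⟩
    | succ k ih =>
      intro hk
      obtain ⟨P, hlen, hP, hPS, hc⟩ := ih (by omega)
      obtain ⟨Q, hQ⟩ := exists_longer_path hdeg (by rintro rfl; simp at hlen) hP hPS hc (by omega)
      exact ⟨Q, by omega, hQ.2⟩
  have hpos := hS.card_pos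
  obtain ⟨P, hlen, hP, hPS, hc⟩ := key (S.card - 1) (by omega)
  have hne : P ≠ [] := by rintro rfl; simp at hlen
  have hPeq : P.toFinset = S := by
    refine Finset.eq_of_subset_of_card_le (fun v hv => hPS v (List.mem_toFinset.1 hv)) ?_
    rw [List.toFinset_card_of_nodup hP]
    omega
  have hmem : ∀ v, v ∈ P ↔ v ∈ S := fun v => by rw [← hPeq, List.mem_toFinset]
  obtain ⟨L, hLP, hLL⟩ := exists_closed_of_path hdeg hP hPS hc
    (List.head?_eq_some_head hne) (List.getLast?_eq_some_getLast hne)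
    (fun v hv _ => (hmem v).2 hv) (fun v hv _ => (hmem v).2 hv)
  exact ⟨L, hLP.nodup_iff.2 hP, fun v => by rw [hLP.mem_iff, hmem], hLL⟩

/-- Above Dirac's threshold, any `x, y` are joined by a walk whose interior `R` visits
each vertex outside `F` once and no other vertex. -/
lemma exists_path_through_compl [Fintype V] {F : Finset V}
    (hdeg : Fintype.card V + F.card + 3 ≤ 2 * G.minDegree) (x y : V) :
    ∃ R : List V, R.Nodup ∧ (∀ v, v ∈ R ↔ v ∉ F) ∧ (y :: (R ++ [x])).IsChain G.Adj := by
  have hcard : Fᶜ.card = Fintype.card V - F.card := Finset.card_compl F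
  have hF := Finset.card_le_univ F
  have hmin : G.minDegree < Fintype.card V :=
    (G.minDegree_le_degree x).trans_lt (G.degree_lt_card_verts x)
  have hfil : ∀ v, G.minDegree ≤ (Fᶜ.filter (G.Adj v)).card + F.card := by
    intro v
    have h := G.minDegree_le_degree v
    rw [← G.card_neighborFinset_eq_degree] at h
    refine h.trans ((Finset.card_le_card (t := Fᶜ.filter (G.Adj v) ∪ F) fun w hw => ?_).trans
      (Finset.card_union_le _ _))
    rw [SimpleGraph.mem_neighborFinset] at hw
    by_cases hwF : w ∈ F <;> simp [hwF, hw]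
  obtain ⟨L, hL, hmem, hLL⟩ := exists_closed_list (G := G) (S := Fᶜ)
    (by rw [← Finset.card_pos]; omega) (fun v _ => by have := hfil v; omega)
  have hlen : L.length = Fᶜ.card := by
    rw [← List.toFinset_card_of_nodup hL]
    congr 1
    ext v
    rw [List.mem_toFinset, hmem]
  have h1 := countP_eq_card_filter (G.Adj x) hL (fun v hv _ => (hmem v).2 hv)
    (fun v hv => (hmem v).1 hv)
  have h2 := countP_eq_card_filter (G.Adj y) hL (fun v hv _ => (hmem v).2 hv)
    (fun v hv => (hmem v).1 hv)
  have h3 : L.countP (G.Adj y ·) ≤ L.tail.countP (G.Adj y ·) + 1 := by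
    cases L with
    | nil => simp
    | cons b t =>
      rw [List.countP_cons, List.tail_cons]
      split_ifs <;> omega
  obtain ⟨l₁, u, v, l₂, rfl, hu, hv⟩ := exists_consecutive (G.Adj x) (G.Adj y) L (by
    have := hfil x
    have := hfil y
    omega)
  have hperm : (v :: l₂ ++ (l₁ ++ [u])).Perm (l₁ ++ u :: v :: l₂) := by
    rw [show l₁ ++ u :: v :: l₂ = (l₁ ++ [u]) ++ v :: l₂ by simp]
    exact List.perm_append_comm
  refine ⟨v :: l₂ ++ (l₁ ++ [u]), hperm.nodup_iff.2 hL, fun w => ?_, ?_⟩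
  · rw [hperm.mem_iff, hmem, Finset.mem_compl]
  · have hch : (v :: l₂ ++ (l₁ ++ [u])).IsChain G.Adj := by
      rw [show (l₁ ++ u :: v :: l₂) ++ (l₁ ++ u :: v :: l₂)
        = (l₁ ++ [u]) ++ ((v :: l₂ ++ (l₁ ++ [u])) ++ v :: l₂) by simp] at hLL
      exact hLL.right_of_append.left_of_append
    refine List.isChain_cons.2 ⟨by simpa using hv, hch.append (by simp) ?_⟩
    intro a ha b hb
    obtain rfl : u = a := by simpa [List.getLast?_append, List.getLast?_cons] using ha
    obtain rfl : x = b := by simpa using hb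
    exact hu.symm

end HamiltonCycles

section PathWeights

variable {V : Type}

/-- The total weight of the consecutive pairs of a list of vertices. -/
def pathWeight (w : Sym2 V → ℤ) : List V → ℤ
  | a :: b :: l => w s(a, b) + pathWeight w (b :: l)
  | _ => 0

lemma pathWeight_append_cons (w : Sym2 V → ℤ) (z : V) (S : List V) :
    ∀ l : List V, pathWeight w (l ++ z :: S) = pathWeight w (l ++ [z]) + pathWeight w (z :: S)
  | [] => by simp [pathWeight]
  | [a] => by simp [pathWeight]
  | a :: b :: l => by
      have := pathWeight_append_cons w z S (b :: l)
      simp only [List.cons_append, pathWeight] at this ⊢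
      rw [this, add_assoc]

lemma pathWeight_neg (w : Sym2 V → ℤ) : ∀ l : List V,
    pathWeight (fun e => - w e) l = - pathWeight w l
  | [] => by simp [pathWeight]
  | [a] => by simp [pathWeight]
  | a :: b :: l => by
      simp only [pathWeight]
      rw [pathWeight_neg w (b :: l)]
      ring

lemma two_mul_pathWeight_le {G : SimpleGraph V} {w : Sym2 V → ℤ} {g : V → ℤ}
    (h : ∀ u v, G.Adj u v → 2 * w s(u, v) ≤ g u + g v) :
    ∀ (l : List V) (x y : V), (x :: (l ++ [y])).IsChain G.Adj →
      2 * pathWeight w (x :: (l ++ [y])) ≤ g x + 2 * (l.map g).sum + g y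
  | [], x, y, hc => by
      simp only [List.nil_append, List.isChain_pair] at hc
      have := h x y hc
      simp [pathWeight]
      linarith
  | a :: l, x, y, hc => by
      simp only [List.cons_append, List.isChain_cons_cons] at hc
      have h1 := two_mul_pathWeight_le h l a y hc.2
      have h2 := h x a hc.1
      simp only [List.cons_append, pathWeight, List.map_cons, List.sum_cons]
      linarith

lemma exists_walk_of_isChain {G : SimpleGraph V} (w : Sym2 V → ℤ) :
    ∀ (l : List V) (x y : V), (x :: (l ++ [y])).IsChain G.Adj →
      ∃ p : G.Walk x y, p.support = x :: (l ++ [y]) ∧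
        (p.edges.map w).sum = pathWeight w (x :: (l ++ [y]))
  | [], x, y, hc => by
      simp only [List.nil_append, List.isChain_pair] at hc
      exact ⟨.cons hc .nil, by simp, by simp [pathWeight]⟩
  | a :: l, x, y, hc => by
      simp only [List.cons_append, List.isChain_cons_cons] at hc
      obtain ⟨p, hs, hw⟩ := exists_walk_of_isChain w l a y hc.2
      exact ⟨.cons hc.1 p, by simp [hs], by simp [hw, pathWeight]⟩

lemma exists_isHamiltonianCycle_of_list [DecidableEq V] {G : SimpleGraph V} (w : Sym2 V → ℤ)
    {x : V} {l : List V} (hl : (x :: l).Nodup) (hmem : ∀ v, v ∈ x :: l) (hlen : 2 ≤ l.length)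
    (hc : (x :: (l ++ [x])).IsChain G.Adj) :
    ∃ H : G.Walk x x, H.IsHamiltonianCycle ∧
      (H.edges.map w).sum = pathWeight w (x :: (l ++ [x])) := by
  obtain ⟨p, hs, hw⟩ := exists_walk_of_isChain w l x x hc
  refine ⟨p, ?_, hw⟩
  have htail : p.support.tail.Perm (x :: l) := by
    rw [hs]
    simp
  rw [SimpleGraph.Walk.isHamiltonianCycle_iff_isCycle_and_support_count_tail_eq_one]
  refine ⟨?_, fun v => ?_⟩
  · have hnd := htail.nodup_iff.2 hl
    have hplen : p.length = l.length + 1 := by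
      have := p.length_support
      rw [hs] at this
      simp at this
      omega
    cases p with
    | nil => simp at hplen
    | cons h q =>
      rw [SimpleGraph.Walk.support_cons, List.tail_cons] at hnd
      have hq : q.IsPath := .mk' hnd
      rw [SimpleGraph.Walk.cons_isCycle_iff]
      refine ⟨hq, fun hmem' => ?_⟩
      rw [SimpleGraph.Walk.length_cons] at hplen
      cases q with
      | nil => rw [SimpleGraph.Walk.length_nil] at hplen; omega
      | cons h' r =>
        rw [SimpleGraph.Walk.cons_isPath_iff] at hq
        rw [SimpleGraph.Walk.edges_cons, List.mem_cons] at hmem'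
        rcases hmem' with he | he
        · rw [Sym2.eq_swap, Sym2.congr_right] at he
          subst he
          have := (SimpleGraph.Walk.isPath_iff_nil.1 hq.1).length_eq_zero
          rw [SimpleGraph.Walk.length_cons] at hplen
          omega
        · exact hq.2 (r.snd_mem_support_of_mem_edges he)
  · rw [htail.count_eq]
    exact List.count_eq_one_of_mem hl (hmem v)

end PathWeights

section Switches

variable {V : Type}

/-- Two paths from `x` to `y` with the same interior vertices, the first of which is heavier
by at least `k`. -/
structure IsSwitch_s2 (G : SimpleGraph V) (w : Sym2 V → ℤ) (k : ℤ) (x y : V) (l l' : List V) :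
    Prop where
  perm : l'.Perm l
  nodup : (x :: (l ++ [y])).Nodup
  chain : (x :: (l ++ [y])).IsChain G.Adj
  chain' : (x :: (l' ++ [y])).IsChain G.Adj
  weight : pathWeight w (x :: (l' ++ [y])) + k ≤ pathWeight w (x :: (l ++ [y]))

lemma IsSwitch_s2.trans {G : SimpleGraph V} {w : Sym2 V → ℤ} {j k : ℤ} {a d q x y : V}
    {l₁ l₁' l l' : List V} (h₁ : IsSwitch_s2 G w j a d l₁ l₁') (h : IsSwitch_s2 G w k x y l l')
    (hdisj : (a :: (l₁ ++ [d])).Disjoint (x :: (l ++ [y]))) (hq₁ : q ∉ a :: (l₁ ++ [d]))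
    (hq : q ∉ x :: (l ++ [y])) (hdq : G.Adj d q) (hqx : G.Adj q x) :
    IsSwitch_s2 G w (j + k) a y (l₁ ++ d :: q :: x :: l) (l₁' ++ d :: q :: x :: l') where
  perm := h₁.perm.append (((h.perm.cons x).cons q).cons d)
  nodup := by
    rw [show a :: ((l₁ ++ d :: q :: x :: l) ++ [y])
      = (a :: (l₁ ++ [d])) ++ q :: (x :: (l ++ [y])) by simp]
    refine List.Nodup.append h₁.nodup (List.nodup_cons.2 ⟨hq, h.nodup⟩) ?_
    rw [List.disjoint_cons_right]
    exact ⟨hq₁, hdisj⟩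
  chain := by
    rw [show a :: ((l₁ ++ d :: q :: x :: l) ++ [y])
      = (a :: l₁) ++ d :: (q :: x :: (l ++ [y])) by simp, List.isChain_split]
    exact ⟨h₁.chain, by
      rw [List.isChain_cons_cons, List.isChain_cons_cons]
      exact ⟨hdq, hqx, h.chain⟩⟩
  chain' := by
    rw [show a :: ((l₁' ++ d :: q :: x :: l') ++ [y])
      = (a :: l₁') ++ d :: (q :: x :: (l' ++ [y])) by simp, List.isChain_split]
    exact ⟨h₁.chain', by
      rw [List.isChain_cons_cons, List.isChain_cons_cons]
      exact ⟨hdq, hqx, h.chain'⟩⟩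
  weight := by
    have e := pathWeight_append_cons w d (q :: x :: (l ++ [y])) (a :: l₁)
    have e' := pathWeight_append_cons w d (q :: x :: (l' ++ [y])) (a :: l₁')
    have h1 := h₁.weight
    have h2 := h.weight
    simp only [pathWeight, List.cons_append, List.append_assoc] at e e' h1 h2 ⊢
    linarith

variable [Fintype V] [DecidableEq V] {G : SimpleGraph V} [DecidableRel G.Adj]

/-- A switch of gain `k` on few vertices yields Hamilton cycles whose weights differ
by at least `k`. -/
lemma IsSwitch_s2.exists_isHamiltonianCycle {w : Sym2 V → ℤ} {k : ℤ} {x y : V} {l l' : List V}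
    (h : IsSwitch_s2 G w k x y l l')
    (hdeg : Fintype.card V + l.length + 5 ≤ 2 * G.minDegree) :
    ∃ H H' : G.Walk x x, H.IsHamiltonianCycle ∧ H'.IsHamiltonianCycle ∧
      (H'.edges.map w).sum + k ≤ (H.edges.map w).sum := by
  have hF : (x :: (l ++ [y])).toFinset.card = l.length + 2 := by
    rw [List.toFinset_card_of_nodup h.nodup]
    simp
  obtain ⟨R, hR, hmem, hc⟩ := exists_path_through_compl (G := G)
    (F := (x :: (l ++ [y])).toFinset) (by omega) x y
  have hmin : G.minDegree < Fintype.card V :=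
    (G.minDegree_le_degree x).trans_lt (G.degree_lt_card_verts x)
  have hRlen : 2 ≤ R.length := by
    have h1 : R.toFinset = ((x :: (l ++ [y])).toFinset)ᶜ := by
      ext v
      rw [List.mem_toFinset, hmem, Finset.mem_compl]
    have h2 := congrArg Finset.card h1
    rw [List.toFinset_card_of_nodup hR, Finset.card_compl, hF] at h2
    omega
  have hnd : (x :: (l ++ y :: R)).Nodup := by
    rw [show x :: (l ++ y :: R) = (x :: (l ++ [y])) ++ R by simp]
    refine h.nodup.append hR fun v hv hvR => ?_
    exact (hmem v).1 hvR (List.mem_toFinset.2 hv)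
  have hall : ∀ v, v ∈ x :: (l ++ y :: R) := by
    intro v
    rw [show x :: (l ++ y :: R) = (x :: (l ++ [y])) ++ R by simp, List.mem_append, hmem,
      List.mem_toFinset]
    exact em _
  have key : ∀ l₀ : List V, l₀.Perm l → (x :: (l₀ ++ [y])).IsChain G.Adj →
      ∃ H : G.Walk x x, H.IsHamiltonianCycle ∧ (H.edges.map w).sum =
        pathWeight w (x :: (l₀ ++ [y])) + pathWeight w (y :: (R ++ [x])) := by
    intro l₀ hp hch
    have hp' : (x :: (l₀ ++ y :: R)).Perm (x :: (l ++ y :: R)) := (hp.append_right _).cons x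
    have heq : x :: ((l₀ ++ y :: R) ++ [x]) = (x :: l₀) ++ y :: (R ++ [x]) := by simp
    obtain ⟨H, hH, hw⟩ := exists_isHamiltonianCycle_of_list (G := G) w (hp'.nodup_iff.2 hnd)
      (fun v => hp'.mem_iff.2 (hall v)) (by simp; omega)
      (by rw [heq, List.isChain_split]; exact ⟨hch, hc⟩)
    exact ⟨H, hH, by rw [hw, heq, pathWeight_append_cons]; rfl⟩
  obtain ⟨H, hH, hw⟩ := key l (List.Perm.refl _) h.chain
  obtain ⟨H', hH', hw'⟩ := key l' h.perm h.chain'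
  exact ⟨H, H', hH, hH', by rw [hw, hw']; linarith [h.weight]⟩

/-- If every two Hamilton cycles have weights differing by less than `k`, then a small set
meets every short switch of positive gain. -/
lemma exists_hitting_set {w : Sym2 V → ℤ} {k : ℕ}
    (hcommon : ∀ u v, ∀ F : Finset V, F.card ≤ 9 * k + 1 → ∃ x ∉ F, G.Adj u x ∧ G.Adj v x)
    (hdeg : Fintype.card V + 9 * k + 5 ≤ 2 * G.minDegree) [Nonempty V]
    (hbias : ∀ (x : V) (H H' : G.Walk x x), H.IsHamiltonianCycle → H'.IsHamiltonianCycle →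
      (H.edges.map w).sum < (H'.edges.map w).sum + k) :
    ∃ A : Finset V, A.card ≤ 9 * k ∧
      ∀ x y l l', IsSwitch_s2 G w 1 x y l l' → l.length ≤ 6 → ∃ v ∈ x :: (l ++ [y]), v ∈ A := by
  by_contra! hno
  have key : ∀ j ≤ k, ∃ x y l l', IsSwitch_s2 G w j x y l l' ∧ l.length ≤ 9 * j := by
    intro j
    induction j with
    | zero =>
      intro _
      obtain ⟨x⟩ := ‹Nonempty V›
      obtain ⟨y, -, hxy, -⟩ := hcommon x x ∅ (by simp)
      exact ⟨x, y, [], [], ⟨List.Perm.refl _, by simpa using hxy.ne, by simpa using hxy,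
        by simpa using hxy, by simp⟩, by simp⟩
    | succ j ih =>
      intro hj
      obtain ⟨x, y, l, l', hsw, hlen⟩ := ih (by omega)
      have hF : (x :: (l ++ [y])).toFinset.card = l.length + 2 := by
        rw [List.toFinset_card_of_nodup hsw.nodup]
        simp
      obtain ⟨a, d, l₁, l₁', hsw₁, hlen₁, hd⟩ := hno (x :: (l ++ [y])).toFinset (by omega)
      have hF₁ : (a :: (l₁ ++ [d])).toFinset.card = l₁.length + 2 := by
        rw [List.toFinset_card_of_nodup hsw₁.nodup]
        simp
      obtain ⟨q, hq, hdq, hxq⟩ := hcommon d x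
        ((a :: (l₁ ++ [d])).toFinset ∪ (x :: (l ++ [y])).toFinset)
        ((Finset.card_union_le _ _).trans (by omega))
      rw [Finset.mem_union, List.mem_toFinset, List.mem_toFinset, not_or] at hq
      have := hsw₁.trans hsw (fun v hv hv' => hd v hv (List.mem_toFinset.2 hv'))
        hq.1 hq.2 hdq hxq.symm
      rw [show (1 + j : ℤ) = (j + 1 : ℕ) by push_cast; ring] at this
      exact ⟨a, y, _, _, this, by simp; omega⟩
  obtain ⟨x, y, l, l', hsw, hlen⟩ := key k le_rfl
  obtain ⟨H, H', hH, hH', hw⟩ := hsw.exists_isHamiltonianCycle (by omega)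
  exact absurd (hbias x H H' hH hH') (not_lt.2 hw)

end Switches

section Potential

variable {V : Type} [DecidableEq V] {G : SimpleGraph V} {w : Sym2 V → ℤ} {A : Finset V}

lemma weight_alternating_four
    (hcommon : ∀ u v, ∀ F : Finset V, F.card ≤ A.card + 8 → ∃ x ∉ F, G.Adj u x ∧ G.Adj v x)
    (hA : ∀ x y l l', IsSwitch_s2 G w 1 x y l l' → l.length ≤ 6 → ∃ v ∈ x :: (l ++ [y]), v ∈ A)
    {a b c d : V} (ha : a ∉ A) (hb : b ∉ A) (hc : c ∉ A) (hd : d ∉ A)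
    (hab : G.Adj a b) (hbc : G.Adj b c) (hcd : G.Adj c d) (hda : G.Adj d a) :
    w s(a, b) + w s(c, d) = w s(b, c) + w s(d, a) := by
  by_cases hac : a = c
  · subst hac
    rw [Sym2.eq_swap (a := b), Sym2.eq_swap (a := d)]
  by_cases hbd : b = d
  · subst hbd
    rw [Sym2.eq_swap (a := c), Sym2.eq_swap (a := a), add_comm]
  have key : ∀ a b c d : V, a ∉ A → b ∉ A → c ∉ A → d ∉ A → G.Adj a b → G.Adj b c → G.Adj c d →
      G.Adj d a → a ≠ c → b ≠ d → w s(a, b) + w s(c, d) ≤ w s(b, c) + w s(d, a) := by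
    clear! a b c d
    intro a b c d ha hb hc hd hab hbc hcd hda hac hbd
    by_contra! hlt
    obtain ⟨p, hp, hbp, hdp⟩ := hcommon b d (A ∪ {a, b, c, d})
      ((Finset.card_union_le _ _).trans (by
        have := Finset.card_le_four (a := a) (b := b) (c := c) (d := d)
        omega))
    simp only [Finset.mem_union, Finset.mem_insert, Finset.mem_singleton, not_or] at hp
    obtain ⟨hpA, hpa, hpb, hpc, hpd⟩ := hp
    have hsw : IsSwitch_s2 G w 1 a c [b, p, d] [d, p, b] := by
      refine ⟨List.reverse_perm [b, p, d], ?_, ?_, ?_, ?_⟩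
      · simp [hab.ne, hda.ne', hac, hbd, hbc.ne, hcd.ne', Ne.symm hpa, Ne.symm hpb, hpc, hpd]
      · simp [hab, hbp, hdp.symm, hcd.symm]
      · simp [hda.symm, hdp, hbp.symm, hbc]
      · simp only [List.cons_append, List.nil_append, pathWeight]
        rw [Sym2.eq_swap (a := p) (b := b), Sym2.eq_swap (a := p) (b := d),
          Sym2.eq_swap (a := a) (b := d), Sym2.eq_swap (a := d) (b := c)]
        linarith
    obtain ⟨v, hv, hvA⟩ := hA _ _ _ _ hsw (by simp)
    simp only [List.cons_append, List.nil_append, List.mem_cons, List.not_mem_nil, or_false] at hv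
    rcases hv with rfl | rfl | rfl | rfl | rfl <;> contradiction
  have h1 := key a b c d ha hb hc hd hab hbc hcd hda hac hbd
  have h2 := key b c d a hb hc hd ha hbc hcd hda hab hbd (Ne.symm hac)
  linarith

lemma weight_alternating_six
    (hcommon : ∀ u v, ∀ F : Finset V, F.card ≤ A.card + 8 → ∃ x ∉ F, G.Adj u x ∧ G.Adj v x)
    (hA : ∀ x y l l', IsSwitch_s2 G w 1 x y l l' → l.length ≤ 6 → ∃ v ∈ x :: (l ++ [y]), v ∈ A)
    {a b c d e f : V} (hnd : [a, b, c, d, e, f].Nodup) (hout : ∀ v ∈ [a, b, c, d, e, f], v ∉ A)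
    (hab : G.Adj a b) (hbc : G.Adj b c) (hcd : G.Adj c d) (hde : G.Adj d e) (hef : G.Adj e f)
    (hfa : G.Adj f a) :
    w s(a, b) + w s(c, d) + w s(e, f) = w s(b, c) + w s(d, e) + w s(f, a) := by
  have key : ∀ a b c d e f : V, [a, b, c, d, e, f].Nodup → (∀ v ∈ [a, b, c, d, e, f], v ∉ A) →
      G.Adj a b → G.Adj b c → G.Adj c d → G.Adj d e → G.Adj e f → G.Adj f a →
      w s(a, b) + w s(c, d) + w s(e, f) ≤ w s(b, c) + w s(d, e) + w s(f, a) := by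
    clear! a b c d e f
    intro a b c d e f hnd hout hab hbc hcd hde hef hfa
    by_contra! hlt
    have h6 : ([a, b, c, d, e, f].toFinset).card = 6 := List.toFinset_card_of_nodup hnd
    obtain ⟨p, hp, hbp, hep⟩ := hcommon b e (A ∪ [a, b, c, d, e, f].toFinset)
      ((Finset.card_union_le _ _).trans (by omega))
    obtain ⟨q, hq, hcq, hfq⟩ := hcommon c f (insert p (A ∪ [a, b, c, d, e, f].toFinset))
      ((Finset.card_insert_le _ _).trans
        (by have := Finset.card_union_le A [a, b, c, d, e, f].toFinset; omega))
    rw [Finset.mem_insert, Finset.mem_union, List.mem_toFinset, not_or, not_or] at hq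
    rw [Finset.mem_union, List.mem_toFinset, not_or] at hp
    have hsw : IsSwitch_s2 G w 1 a d [b, p, e, f, q, c] [f, q, c, b, p, e] := by
      refine ⟨List.perm_append_comm (l₁ := [f, q, c]) (l₂ := [b, p, e]), ?_, ?_, ?_, ?_⟩
      · have hperm : (a :: ([b, p, e, f, q, c] ++ [d])).Perm
            (q :: p :: [a, b, c, d, e, f]) := by
          rw [List.perm_iff_count]
          intro v
          simp only [List.cons_append, List.nil_append, List.count_cons, List.count_nil]
          omega
        rw [hperm.nodup_iff, List.nodup_cons, List.nodup_cons, List.mem_cons, not_or]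
        exact ⟨⟨hq.1, hq.2.2⟩, hp.2, hnd⟩
      · simp [hab, hbp, hep.symm, hef, hfq, hcq.symm, hcd]
      · simp [hfa.symm, hfq, hcq.symm, hbc.symm, hbp, hep.symm, hde.symm]
      · simp only [List.cons_append, List.nil_append, pathWeight]
        rw [Sym2.eq_swap (a := a) (b := f), Sym2.eq_swap (a := c) (b := b),
          Sym2.eq_swap (a := e) (b := d)]
        linarith
    obtain ⟨v, hv, hvA⟩ := hA _ _ _ _ hsw (by simp)
    simp only [List.cons_append, List.nil_append, List.mem_cons, List.not_mem_nil, or_false]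
      at hv hout
    rcases hv with rfl | rfl | rfl | rfl | rfl | rfl | rfl | rfl
    · exact hout v (by simp) hvA
    · exact hout v (by simp) hvA
    · exact hp.1 hvA
    · exact hout v (by simp) hvA
    · exact hout v (by simp) hvA
    · exact hq.2.1 hvA
    · exact hout v (by simp) hvA
    · exact hout v (by simp) hvA
  have h1 := key a b c d e f hnd hout hab hbc hcd hde hef hfa
  have hperm : [b, c, d, e, f, a].Perm [a, b, c, d, e, f] :=
    List.perm_append_comm (l₁ := [b, c, d, e, f]) (l₂ := [a])
  have h2 := key b c d e f a (hperm.nodup_iff.2 hnd) (fun v hv => hout v (hperm.mem_iff.1 hv))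
    hbc hcd hde hef hfa hab
  linarith

lemma weight_triangle_eq
    (hcommon : ∀ u v, ∀ F : Finset V, F.card ≤ A.card + 8 → ∃ x ∉ F, G.Adj u x ∧ G.Adj v x)
    (hA : ∀ x y l l', IsSwitch_s2 G w 1 x y l l' → l.length ≤ 6 → ∃ v ∈ x :: (l ++ [y]), v ∈ A)
    {u a b c d : V} (hu : u ∉ A) (ha : a ∉ A) (hb : b ∉ A) (hc : c ∉ A) (hd : d ∉ A)
    (hua : G.Adj u a) (hub : G.Adj u b) (hab : G.Adj a b)
    (huc : G.Adj u c) (hud : G.Adj u d) (hcd : G.Adj c d) :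
    w s(u, a) + w s(u, b) - w s(a, b) = w s(u, c) + w s(u, d) - w s(c, d) := by
  have sw : ∀ x y, w s(x, y) = w s(y, x) := fun x y => by rw [Sym2.eq_swap]
  have common : ∀ a b d, a ∉ A → b ∉ A → d ∉ A → G.Adj u b → G.Adj a b → G.Adj u d →
      G.Adj a d → w s(u, b) - w s(a, b) = w s(u, d) - w s(a, d) := by
    intro a b d ha hb hd hub hab hud had
    have := weight_alternating_four hcommon hA hu hb ha hd hub hab.symm had hud.symm
    linarith [sw b a, sw d u]
  by_cases hac : a = c
  · subst hac
    linarith [common a b d ha hb hd hub hab hud hcd]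
  by_cases had : a = d
  · subst had
    linarith [common a b c ha hb hc hub hab huc hcd.symm, sw a c]
  by_cases hbc : b = c
  · subst hbc
    linarith [common b a d hb ha hd hua hab.symm hud hcd, sw a b]
  by_cases hbd : b = d
  · subst hbd
    linarith [common b a c hb ha hc hua hab.symm huc hcd.symm, sw a b, sw b c]
  obtain ⟨x, hx, hbx, hcx⟩ := hcommon b c (A ∪ [u, a, b, c, d].toFinset)
    ((Finset.card_union_le _ _).trans
      (by have := List.toFinset_card_le [u, a, b, c, d]; simp at this ⊢; omega))
  rw [Finset.mem_union, List.mem_toFinset, not_or] at hx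
  simp only [List.mem_cons, List.not_mem_nil, or_false, not_or] at hx
  obtain ⟨hxA, hxu, hxa, hxb, hxc, hxd⟩ := hx
  have h4 := weight_alternating_four hcommon hA hb hu hc hxA hub.symm huc hcx hbx.symm
  have h6 := weight_alternating_six hcommon hA (a := u) (b := a) (c := b) (d := x) (e := c)
    (f := d)
    (by simp [hua.ne, hub.ne, huc.ne, hud.ne, hab.ne, hcd.ne, hac, had, hbc, hbd, hxc, hxd,
      Ne.symm hxu, Ne.symm hxa, Ne.symm hxb])
    (by simp [hu, ha, hb, hc, hd, hxA]) hua hab hbx hcx.symm hcd hud.symm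
  linarith [sw b u, sw c x, sw b x, sw d u]

/-- Outside `A`, twice the weight of an edge is the sum of a potential at its ends. -/
lemma exists_potential
    (hcommon : ∀ u v, ∀ F : Finset V, F.card ≤ A.card + 8 → ∃ x ∉ F, G.Adj u x ∧ G.Adj v x)
    (hA : ∀ x y l l', IsSwitch_s2 G w 1 x y l l' → l.length ≤ 6 → ∃ v ∈ x :: (l ++ [y]), v ∈ A) :
    ∃ g : V → ℤ, ∀ u a b, u ∉ A → a ∉ A → b ∉ A → G.Adj u a → G.Adj u b → G.Adj a b →
      g u = w s(u, a) + w s(u, b) - w s(a, b) := by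
  have : ∀ u, ∃ t : ℤ, ∀ a b, u ∉ A → a ∉ A → b ∉ A → G.Adj u a → G.Adj u b → G.Adj a b →
      t = w s(u, a) + w s(u, b) - w s(a, b) := by
    intro u
    by_cases h : ∃ a b, u ∉ A ∧ a ∉ A ∧ b ∉ A ∧ G.Adj u a ∧ G.Adj u b ∧ G.Adj a b
    · obtain ⟨a, b, hu, ha, hb, hua, hub, hab⟩ := h
      exact ⟨_, fun c d _ hc hd huc hud hcd =>
        weight_triangle_eq hcommon hA hu ha hb hc hd hua hub hab huc hud hcd⟩
    · exact ⟨0, fun a b hu ha hb hua hub hab => absurd ⟨a, b, hu, ha, hb, hua, hub, hab⟩ h⟩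
  choose g hg using this
  exact ⟨g, fun u a b => hg u a b⟩

end Potential

section Classification

variable {V : Type} [DecidableEq V] {G : SimpleGraph V} {A : Finset V}

/-- The indicator weight of a colour class. -/
def colorWeight (χ : Sym2 V → Fin 3) (i : Fin 3) (e : Sym2 V) : ℤ := if χ e = i then 1 else 0

omit [DecidableEq V] in
lemma eq_of_colorWeight_eq_one {χ : Sym2 V → Fin 3} {i : Fin 3} {e : Sym2 V}
    (h : colorWeight χ i e = 1) : χ e = i := by
  by_contra hne
  simp [colorWeight, hne] at h

lemma triangle_potential_cases (a b c : Fin 3) :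
    let t : Fin 3 → ℤ := fun i =>
      (if a = i then 1 else 0) + (if b = i then 1 else 0) - (if c = i then 1 else 0)
    (∃ j, ∀ i, t i = 1 - 2 * if j = i then 1 else 0) ∨
      ∃ k j, ∀ i, t i = (2 * if j = i then 1 else 0) - if k = i then 1 else 0 := by
  revert a b c
  decide

/-- The potentials of the three colours are either those of a tripartite colouring, or those
of a colouring with a dominant colour `k`. -/
lemma exists_labelling {χ : Sym2 V → Fin 3}
    (hcommon : ∀ u v, ∀ F : Finset V, F.card ≤ A.card + 8 → ∃ x ∉ F, G.Adj u x ∧ G.Adj v x)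
    {g : Fin 3 → V → ℤ}
    (hg : ∀ i u a b, u ∉ A → a ∉ A → b ∉ A → G.Adj u a → G.Adj u b → G.Adj a b →
      g i u = colorWeight χ i s(u, a) + colorWeight χ i s(u, b) - colorWeight χ i s(a, b)) :
    (∀ i u v, u ∉ A → v ∉ A → G.Adj u v → g i u + g i v = 2 * colorWeight χ i s(u, v)) ∧
    ((∃ c : V → Fin 3, ∀ u ∉ A, ∀ i, g i u = 1 - 2 * if c u = i then 1 else 0) ∨
      ∃ (k : Fin 3) (c : V → Fin 3), ∀ u ∉ A, ∀ i,
        g i u = (2 * if c u = i then 1 else 0) - if k = i then 1 else 0) := by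
  have hadd : ∀ i u v, u ∉ A → v ∉ A → G.Adj u v →
      g i u + g i v = 2 * colorWeight χ i s(u, v) := by
    intro i u v hu hv huv
    obtain ⟨x, hx, hux, hvx⟩ := hcommon u v A (by omega)
    rw [hg i u v x hu hv hx huv hux hvx, hg i v u x hv hu hx huv.symm hvx hux,
      Sym2.eq_swap (a := v) (b := u)]
    ring
  refine ⟨hadd, ?_⟩
  have hcases : ∀ u ∉ A, (∃ j, ∀ i, g i u = 1 - 2 * if j = i then 1 else 0) ∨
      ∃ k j, ∀ i, g i u = (2 * if j = i then 1 else 0) - if k = i then 1 else 0 := by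
    intro u hu
    obtain ⟨a, ha, hua, -⟩ := hcommon u u A (by omega)
    obtain ⟨b, hb, hub, hab⟩ := hcommon u a A (by omega)
    have h := fun i => hg i u a b hu ha hb hua hub hab
    have := triangle_potential_cases (χ s(u, a)) (χ s(u, b)) (χ s(a, b))
    simpa only [h, colorWeight] using this
  have hparity : ∀ u v, u ∉ A → v ∉ A → ∀ i, g i u % 2 = g i v % 2 := by
    intro u v hu hv i
    obtain ⟨x, hx, hux, hvx⟩ := hcommon u v A (by omega)
    have h1 := hadd i u x hu hx hux
    have h2 := hadd i v x hv hx hvx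
    omega
  by_cases hall : ∀ u ∉ A, ∃ j, ∀ i, g i u = 1 - 2 * if j = i then 1 else 0
  · left
    have : ∀ u, ∃ j, u ∉ A → ∀ i, g i u = 1 - 2 * if j = i then 1 else 0 := fun u =>
      (em (u ∈ A)).elim (fun h => ⟨0, fun h' => absurd h h'⟩)
        fun h => (hall u h).imp fun _ hj _ => hj
    choose c hc using this
    exact ⟨c, hc⟩
  · right
    push Not at hall
    obtain ⟨u₀, hu₀, hno⟩ := hall
    obtain ⟨k, j₀, hk⟩ := (hcases u₀ hu₀).resolve_left (by simpa using hno)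
    have : ∀ u, ∃ j, u ∉ A →
        ∀ i, g i u = (2 * if j = i then 1 else 0) - if k = i then 1 else 0 := by
      intro u
      by_cases hu : u ∈ A
      · exact ⟨0, fun h => absurd hu h⟩
      rcases hcases u hu with ⟨j, hj⟩ | ⟨k', j, hj⟩
      · exfalso
        have h1 := hparity u₀ u hu₀ hu (k + 1)
        rw [hk, hj] at h1
        have hne : ∀ k : Fin 3, k ≠ k + 1 := by decide
        rw [if_neg (hne k)] at h1
        omega
      · refine ⟨j, fun _ i => ?_⟩
        have hkk : k' = k := by
          have h1 := hparity u₀ u hu₀ hu k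
          rw [hk, hj, if_pos rfl] at h1
          by_contra hne
          rw [if_neg hne] at h1
          omega
        rw [hj, hkk]
    choose c hc using this
    exact ⟨k, c, hc⟩

end Classification

section Assembly

variable {V : Type} [Fintype V] [DecidableEq V] {G : SimpleGraph V}

lemma exists_isHamiltonianCycle_weight_near [DecidableRel G.Adj] [Nonempty V]
    {w : Sym2 V → ℤ} {g : V → ℤ} {A : Finset V}
    (hdeg : Fintype.card V + 4 ≤ 2 * G.minDegree)
    (hadd : ∀ u v, u ∉ A → v ∉ A → G.Adj u v → g u + g v = 2 * w s(u, v))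
    (hg : ∀ u ∉ A, -1 ≤ g u ∧ g u ≤ 2) (hw : ∀ e, 0 ≤ w e ∧ w e ≤ 1) :
    ∃ (x : V) (H : G.Walk x x), H.IsHamiltonianCycle ∧
      |(H.edges.map w).sum - ∑ u ∈ Aᶜ, g u| ≤ 3 * A.card := by
  obtain ⟨x⟩ := ‹Nonempty V›
  obtain ⟨R, hR, hmem, hc⟩ := exists_path_through_compl (G := G) (F := {x}) (by simp; omega) x x
  have hmin : G.minDegree < Fintype.card V :=
    (G.minDegree_le_degree x).trans_lt (G.degree_lt_card_verts x)
  have hnd : (x :: R).Nodup := List.nodup_cons.2 ⟨by simp [hmem], hR⟩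
  have hall : ∀ v, v ∈ x :: R := by simp [hmem, em]
  have hset : (x :: R).toFinset = Finset.univ := by
    ext v
    simpa only [List.mem_toFinset, Finset.mem_univ, iff_true] using hall v
  have hlen : (x :: R).length = Fintype.card V := by
    rw [← List.toFinset_card_of_nodup hnd, hset, Finset.card_univ]
  obtain ⟨H, hH, hHw⟩ := exists_isHamiltonianCycle_of_list (G := G) w hnd hall
    (by simp at hlen; omega) hc
  refine ⟨x, H, hH, ?_⟩
  have hsum : ∀ (w' : Sym2 V → ℤ) (g' : V → ℤ),
      (∀ u v, G.Adj u v → 2 * w' s(u, v) ≤ g' u + g' v) →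
      pathWeight w' (x :: (R ++ [x])) ≤ ∑ v, g' v := by
    intro w' g' h
    have h1 := two_mul_pathWeight_le h R x x hc
    rw [← hset, List.sum_toFinset g' hnd, List.map_cons, List.sum_cons]
    linarith
  have hext : ∀ g' : V → ℤ, ∑ v, (if v ∈ A then 3 else g' v) = 3 * A.card + ∑ v ∈ Aᶜ, g' v := by
    intro g'
    rw [← Finset.sum_add_sum_compl A]
    congr 1
    · rw [Finset.sum_congr rfl fun v hv => if_pos hv, Finset.sum_const]
      simp [mul_comm]
    · exact Finset.sum_congr rfl fun v hv => if_neg (Finset.mem_compl.1 hv)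
  have hup := hsum w (fun v => if v ∈ A then 3 else g v) (by
    intro u v huv
    have hw' := hw s(u, v)
    by_cases hu : u ∈ A <;> by_cases hv : v ∈ A <;> simp only [hu, hv, if_true, if_false]
    · linarith
    · linarith [hg v hv]
    · linarith [hg u hu]
    · linarith [hadd u v hu hv huv])
  have hlow := hsum (fun e => - w e) (fun v => if v ∈ A then 3 else - g v) (by
    intro u v huv
    have hw' := hw s(u, v)
    by_cases hu : u ∈ A <;> by_cases hv : v ∈ A <;> simp only [hu, hv, if_true, if_false]
    · linarith
    · linarith [hg v hv]
    · linarith [hg u hu]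
    · linarith [hadd u v hu hv huv])
  rw [hext] at hup hlow
  rw [pathWeight_neg, Finset.sum_neg_distrib] at hlow
  rw [hHw, abs_le]
  constructor <;> linarith

/-- Disjoint sets `P i` that almost reach the sizes `t i` can be turned into a partition with
exactly these sizes by reassigning few vertices. -/
lemma exists_partition_near_s2 {P : Fin 3 → Finset V} {t : Fin 3 → ℕ} {D : ℕ}
    (hP : ∀ i j, i ≠ j → Disjoint (P i) (P j))
    (ht : t 0 + t 1 + t 2 = Fintype.card V) (hPt : ∀ i, t i ≤ (P i).card + D) :
    ∃ (Q : Fin 3 → Finset V) (Z : Finset V), (∀ i j, i ≠ j → Disjoint (Q i) (Q j)) ∧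
      Finset.univ.biUnion Q = Finset.univ ∧ (∀ i, (Q i).card = t i) ∧ Z.card ≤ 3 * D ∧
      ∀ i, ∀ v ∈ Q i, v ∉ Z → v ∈ P i := by
  have : ∀ i, ∃ S ⊆ P i, S.card = min (P i).card (t i) := fun i =>
    Finset.exists_subset_card_eq (min_le_left _ _)
  choose S hSP hS using this
  have hSd : ∀ i j, i ≠ j → Disjoint (S i) (S j) := fun i j hij =>
    (hP i j hij).mono (hSP i) (hSP j)
  have hSt : ∀ i, (S i).card ≤ t i := fun i => by rw [hS]; exact min_le_right _ _
  have hSD : ∀ i, t i ≤ (S i).card + D := fun i => by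
    have := hPt i
    rw [hS]
    omega
  have c12 : (S 1 ∪ S 2).card = (S 1).card + (S 2).card :=
    Finset.card_union_of_disjoint (hSd 1 2 (by decide))
  obtain ⟨Q₀, h0, h0', hQ₀⟩ := Finset.exists_subsuperset_card_eq (s := S 0) (t := (S 1 ∪ S 2)ᶜ)
    (n := t 0)
    (by
      rw [Finset.subset_compl_iff_disjoint_right, Finset.disjoint_union_right]
      exact ⟨hSd 0 1 (by decide), hSd 0 2 (by decide)⟩)
    (hSt 0)
    (by rw [Finset.card_compl, c12]; have := hSt 1; have := hSt 2; omega)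
  rw [Finset.subset_compl_iff_disjoint_right, Finset.disjoint_union_right] at h0'
  have c02 : (Q₀ ∪ S 2).card = Q₀.card + (S 2).card := Finset.card_union_of_disjoint h0'.2
  obtain ⟨Q₁, h1, h1', hQ₁⟩ := Finset.exists_subsuperset_card_eq (s := S 1) (t := (Q₀ ∪ S 2)ᶜ)
    (n := t 1)
    (by
      rw [Finset.subset_compl_iff_disjoint_right, Finset.disjoint_union_right]
      exact ⟨h0'.1.symm, hSd 1 2 (by decide)⟩)
    (hSt 1)
    (by rw [Finset.card_compl, c02]; have := hSt 2; omega)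
  rw [Finset.subset_compl_iff_disjoint_right, Finset.disjoint_union_right] at h1'
  have c01 : (Q₀ ∪ Q₁).card = Q₀.card + Q₁.card := Finset.card_union_of_disjoint h1'.1.symm
  have hd02 : Disjoint Q₀ (Q₀ ∪ Q₁)ᶜ :=
    Finset.disjoint_left.2 fun v hv h => Finset.mem_compl.1 h (Finset.mem_union_left _ hv)
  have hd12 : Disjoint Q₁ (Q₀ ∪ Q₁)ᶜ :=
    Finset.disjoint_left.2 fun v hv h => Finset.mem_compl.1 h (Finset.mem_union_right _ hv)
  refine ⟨![Q₀, Q₁, (Q₀ ∪ Q₁)ᶜ], (S 0 ∪ (S 1 ∪ S 2))ᶜ, ?_, ?_, ?_, ?_, ?_⟩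
  · intro i j hij
    fin_cases i <;> fin_cases j <;> simp at hij ⊢
    exacts [h1'.1.symm, by simpa using hd02, h1'.1, by simpa using hd12,
      by simpa using hd02.symm, by simpa using hd12.symm]
  · ext v
    simp only [Finset.mem_biUnion, Finset.mem_univ, true_and, iff_true]
    by_cases hv0 : v ∈ Q₀
    · exact ⟨0, hv0⟩
    by_cases hv1 : v ∈ Q₁
    · exact ⟨1, hv1⟩
    exact ⟨2, by simp [hv0, hv1]⟩
  · intro i
    fin_cases i
    · exact hQ₀
    · exact hQ₁
    · change ((Q₀ ∪ Q₁)ᶜ).card = t 2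
      rw [Finset.card_compl, c01]
      omega
  · rw [Finset.card_compl, Finset.card_union_of_disjoint, c12]
    · have := hSD 0
      have := hSD 1
      have := hSD 2
      omega
    · rw [Finset.disjoint_union_right]
      exact ⟨hSd 0 1 (by decide), hSd 0 2 (by decide)⟩
  · intro i v hv hvZ
    rw [Finset.mem_compl, not_not, Finset.mem_union, Finset.mem_union] at hvZ
    fin_cases i
    · rcases hvZ with h | h | h
      · exact hSP 0 h
      · exact absurd h (Finset.disjoint_left.1 h0'.1 hv)
      · exact absurd h (Finset.disjoint_left.1 h0'.2 hv)
    · rcases hvZ with h | h | h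
      · exact absurd (h0 h) (Finset.disjoint_right.1 h1'.1.symm hv)
      · exact hSP 1 h
      · exact absurd h (Finset.disjoint_left.1 h1'.2 hv)
    · replace hv : v ∉ Q₀ ∪ Q₁ := Finset.mem_compl.1 hv
      rw [Finset.mem_union, not_or] at hv
      rcases hvZ with h | h | h
      · exact absurd (h0 h) hv.1
      · exact absurd (h1 h) hv.2
      · exact hSP 2 h

omit [Fintype V] [DecidableEq V] in
lemma not_hasMatchingOn_of_cover {s : ℕ} {Q : Sym2 V → Prop} {Z : Finset V} (hZ : Z.card < s)
    (hQ : ∀ e, Q e → ∃ x ∈ e, x ∈ Z) : ¬ HasMatchingOn s Q := by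
  rintro ⟨M, hM, hMQ, hdisj⟩
  have : ∀ e, ∃ x, e ∈ M → x ∈ e ∧ x ∈ Z := by
    intro e
    by_cases he : e ∈ M
    · obtain ⟨x, hx⟩ := hQ e (hMQ e he)
      exact ⟨x, fun _ => hx⟩
    · exact ⟨e.out.1, fun h => absurd h he⟩
  choose f hf using this
  have hle : M.card ≤ Z.card := by
    refine Finset.card_le_card_of_injOn f (fun e he => (hf e he).2) ?_
    intro e he e' he' hee
    by_contra hne
    exact hdisj he he' hne (f e) (hf e he).1 (hee ▸ (hf e' he').1)
  omega

omit [Fintype V] [DecidableEq V] in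
lemma length_filter_eq_sum_colorWeight (χ : Sym2 V → Fin 3) (i : Fin 3) (l : List (Sym2 V)) :
    ((l.filter (fun e => χ e = i)).length : ℤ) = (l.map (colorWeight χ i)).sum := by
  induction l with
  | nil => simp
  | cons e l ih =>
    rw [List.filter_cons, List.map_cons, List.sum_cons, ← ih]
    by_cases h : χ e = i <;> simp [h, colorWeight, add_comm]

end Assembly

/-- The stability theorem with an exceptional set: away from few vertices `Z`, the colouring is one
of the two extremal ones. -/
theorem exists_partition_of_unbiased {V : Type} [Fintype V] [DecidableEq V] {n m : ℕ}
    (hn : n = Fintype.card V)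
    (h6 : 6 ∣ n) (hm : 1 ≤ m) {G : SimpleGraph V} [DecidableRel G.Adj]
    (hdeg : n + 108 * m ≤ 2 * G.minDegree) {χ : Sym2 V → Fin 3}
    (hbias : ∀ (v : V) (H : G.Walk v v), H.IsHamiltonianCycle → ∀ i : Fin 3,
      |3 * (H.edges.map (colorWeight χ i)).sum - n| < 3 * m) :
    ∃ (P : Fin 3 → Finset V) (Z : Finset V), Z.card < 900 * m ∧
      (∀ i j : Fin 3, i ≠ j → Disjoint (P i) (P j)) ∧
      Finset.univ.biUnion P = Finset.univ ∧
      (((∀ i : Fin 3, 3 * (P i).card = n) ∧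
        ∀ i j u v, G.Adj u v → u ∈ P i → v ∈ P j → u ∉ Z → v ∉ Z →
          i ≠ j ∧ ∀ k, i ≠ k → j ≠ k → χ s(u, v) = k) ∨
      ∃ k : Fin 3, 3 * (P k).card = 2 * n ∧ (∀ i, i ≠ k → 6 * (P i).card = n) ∧
        ∀ i j u v, G.Adj u v → u ∈ P i → v ∈ P j → u ∉ Z → v ∉ Z →
          j = k ∧ χ s(u, v) = i ∨ i = k ∧ χ s(u, v) = j) := by
  have hne : Nonempty V := by
    by_contra h
    rw [not_nonempty_iff] at h
    have : G.minDegree = 0 := by simp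
    omega
  have hcommon : ∀ u v, ∀ F : Finset V, F.card ≤ 54 * m + 8 →
      ∃ x ∉ F, G.Adj u x ∧ G.Adj v x := by
    intro u v F hF
    by_contra! hno
    have h1 := G.minDegree_le_degree u
    have h2 := G.minDegree_le_degree v
    rw [← G.card_neighborFinset_eq_degree] at h1 h2
    have h3 := Finset.card_union_add_card_inter (G.neighborFinset u) (G.neighborFinset v)
    have h4 := Finset.card_le_univ (G.neighborFinset u ∪ G.neighborFinset v)
    have h5 : (G.neighborFinset u ∩ G.neighborFinset v).card ≤ F.card := by
      refine Finset.card_le_card fun x hx => ?_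
      rw [Finset.mem_inter, SimpleGraph.mem_neighborFinset, SimpleGraph.mem_neighborFinset] at hx
      by_contra hxF
      exact hno x hxF hx.1 hx.2
    omega
  have hhit : ∀ i : Fin 3, ∃ A : Finset V, A.card ≤ 9 * (2 * m) ∧ ∀ x y l l',
      IsSwitch_s2 G (colorWeight χ i) 1 x y l l' → l.length ≤ 6 → ∃ v ∈ x :: (l ++ [y]), v ∈ A := by
    intro i
    refine exists_hitting_set (fun u v F hF => hcommon u v F (by omega)) (by omega) ?_
    intro x H H' hH hH'
    have h1 := abs_lt.1 (hbias x H hH i)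
    have h2 := abs_lt.1 (hbias x H' hH' i)
    push_cast
    linarith
  choose B hB hBhit using hhit
  obtain ⟨A, hAcard, hBA⟩ : ∃ A : Finset V, A.card ≤ 54 * m ∧ ∀ i, B i ⊆ A := by
    refine ⟨Finset.univ.biUnion B, ?_, fun i => Finset.subset_biUnion_of_mem B (Finset.mem_univ i)⟩
    refine (Finset.card_biUnion_le_card_mul _ _ _ fun i _ => hB i).trans ?_
    simp
    omega
  have hcommonA : ∀ u v, ∀ F : Finset V, F.card ≤ A.card + 8 →
      ∃ x ∉ F, G.Adj u x ∧ G.Adj v x := fun u v F hF => hcommon u v F (by omega)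
  have hpot : ∀ i, ∃ g : V → ℤ, ∀ u a b, u ∉ A → a ∉ A → b ∉ A → G.Adj u a → G.Adj u b →
      G.Adj a b → g u = colorWeight χ i s(u, a) + colorWeight χ i s(u, b)
        - colorWeight χ i s(a, b) := fun i =>
    exists_potential hcommonA fun x y l l' h hl =>
      (hBhit i x y l l' h hl).imp fun _ hv => ⟨hv.1, hBA i hv.2⟩
  choose g hg using hpot
  obtain ⟨hadd, hlabel⟩ := exists_labelling hcommonA hg
  have hgb : ∀ i, ∀ u ∉ A, -1 ≤ g i u ∧ g i u ≤ 2 := by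
    intro i u hu
    rcases hlabel with ⟨c, hc⟩ | ⟨k, c, hc⟩ <;> rw [hc u hu i] <;> split_ifs <;> simp
  have hsum : ∀ i, |3 * (∑ u ∈ Aᶜ, g i u) - n| ≤ 489 * m := by
    intro i
    obtain ⟨x, H, hH, hHw⟩ := exists_isHamiltonianCycle_weight_near (G := G)
      (w := colorWeight χ i) (g := g i) (A := A) (by omega) (hadd i) (hgb i)
      (fun e => by unfold colorWeight; split_ifs <;> simp)
    have h1 := abs_lt.1 (hbias x H hH i)
    rw [abs_le] at hHw ⊢
    have h2 : (A.card : ℤ) ≤ 54 * m := by exact_mod_cast hAcard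
    constructor <;> linarith
  have hcompl : ((Aᶜ.card : ℕ) : ℤ) + A.card = n := by
    rw [hn]
    exact_mod_cast Finset.card_compl_add_card A
  have hmem : ∀ (c : V → Fin 3) i v, v ∈ Aᶜ.filter (fun v => c v = i) ↔ v ∉ A ∧ c v = i := by
    simp
  have hPd : ∀ (c : V → Fin 3) (i j : Fin 3), i ≠ j →
      Disjoint (Aᶜ.filter (fun v => c v = i)) (Aᶜ.filter (fun v => c v = j)) := by
    intro c i j hij
    rw [Finset.disjoint_left]
    intro v hv hv'
    exact hij ((((hmem c i v).1 hv).2).symm.trans ((hmem c j v).1 hv').2)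
  have hcount : ∀ (c : V → Fin 3) i, ∑ u ∈ Aᶜ, (if c u = i then (1 : ℤ) else 0)
      = (Aᶜ.filter (fun v => c v = i)).card := by
    intro c i
    rw [Finset.card_filter]
    push_cast
    rfl
  rcases hlabel with ⟨c, hc⟩ | ⟨k, c, hc⟩
  · have hsize : ∀ i, 2 * ((Aᶜ.filter (fun v => c v = i)).card : ℤ)
        = Aᶜ.card - ∑ u ∈ Aᶜ, g i u := by
      intro i
      rw [Finset.sum_congr rfl fun u hu => hc u (Finset.mem_compl.1 hu) i,
        Finset.sum_sub_distrib, ← Finset.mul_sum, hcount]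
      simp
    obtain ⟨P, Z, hPdisj, hPun, hPcard, hZ, hPZ⟩ := exists_partition_near_s2
      (P := fun i => Aᶜ.filter (fun v => c v = i)) (t := fun _ => n / 3) (D := 109 * m)
      (hPd c) (by omega) (by
        intro i
        have h1 := hsize i
        have h2 := abs_le.1 (hsum i)
        omega)
    refine ⟨P, Z, by omega, hPdisj, hPun, Or.inl ⟨fun i => by rw [hPcard]; omega, ?_⟩⟩
    intro i j u v huv hu hv huZ hvZ
    obtain ⟨huA, hui⟩ := (hmem c i u).1 (hPZ i u hu huZ)
    obtain ⟨hvA, hvj⟩ := (hmem c j v).1 (hPZ j v hv hvZ)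
    have hkey := fun t => hadd t u v huA hvA huv
    simp only [hc u huA, hc v hvA, hui, hvj] at hkey
    refine ⟨?_, fun k hik hjk => eq_of_colorWeight_eq_one ?_⟩
    · rintro rfl
      have := hkey i
      rw [if_pos rfl] at this
      unfold colorWeight at this
      split_ifs at this <;> omega
    · have := hkey k
      rw [if_neg hik, if_neg hjk] at this
      linarith
  · have hsize : ∀ i, 2 * ((Aᶜ.filter (fun v => c v = i)).card : ℤ)
        = (∑ u ∈ Aᶜ, g i u) + if k = i then (Aᶜ.card : ℤ) else 0 := by
      intro i
      rw [Finset.sum_congr rfl fun u hu => hc u (Finset.mem_compl.1 hu) i,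
        Finset.sum_sub_distrib, ← Finset.mul_sum, hcount]
      simp
    obtain ⟨P, Z, hPdisj, hPun, hPcard, hZ, hPZ⟩ := exists_partition_near_s2
      (P := fun i => Aᶜ.filter (fun v => c v = i))
      (t := fun i => if i = k then 4 * (n / 6) else n / 6) (D := 109 * m)
      (hPd c) (by fin_cases k <;> simp <;> omega) (by
        intro i
        have h1 := hsize i
        have h2 := abs_le.1 (hsum i)
        by_cases hik : i = k
        · rw [if_pos hik.symm] at h1
          simp only [if_pos hik]
          omega
        · rw [if_neg (Ne.symm hik)] at h1
          simp only [if_neg hik]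
          omega)
    refine ⟨P, Z, by omega, hPdisj, hPun, Or.inr ⟨k, by rw [hPcard, if_pos rfl]; omega,
      fun i hik => by rw [hPcard, if_neg hik]; omega, ?_⟩⟩
    intro i j u v huv hu hv huZ hvZ
    obtain ⟨huA, hui⟩ := (hmem c i u).1 (hPZ i u hu huZ)
    obtain ⟨hvA, hvj⟩ := (hmem c j v).1 (hPZ j v hv hvZ)
    have hkey := fun t => hadd t u v huA hvA huv
    simp only [hc u huA, hc v hvA, hui, hvj] at hkey
    by_cases hjk : j = k
    · subst hjk
      refine Or.inl ⟨rfl, eq_of_colorWeight_eq_one ?_⟩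
      have := hkey i
      by_cases hji : j = i
      · simp only [hji, if_true] at this
        linarith
      · simp only [hji, if_true, if_false] at this
        linarith
    by_cases hik : i = k
    · subst hik
      refine Or.inr ⟨rfl, eq_of_colorWeight_eq_one ?_⟩
      have := hkey j
      simp only [Ne.symm hjk, if_true, if_false] at this
      linarith
    · exfalso
      have := hkey k
      simp only [hjk, hik, if_true, if_false] at this
      unfold colorWeight at this
      split_ifs at this <;> omega

/-- Stability theorem for `r = 3`: for sufficiently large `n` with `6 ∣ n`, if `G` is an
`n`-vertex graph with `δ(G) ≥ n/2 + 54m` (where `m < 2⁻⁶·9·n`, `s = 900m`) and every Hamilton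
cycle has color-bias less than `m`, then either (1) there is a partition into three parts of
size `n/3` with each `G[V_i]` `s`-nearly empty and each `G[V_i, V_j]` `(s,k)`-nearly
monochromatic (for `{i,j,k} = [3]`), or (2) there are a color `k` and a partition with
`|V_k| = 2n/3`, `|V_i| = n/6` for `i ≠ k`, with `G[V_k]` `(s,k)`-nearly monochromatic,
`G[V_i, V_k]` `(s,i)`-nearly monochromatic for `i ≠ k`, and `G[⋃_{i ≠ k} V_i]` `s`-nearly
empty. -/
theorem statement2 :
    ∃ N : ℕ, ∀ (V : Type) [Fintype V] [DecidableEq V], ∀ n m s : ℕ,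
      n = Fintype.card V → N ≤ n → 6 ∣ n →
      1 ≤ m → 2 ^ 6 * m < 9 * n → s = 900 * m →
      ∀ (G : SimpleGraph V) [DecidableRel G.Adj],
        (n : ℚ) / 2 + 54 * m ≤ (G.minDegree : ℚ) →
        ∀ χ : Sym2 V → Fin 3,
          (∀ (v : V) (H : G.Walk v v), H.IsHamiltonianCycle →
            ∀ i : Fin 3,
              |((H.edges.filter (fun e => χ e = i)).length : ℚ) - (n : ℚ) / 3| < m) →
          (∃ P : Fin 3 → Finset V,
            (∀ i j : Fin 3, i ≠ j → Disjoint (P i) (P j)) ∧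
            Finset.univ.biUnion P = Finset.univ ∧
            (∀ i : Fin 3, 3 * (P i).card = n) ∧
            (∀ i : Fin 3, ¬ HasMatchingOn s
              (fun ed => ed ∈ G.edgeSet ∧ ∀ x ∈ ed, x ∈ P i)) ∧
            (∀ i j k : Fin 3, i ≠ j → j ≠ k → i ≠ k → ¬ HasMatchingOn s
              (fun ed => (∃ u w : V, ed = s(u, w) ∧ G.Adj u w ∧ u ∈ P i ∧ w ∈ P j) ∧
                χ ed ≠ k))) ∨
          (∃ (k : Fin 3) (P : Fin 3 → Finset V),
            (∀ i j : Fin 3, i ≠ j → Disjoint (P i) (P j)) ∧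
            Finset.univ.biUnion P = Finset.univ ∧
            3 * (P k).card = 2 * n ∧
            (∀ i : Fin 3, i ≠ k → 6 * (P i).card = n) ∧
            ¬ HasMatchingOn s
              (fun ed => ed ∈ G.edgeSet ∧ (∀ x ∈ ed, x ∈ P k) ∧ χ ed ≠ k) ∧
            (∀ i : Fin 3, i ≠ k → ¬ HasMatchingOn s
              (fun ed => (∃ u w : V, ed = s(u, w) ∧ G.Adj u w ∧ u ∈ P i ∧ w ∈ P k) ∧
                χ ed ≠ i)) ∧
            ¬ HasMatchingOn s
              (fun ed => ed ∈ G.edgeSet ∧ ∀ x ∈ ed, ∃ i : Fin 3, i ≠ k ∧ x ∈ P i)) := by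
  refine ⟨0, ?_⟩
  intro V _ _ n m s hn _ h6 hm _ hs G _ hdeg χ hbias
  subst hs
  have hdeg' : n + 108 * m ≤ 2 * G.minDegree := by
    have : (n : ℚ) + 108 * m ≤ 2 * G.minDegree := by linarith
    exact_mod_cast this
  have hbias' : ∀ (v : V) (H : G.Walk v v), H.IsHamiltonianCycle → ∀ i : Fin 3,
      |3 * (H.edges.map (colorWeight χ i)).sum - n| < 3 * m := by
    intro v H hH i
    have h := abs_lt.1 (hbias v H hH i)
    rw [← length_filter_eq_sum_colorWeight, abs_lt]
    have h1 : -(3 * m : ℚ) < 3 * ((H.edges.filter (fun e => χ e = i)).length : ℚ) - n := by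
      linarith
    have h2 : 3 * ((H.edges.filter (fun e => χ e = i)).length : ℚ) - n < 3 * m := by
      linarith
    exact ⟨by exact_mod_cast h1, by exact_mod_cast h2⟩
  obtain ⟨P, Z, hZ, hdisj, hun, ⟨hcard, hedge⟩ | ⟨k, hk, hcard, hedge⟩⟩ :=
    exists_partition_of_unbiased hn h6 hm hdeg' hbias'
  · refine Or.inl ⟨P, hdisj, hun, hcard, fun i => ?_, fun i j k _ hjk hik => ?_⟩
    · refine not_hasMatchingOn_of_cover hZ fun e => ?_
      induction e using Sym2.ind with
      | _ u v =>
        rintro ⟨huv, hP⟩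
        by_contra! hno
        exact (hedge i i u v huv (hP u (by simp)) (hP v (by simp))
          (hno u (by simp)) (hno v (by simp))).1 rfl
    · refine not_hasMatchingOn_of_cover hZ ?_
      rintro _ ⟨⟨u, v, rfl, huv, hu, hv⟩, hχ⟩
      by_contra! hno
      exact hχ ((hedge i j u v huv hu hv (hno u (by simp)) (hno v (by simp))).2 k hik hjk)
  · refine Or.inr ⟨k, P, hdisj, hun, hk, hcard, ?_, fun i hik => ?_, ?_⟩
    · refine not_hasMatchingOn_of_cover hZ fun e => ?_
      induction e using Sym2.ind with
      | _ u v =>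
        rintro ⟨huv, hP, hχ⟩
        by_contra! hno
        have := hedge k k u v huv (hP u (by simp)) (hP v (by simp))
          (hno u (by simp)) (hno v (by simp))
        simp [hχ] at this
    · refine not_hasMatchingOn_of_cover hZ ?_
      rintro _ ⟨⟨u, v, rfl, huv, hu, hv⟩, hχ⟩
      by_contra! hno
      have := hedge i k u v huv hu hv (hno u (by simp)) (hno v (by simp))
      simp [hχ, hik] at this
    · refine not_hasMatchingOn_of_cover hZ fun e => ?_
      induction e using Sym2.ind with
      | _ u v =>
        rintro ⟨huv, hP⟩
        by_contra! hno
        obtain ⟨i, hik, hu⟩ := hP u (by simp)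
        obtain ⟨j, hjk, hv⟩ := hP v (by simp)
        have := hedge i j u v huv hu hv (hno u (by simp)) (hno v (by simp))
        simp [hik, hjk] at this
end

section
/- For every integer C ≥ 1, let G be a graph on n vertices with minimum degree δ(G) ≥ n/2 + (C+1)/2, and let L be a subgraph of G that is a union of vertex-disjoint paths with |E(L)| ≤ C. Then there exists a Hamilton cycle of G containing L as a subgraph (i.e., containing every edge of L). -/
open SimpleGraph

namespace SimpleGraph

variable {V : Type*} {G L : SimpleGraph V} {u v : V}

namespace Walk

lemma exists_eq_append_cons_of_mem_darts {d : G.Dart} (p : G.Walk u v) (hd : d ∈ p.darts) :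
    ∃ (q : G.Walk u d.fst) (r : G.Walk d.snd v), p = q.append (cons d.adj r) := by
  induction p with
  | nil => simp at hd
  | cons h p ih =>
    rw [darts_cons, List.mem_cons] at hd
    obtain rfl | hd := hd
    · exact ⟨nil, p, rfl⟩
    · obtain ⟨q, r, rfl⟩ := ih hd
      exact ⟨cons h q, r, rfl⟩

lemma IsHamiltonian.cons_isHamiltonianCycle [Fintype V] [DecidableEq V] {p : G.Walk u v}
    (hp : p.IsHamiltonian) (h : G.Adj v u) (hV : 3 ≤ Fintype.card V) :
    (cons h p).IsHamiltonianCycle := by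
  have hlen := hp.length_eq
  refine isHamiltonianCycle_iff_isCycle_and_length_eq.2
    ⟨(cons_isCycle_iff _ _).2 ⟨hp.isPath, fun he ↦ ?_⟩, by rw [length_cons]; lia⟩
  have := hp.isPath.length_eq_one_of_mem_edges (Sym2.eq_swap ▸ he)
  lia

/-- A Hamiltonian cycle with one of its edges removed is a Hamiltonian path. -/
lemma IsHamiltonianCycle.exists_isHamiltonian_of_mem_edges [DecidableEq V] {a : V}
    {H : G.Walk a a} (hH : H.IsHamiltonianCycle) {e : Sym2 V} (he : e ∈ H.edges) :
    ∃ (x y : V) (p : G.Walk x y), p.IsHamiltonian ∧ e ∉ p.edges ∧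
      ∀ f ∈ H.edges, f ≠ e → f ∈ p.edges := by
  obtain ⟨d, hd, rfl⟩ := List.mem_map.1 he
  obtain ⟨q, r, rfl⟩ := H.exists_eq_append_cons_of_mem_darts hd
  have hc := (isHamiltonianCycle_iff_isCycle_and_support_count_tail_eq_one.1 hH).2
  have hn := hH.isCycle.edges_nodup
  refine ⟨_, _, r.append q, fun b ↦ ?_, ?_, ?_⟩
  · rw [← hc b]
    simp only [support_append, support_cons, List.tail_cons, List.count_append,
      List.tail_append_of_ne_nil q.support_ne_nil]
    lia
  · rw [edges_append, edges_cons, List.nodup_middle, List.nodup_cons] at hn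
    change s(d.fst, d.snd) ∉ _
    simpa [edges_append, or_comm] using hn.1
  · intro f hf hne
    change f ≠ s(d.fst, d.snd) at hne
    simp only [edges_append, edges_cons, List.mem_append, List.mem_cons] at hf ⊢
    tauto

/-- A Hamiltonian path traversing all of `L` whose endpoints have large degree sum can be closed
to a Hamiltonian cycle traversing all of `L`. -/
lemma IsHamiltonian.exists_isHamiltonianCycle [Fintype V] [DecidableEq V] {p : G.Walk u v}
    (hp : p.IsHamiltonian) (hV : 3 ≤ Fintype.card V)
    (hdeg : Fintype.card V + L.edgeSet.ncard ≤
      (G.neighborSet u).ncard + (G.neighborSet v).ncard)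
    (hL : ∀ e ∈ L.edgeSet, e ∈ p.edges) :
    ∃ (a : V) (H : G.Walk a a), H.IsHamiltonianCycle ∧ ∀ e ∈ L.edgeSet, e ∈ H.edges := by
  classical
  have hlen := hp.length_eq
  obtain ⟨d, hd, hdv, hdu, hdL⟩ : ∃ d ∈ p.darts, G.Adj v d.fst ∧ G.Adj u d.snd ∧
      d.edge ∉ L.edgeSet := by
    by_contra! hcon
    let D : Set G.Dart := {d | d ∈ p.darts}
    let A : Set G.Dart := {d | d ∈ p.darts ∧ G.Adj v d.fst}
    let B : Set G.Dart := {d | d ∈ p.darts ∧ G.Adj u d.snd}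
    have hDfin : D.Finite := p.darts.finite_toSet
    have hAD : A ⊆ D := fun d hd ↦ hd.1
    have hBD : B ⊆ D := fun d hd ↦ hd.1
    have hD : D.ncard ≤ p.length := by
      rw [← length_darts, show D = (p.darts.toFinset : Set G.Dart) by ext; simp [D],
        Set.ncard_coe_finset]
      exact List.toFinset_card_le _
    have hA : (G.neighborSet v).ncard ≤ A.ncard := by
      refine (Set.ncard_le_ncard ?_ ((hDfin.subset hAD).image _)).trans
        (Set.ncard_image_le (f := fun d : G.Dart ↦ d.fst) (hDfin.subset hAD))
      intro w hw
      have hw' : w ∈ p.darts.map (·.fst) ++ [v] := by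
        rw [map_fst_darts_append]; exact hp.mem_support w
      have hne : w ≠ v := (G.ne_of_adj hw).symm
      simp only [List.mem_append, List.mem_singleton, hne, or_false, List.mem_map] at hw'
      obtain ⟨d, hd, rfl⟩ := hw'
      exact ⟨d, ⟨hd, hw⟩, rfl⟩
    have hB : (G.neighborSet u).ncard ≤ B.ncard := by
      refine (Set.ncard_le_ncard ?_ ((hDfin.subset hBD).image _)).trans
        (Set.ncard_image_le (f := fun d : G.Dart ↦ d.snd) (hDfin.subset hBD))
      intro w hw
      have hw' : w ∈ u :: p.darts.map (·.snd) := by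
        rw [cons_map_snd_darts]; exact hp.mem_support w
      have hne : w ≠ u := (G.ne_of_adj hw).symm
      simp only [List.mem_cons, hne, false_or, List.mem_map] at hw'
      obtain ⟨d, hd, rfl⟩ := hw'
      exact ⟨d, ⟨hd, hw⟩, rfl⟩
    have hAB : (A ∩ B).ncard ≤ L.edgeSet.ncard := by
      refine Set.ncard_le_ncard_of_injOn Dart.edge
        (fun d hd ↦ hcon d hd.1.1 hd.1.2 hd.2.2) ?_ (Set.toFinite _)
      intro d hd d' hd' h
      exact List.inj_on_of_nodup_map hp.isPath.isTrail.edges_nodup hd.1.1 hd'.1.1 h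
    have hU : (A ∪ B).ncard ≤ D.ncard := Set.ncard_le_ncard (Set.union_subset hAD hBD) hDfin
    have := Set.ncard_union_add_ncard_inter A B (hDfin.subset hAD) (hDfin.subset hBD)
    lia
  obtain ⟨q, r, rfl⟩ := p.exists_eq_append_cons_of_mem_darts hd
  have hq : (q.reverse.append (cons hdu r)).IsHamiltonian := by
    intro b
    rw [← hp b]
    simp [support_append]
  refine ⟨_, _, hq.cons_isHamiltonianCycle hdv hV, fun e he ↦ ?_⟩
  have hne : e ≠ s(d.fst, d.snd) := by
    rintro rfl
    exact hdL he
  have := hL e he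
  simp only [edges_append, edges_cons, List.mem_append, List.mem_cons, hne, false_or,
    edges_reverse, List.mem_reverse] at this ⊢
  tauto

end Walk

/-- Bondy–Chvátal closure for Hamiltonian cycles through a prescribed set of edges. -/
lemma exists_isHamiltonianCycle_of_le [Fintype V] [DecidableEq V] (hV : 3 ≤ Fintype.card V)
    (hLG : L ≤ G)
    (hdeg : ∀ u v, Fintype.card V + L.edgeSet.ncard ≤
      (G.neighborSet u).ncard + (G.neighborSet v).ncard)
    {K : SimpleGraph V} (hGK : G ≤ K)
    (hK : ∃ (a : V) (H : K.Walk a a), H.IsHamiltonianCycle ∧ ∀ e ∈ L.edgeSet, e ∈ H.edges) :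
    ∃ (a : V) (H : G.Walk a a), H.IsHamiltonianCycle ∧ ∀ e ∈ L.edgeSet, e ∈ H.edges := by
  induction K using WellFoundedLT.induction with | ind K ih =>
  obtain rfl | hlt := hGK.eq_or_lt
  · exact hK
  obtain ⟨e, heK, heG⟩ := Set.exists_of_ssubset (edgeSet_ssubset_edgeSet.2 hlt)
  have hGK' : G ≤ K.deleteEdges {e} := by
    rw [← edgeSet_subset_edgeSet, edgeSet_deleteEdges]
    exact fun f hf ↦ ⟨edgeSet_mono hGK hf, fun h ↦ heG (h ▸ hf)⟩
  have hK'K : K.deleteEdges {e} < K := by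
    rw [← edgeSet_ssubset_edgeSet, edgeSet_deleteEdges]
    exact Set.sdiff_singleton_ssubset.2 heK
  refine ih _ hK'K hGK' ?_
  obtain ⟨a, H, hH, hLH⟩ := hK
  have hmem : ∀ f ∈ K.edgeSet, f ≠ e → f ∈ (K.deleteEdges {e}).edgeSet := fun f hf hne ↦ by
    rw [edgeSet_deleteEdges]; exact ⟨hf, hne⟩
  have hLe : ∀ f ∈ L.edgeSet, f ≠ e := by
    rintro f hf rfl
    exact heG (edgeSet_mono hLG hf)
  by_cases heH : e ∈ H.edges
  · obtain ⟨x, y, p, hp, hep, hpH⟩ := hH.exists_isHamiltonian_of_mem_edges heH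
    have htr : ∀ f ∈ p.edges, f ∈ (K.deleteEdges {e}).edgeSet := fun f hf ↦
      hmem f (p.edges_subset_edgeSet hf) (fun h ↦ hep (h ▸ hf))
    have hham : (p.transfer _ htr).IsHamiltonian := fun b ↦ by
      rw [Walk.support_transfer]; exact hp b
    refine hham.exists_isHamiltonianCycle hV ((hdeg x y).trans (Nat.add_le_add ?_ ?_)) ?_
    · exact Set.ncard_le_ncard (fun w hw ↦ hGK' hw) (Set.toFinite _)
    · exact Set.ncard_le_ncard (fun w hw ↦ hGK' hw) (Set.toFinite _)
    · intro f hf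
      rw [Walk.edges_transfer]
      exact hpH f (hLH f hf) (hLe f hf)
  · have htr : ∀ f ∈ H.edges, f ∈ (K.deleteEdges {e}).edgeSet := fun f hf ↦
      hmem f (H.edges_subset_edgeSet hf) (fun h ↦ heH (h ▸ hf))
    refine ⟨a, H.transfer _ htr, Walk.isHamiltonianCycle_iff_isCycle_and_length_eq.2
      ⟨hH.isCycle.transfer htr, by rw [Walk.length_transfer, hH.length_eq]⟩, ?_⟩
    simpa using hLH

lemma IsAcyclic.exists_reachable_subsingleton_neighborSet [Finite V] (hG : G.IsAcyclic) (u : V) :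
    ∃ w, G.Reachable u w ∧ (G.neighborSet w).Subsingleton := by
  cases nonempty_fintype V
  let s : Set ℕ := {n | ∃ (w : V) (p : G.Walk u w), p.IsPath ∧ p.length = n}
  have hs : s.Finite := (Set.finite_le_nat (Fintype.card V)).subset
    fun n ⟨_, _, hp, hn⟩ ↦ hn ▸ hp.length_lt.le
  obtain ⟨_, ⟨w, p, hp, rfl⟩, hmax⟩ := hs.exists_maximal ⟨0, u, Walk.nil, by simp⟩
  have key : ∀ x, G.Adj w x → x = p.penultimate := fun x hx ↦ by
    by_cases hxp : x ∈ p.support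
    · exact hG.eq_penultimate_of_adj_end hp hx hxp
    · have := hmax ⟨x, p.concat hx, hp.concat hxp hx, rfl⟩
      rw [Walk.length_concat] at this
      lia
  exact ⟨w, p.reachable, fun x hx y hy ↦ (key x hx).trans (key y hy).symm⟩

/-- A finite connected acyclic graph of maximum degree at most two is a path. -/
lemma IsAcyclic.exists_isHamiltonian_forall_mem_edges [Finite V] [DecidableEq V]
    (hG : G.IsAcyclic) (hconn : G.Connected) (hdeg : ∀ v, (G.neighborSet v).ncard ≤ 2) :
    ∃ (u v : V) (p : G.Walk u v), p.IsHamiltonian ∧ ∀ e ∈ G.edgeSet, e ∈ p.edges := by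
  have := hconn.nonempty
  obtain ⟨u, v, p, hp, hmax⟩ := Walk.exists_isPath_forall_isPath_length_le_length G
  have key : ∀ a b, a ∈ p.support → G.Adj a b → s(a, b) ∈ p.edges := by
    intro a b ha hab
    obtain ⟨q, r, hq, hr, rfl⟩ := hp.mem_support_iff_exists_append.1 ha
    by_cases hbq : b ∈ q.support
    · have hnil : ¬ q.Nil := fun h ↦ by
        cases h
        exact hab.ne (by simpa using hbq : b = _).symm
      rw [hG.eq_penultimate_of_adj_end hq hab hbq, Walk.edges_append, Sym2.eq_swap]
      exact List.mem_append_left _ (Walk.mk_penultimate_end_mem_edges hnil)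
    by_cases hbr : b ∈ r.support
    · have hnil : ¬ r.Nil := fun h ↦ by
        cases h
        exact hab.ne (by simpa using hbr : b = _).symm
      rw [hG.eq_snd_of_adj_start hr hab hbr, Walk.edges_append]
      exact List.mem_append_right _ (Walk.mk_start_snd_mem_edges hnil)
    exfalso
    have hb : b ∉ (q.append r).support := by simp [Walk.mem_support_append_iff, hbq, hbr]
    by_cases hqn : q.Nil
    · cases hqn
      have := hmax _ _ _ (hp.cons (h := hab.symm) hb)
      simp at this
    by_cases hrn : r.Nil
    · cases hrn
      have := hmax _ _ _ (hp.concat hb hab)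
      simp at this
    have hpq : q.penultimate ∈ q.support := q.getVert_mem_support _
    have hsr : r.snd ∈ r.support := r.getVert_mem_support _
    have hne : q.penultimate ≠ r.snd :=
      hp.ne_of_mem_support_of_append (r.adj_snd hrn).ne' hpq hsr
    have hsub : ({q.penultimate, r.snd, b} : Set V) ⊆ G.neighborSet a := by
      rintro x (rfl | rfl | rfl)
      · exact (q.adj_penultimate hqn).symm
      · exact r.adj_snd hrn
      · exact hab
    have h3 : ({q.penultimate, r.snd, b} : Set V).ncard = 3 :=
      Set.ncard_eq_three.2 ⟨_, _, _, hne, ne_of_mem_of_not_mem hpq hbq, ne_of_mem_of_not_mem hsr hbr, rfl⟩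
    have := Set.ncard_le_ncard hsub (Set.toFinite _)
    have := hdeg a
    lia
  have hall : ∀ w, w ∈ p.support := by
    by_contra! ⟨w, hw⟩
    obtain ⟨c⟩ := hconn.preconnected u w
    obtain ⟨d, -, hd, hd'⟩ := c.exists_boundary_dart {x | x ∈ p.support} p.start_mem_support hw
    exact hd' (p.snd_mem_support_of_mem_edges (key _ _ hd d.adj))
  refine ⟨u, v, p, hp.isHamiltonian_of_mem hall, fun e ↦ ?_⟩
  induction e with | h a b => exact fun h ↦ key a b (hall a) h

/-- Every finite linear forest is contained in a Hamiltonian path of the complete graph. -/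
lemma IsAcyclic.exists_isHamiltonian_top [Finite V] [Nonempty V] [DecidableEq V]
    (hL : L.IsAcyclic) (hdeg : ∀ v, (L.neighborSet v).ncard ≤ 2) :
    ∃ (u v : V) (p : (⊤ : SimpleGraph V).Walk u v),
      p.IsHamiltonian ∧ ∀ e ∈ L.edgeSet, e ∈ p.edges := by
  obtain ⟨F, hLF, hF⟩ := Finite.exists_le_maximal
    (p := fun F : SimpleGraph V ↦ F.IsAcyclic ∧ ∀ v, (F.neighborSet v).ncard ≤ 2) ⟨hL, hdeg⟩
  obtain ⟨hFa, hFd⟩ := hF.prop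
  have hconn : F.Connected := by
    refine ⟨fun x y ↦ ?_⟩
    by_contra hxy
    obtain ⟨a, hxa, ha⟩ := hFa.exists_reachable_subsingleton_neighborSet x
    obtain ⟨b, hyb, hb⟩ := hFa.exists_reachable_subsingleton_neighborSet y
    have hab : ¬ F.Reachable a b := fun h ↦ hxy ((hxa.trans h).trans hyb.symm)
    have hadj : (F ⊔ edge a b).Adj a b :=
      .inr ((edge_adj ..).2 ⟨.inl ⟨rfl, rfl⟩, fun h ↦ hab (h ▸ .rfl)⟩)
    refine hab (Adj.reachable (hF.le_of_ge ⟨hFa.sup_edge_of_not_reachable hab, fun w ↦ ?_⟩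
      le_sup_left hadj))
    have hins : ∀ c d, (F.neighborSet c).Subsingleton →
        (F ⊔ edge c d).neighborSet c ⊆ insert d (F.neighborSet c) →
        ((F ⊔ edge c d).neighborSet c).ncard ≤ 2 := fun c d hc hsub ↦ by
      have h1 := Set.ncard_le_ncard hsub (Set.toFinite _)
      have h2 := Set.ncard_insert_le d (F.neighborSet c)
      have h3 := Set.ncard_le_one_iff_subsingleton.2 hc
      lia
    have hsub : ∀ c d, (F ⊔ edge c d).neighborSet c ⊆ insert d (F.neighborSet c) := by
      intro c d z hz
      simp only [mem_neighborSet, sup_adj, edge_adj] at hz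
      simp only [Set.mem_insert_iff, mem_neighborSet]
      grind
    by_cases hwa : w = a
    · subst hwa
      exact hins _ _ ha (hsub _ _)
    by_cases hwb : w = b
    · subst hwb
      rw [edge_comm]
      exact hins _ _ hb (hsub _ _)
    · refine (Set.ncard_le_ncard (fun z hz ↦ ?_) (Set.toFinite _)).trans (hFd w)
      simpa [edge_adj, hwa, hwb] using hz
  obtain ⟨u, v, p, hp, hpF⟩ := hFa.exists_isHamiltonian_forall_mem_edges hconn hFd
  refine ⟨u, v, p.mapLe le_top, fun b ↦ ?_, fun e he ↦ ?_⟩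
  · simpa using hp b
  · simpa using hpF e (edgeSet_mono hLF he)

end SimpleGraph

/-- Pósa's lemma: for every integer `C ≥ 1`, if `G` is a graph on `n` vertices with minimum
degree `δ(G) ≥ n/2 + (C+1)/2` and `L` is a subgraph of `G` that is a union of vertex-disjoint
paths (an acyclic subgraph of maximum degree at most 2) with at most `C` edges, then `G` has a
Hamilton cycle containing every edge of `L`. -/
theorem statement3 {V : Type*} [Fintype V] [DecidableEq V] (C : ℕ) (hC : 1 ≤ C)
    (G : SimpleGraph V) [DecidableRel G.Adj]
    (hδ : (Fintype.card V : ℚ) / 2 + ((C : ℚ) + 1) / 2 ≤ (G.minDegree : ℚ))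
    (L : SimpleGraph V) [DecidableRel L.Adj] (hLG : L ≤ G)
    (hacyclic : ∀ (v : V) (c : L.Walk v v), ¬ c.IsCycle)
    (hmaxdeg : ∀ v : V, L.degree v ≤ 2)
    (hE : L.edgeFinset.card ≤ C) :
    ∃ (v : V) (H : G.Walk v v), H.IsHamiltonianCycle ∧ ∀ e ∈ L.edgeSet, e ∈ H.edges := by
  have hLd : ∀ v, (L.neighborSet v).ncard ≤ 2 := fun v ↦ by
    rw [Set.ncard_eq_toFinset_card', ← neighborFinset_def, card_neighborFinset_eq_degree]
    exact hmaxdeg v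
  have hLe : L.edgeSet.ncard ≤ C := by
    rw [Set.ncard_eq_toFinset_card']
    exact hE
  have hδ' : Fintype.card V + C + 1 ≤ 2 * G.minDegree := by
    have : ((Fintype.card V + C + 1 : ℕ) : ℚ) ≤ (2 * G.minDegree : ℕ) := by
      push_cast
      linarith
    exact_mod_cast this
  have hGd : ∀ v, G.minDegree ≤ (G.neighborSet v).ncard := fun v ↦ by
    rw [Set.ncard_eq_toFinset_card', ← neighborFinset_def, card_neighborFinset_eq_degree]
    exact G.minDegree_le_degree v
  have hne : Nonempty V := by
    by_contra h
    rw [not_nonempty_iff] at h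
    simp at hδ'
  have hV : 3 ≤ Fintype.card V := by
    obtain ⟨v⟩ := hne
    have := G.minDegree_le_degree v
    have := G.degree_lt_card_verts v
    lia
  obtain ⟨u, v, p, hp, hpL⟩ := IsAcyclic.exists_isHamiltonian_top hacyclic hLd
  have hvu : v ≠ u := by
    rintro rfl
    have := hp.length_eq
    have := Walk.length_eq_zero_iff.2 (Walk.isPath_iff_nil.1 hp.isPath)
    lia
  refine exists_isHamiltonianCycle_of_le hV hLG (fun x y ↦ ?_) le_top
    ⟨v, _, hp.cons_isHamiltonianCycle ((top_adj _ _).2 hvu) hV, fun e he ↦ ?_⟩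
  · have := hGd x
    have := hGd y
    lia
  · rw [Walk.edges_cons]
    exact List.mem_cons_of_mem _ (hpL e he)
end

section
/- Let r ≥ 2 and m ≥ 1 be integers, let G be an n-vertex graph with minimum degree δ(G) ≥ n/2 + 6r²m, and let χ : E(G) → [r] be an edge-coloring such that every Hamilton cycle H of G satisfies d_χ(H) < m. Then there exists a set S ⊆ V(G) with |S| ≤ 10rm such that the induced subgraph G' = G[V(G)∖S] contains no bad bowtie (that is, no five vertices of G' span a bowtie subgraph of G' that is bad). -/
open SimpleGraph

/-- A bowtie on vertices `v₁,…,v₅`: five distinct vertices with edges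
`v₁v₂, v₁v₃, v₁v₄, v₁v₅, v₂v₃, v₄v₅`. -/
def IsBowtie {V : Type*} (G : SimpleGraph V) (v₁ v₂ v₃ v₄ v₅ : V) : Prop :=
  [v₁, v₂, v₃, v₄, v₅].Nodup ∧
    G.Adj v₁ v₂ ∧ G.Adj v₁ v₃ ∧ G.Adj v₁ v₄ ∧ G.Adj v₁ v₅ ∧ G.Adj v₂ v₃ ∧ G.Adj v₄ v₅

/-- The color-counting function
`f(B,k) = 1_k(v₁v₂)+1_k(v₁v₃)+1_k(v₄v₅)−1_k(v₁v₄)−1_k(v₁v₅)−1_k(v₂v₃)` of a bowtie.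
The bowtie is `k`-bad if `f(B,k) ≠ 0`, and bad if it is `k`-bad for some color `k`. -/
def bowtieF {V : Type*} {r : ℕ} (χ : Sym2 V → Fin r) (v₁ v₂ v₃ v₄ v₅ : V) (k : Fin r) : ℤ :=
  (if χ s(v₁, v₂) = k then 1 else 0) + (if χ s(v₁, v₃) = k then 1 else 0)
    + (if χ s(v₄, v₅) = k then 1 else 0) - (if χ s(v₁, v₄) = k then 1 else 0)
    - (if χ s(v₁, v₅) = k then 1 else 0) - (if χ s(v₂, v₃) = k then 1 else 0)

/-- The multiset of edges joining consecutive vertices of a list. -/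
def pathEdges {V : Type*} : List V → Multiset (Sym2 V)
  | [] => 0
  | [_] => 0
  | a :: b :: l => s(a, b) ::ₘ pathEdges (b :: l)

/-- The multiset of edges joining cyclically consecutive vertices of a list. -/
def cycleEdges {V : Type*} : List V → Multiset (Sym2 V)
  | [] => 0
  | a :: l => pathEdges (a :: (l ++ [a]))

section ListEdges

variable {V : Type*}

lemma pathEdges_singleton (a : V) : pathEdges [a] = 0 := rfl

lemma pathEdges_cons_cons (a b : V) (l : List V) :
    pathEdges (a :: b :: l) = s(a, b) ::ₘ pathEdges (b :: l) := rfl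

lemma pathEdges_append_cons (p : List V) (x : V) (q : List V) :
    pathEdges (p ++ x :: q) = pathEdges (p ++ [x]) + pathEdges (x :: q) := by
  induction p with
  | nil => simp [pathEdges_singleton]
  | cons a p ih =>
    cases p with
    | nil => simp [pathEdges_cons_cons, pathEdges_singleton]
    | cons b p =>
      simp only [List.cons_append, pathEdges_cons_cons, Multiset.cons_add] at ih ⊢
      rw [ih]

lemma pathEdges_append_pair (p : List V) (x y : V) :
    pathEdges (p ++ [x, y]) = pathEdges (p ++ [x]) + {s(x, y)} := by
  rw [pathEdges_append_cons]
  rfl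

lemma pathEdges_reverse (l : List V) : pathEdges l.reverse = pathEdges l := by
  induction l with
  | nil => rfl
  | cons a l ih =>
    cases l with
    | nil => rfl
    | cons b l =>
      have h : (a :: b :: l).reverse = l.reverse ++ [b, a] := by simp
      rw [h, pathEdges_append_pair, pathEdges_cons_cons, ← ih, Sym2.eq_swap]
      simp [add_comm, ← Multiset.singleton_add]

lemma cycleEdges_append_cons (p : List V) (x : V) (q : List V) :
    cycleEdges (p ++ x :: q) = cycleEdges (x :: q ++ p) := by
  cases p with
  | nil => simp
  | cons a p =>
    have h₁ : cycleEdges (a :: p ++ x :: q) = pathEdges ((a :: p) ++ x :: (q ++ [a])) := by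
      simp [cycleEdges]
    have h₂ : cycleEdges (x :: q ++ a :: p) = pathEdges ((x :: q) ++ a :: (p ++ [x])) := by
      simp [cycleEdges]
    rw [h₁, h₂, pathEdges_append_cons, pathEdges_append_cons (x :: q), add_comm]
    simp

lemma cycleEdges_append_comm (p q : List V) : cycleEdges (p ++ q) = cycleEdges (q ++ p) := by
  cases q with
  | nil => simp
  | cons x q => exact cycleEdges_append_cons p x q

lemma cycleEdges_reverse (l : List V) : cycleEdges l.reverse = cycleEdges l := by
  cases l with
  | nil => rfl
  | cons a l =>
    rw [List.reverse_cons, cycleEdges_append_comm]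
    change pathEdges (a :: (l.reverse ++ [a])) = pathEdges (a :: (l ++ [a]))
    rw [← pathEdges_reverse]
    simp

lemma mem_of_mem_pathEdges {l : List V} {x y : V} (h : s(x, y) ∈ pathEdges l) : x ∈ l := by
  induction l with
  | nil => simp [pathEdges] at h
  | cons a l ih =>
    cases l with
    | nil => simp [pathEdges] at h
    | cons b l =>
      rw [pathEdges_cons_cons, Multiset.mem_cons] at h
      rcases h with h | h
      · rcases Sym2.eq_iff.1 h with ⟨rfl, rfl⟩ | ⟨rfl, rfl⟩ <;> simp
      · exact List.mem_cons_of_mem _ (ih h)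

lemma exists_split_of_mem_pathEdges {l : List V} {x y : V} (h : s(x, y) ∈ pathEdges l) :
    ∃ p q, l = p ++ x :: y :: q ∨ l = p ++ y :: x :: q := by
  induction l with
  | nil => simp [pathEdges] at h
  | cons a l ih =>
    cases l with
    | nil => simp [pathEdges] at h
    | cons b l =>
      rw [pathEdges_cons_cons, Multiset.mem_cons] at h
      rcases h with h | h
      · refine ⟨[], l, ?_⟩
        rcases Sym2.eq_iff.1 h with ⟨rfl, rfl⟩ | ⟨rfl, rfl⟩ <;> simp
      · obtain ⟨p, q, h | h⟩ := ih h
        · exact ⟨a :: p, q, Or.inl (by simp [h])⟩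
        · exact ⟨a :: p, q, Or.inr (by simp [h])⟩

lemma nodup_pathEdges {l : List V} (h : l.Nodup) : (pathEdges l).Nodup := by
  induction l with
  | nil => simp [pathEdges]
  | cons a l ih =>
    cases l with
    | nil => simp [pathEdges]
    | cons b l =>
      rw [pathEdges_cons_cons, Multiset.nodup_cons]
      exact ⟨fun hh => (List.nodup_cons.1 h).1 (mem_of_mem_pathEdges hh), ih (List.nodup_cons.1 h).2⟩

lemma cycleEdges_eq_cons_pathEdges {l : List V} {a b : V} (ha : l.head? = some a)
    (hb : l.getLast? = some b) : cycleEdges l = s(b, a) ::ₘ pathEdges l := by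
  obtain ⟨t, rfl⟩ := List.head?_eq_some_iff.1 ha
  obtain ⟨s, hs⟩ := List.getLast?_eq_some_iff.1 hb
  have : a :: (t ++ [a]) = s ++ [b, a] := by
    rw [← List.cons_append, hs]
    simp
  rw [cycleEdges, this, hs, pathEdges_append_pair, add_comm, Multiset.singleton_add]

/-- Every edge of a cyclic order is the closing edge of some rotation or reflection of it. -/
lemma exists_perm_closing_edge {l : List V} {x y : V} (hlen : 2 ≤ l.length)
    (h : s(x, y) ∈ cycleEdges l) :
    ∃ t, l.Perm (y :: (t ++ [x])) ∧ cycleEdges (y :: (t ++ [x])) = cycleEdges l := by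
  have key : ∀ (x y : V) (p q : List V) (a : V) (t : List V), 1 ≤ t.length →
      a :: (t ++ [a]) = p ++ x :: y :: q →
      ∃ t', (a :: t).Perm (y :: (t' ++ [x])) ∧
        cycleEdges (y :: (t' ++ [x])) = cycleEdges (a :: t) := by
    intro x y p q a t ht heq
    obtain rfl | ⟨q, z, rfl⟩ := q.eq_nil_or_concat'
    · have h₁ : (a :: t) ++ [a] = (p ++ [x]) ++ [y] := by simpa using heq
      obtain ⟨h₂, h₃⟩ := List.append_inj' h₁ rfl
      obtain _ | ⟨b, p⟩ := p
      · simp only [List.nil_append, List.cons.injEq] at h₂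
        simp [h₂.2] at ht
      · simp only [List.cons_append, List.cons.injEq] at h₂ h₃
        obtain ⟨rfl, rfl⟩ := h₂
        obtain ⟨rfl, -⟩ := h₃
        exact ⟨p, .refl _, rfl⟩
    · have h₁ : (a :: t) ++ [a] = (p ++ x :: y :: q) ++ [z] := by simpa using heq
      obtain ⟨h₂, -⟩ := List.append_inj' h₁ rfl
      have h₃ : p ++ x :: y :: q = (p ++ [x]) ++ (y :: q) := by simp
      have h₄ : y :: (q ++ p ++ [x]) = (y :: q) ++ (p ++ [x]) := by simp
      refine ⟨q ++ p, ?_, ?_⟩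
      · rw [h₂, h₃, h₄]
        exact List.perm_append_comm
      · rw [h₂, h₃, h₄, cycleEdges_append_comm]
  obtain _ | ⟨a, t⟩ := l
  · simp at hlen
  have ht : 1 ≤ t.length := by simpa using hlen
  obtain ⟨p, q, hpq | hpq⟩ := exists_split_of_mem_pathEdges h
  · exact key x y p q a t ht hpq
  · obtain ⟨t', h₁, h₂⟩ := key y x p q a t ht hpq
    have h₃ : y :: (t'.reverse ++ [x]) = (x :: (t' ++ [y])).reverse := by simp
    refine ⟨t'.reverse, ?_, ?_⟩
    · rw [h₃]
      exact h₁.trans (List.reverse_perm _).symm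
    · rw [h₃, cycleEdges_reverse, h₂]

/-- Reversing a segment of a cyclic order exchanges two edges. -/
lemma cycleEdges_reverse_segment {p q : List V} {a c d x : V}
    (ha : (p ++ c :: d :: q).head? = some a) (hx : (p ++ c :: d :: q).getLast? = some x) :
    cycleEdges (p ++ c :: (d :: q).reverse) + {s(x, a), s(c, d)} =
      cycleEdges (p ++ c :: d :: q) + {s(c, x), s(d, a)} := by
  obtain ⟨s, hs⟩ := List.getLast?_eq_some_iff.1 (show (d :: q).getLast? = some x by simpa using hx)
  have hrev : (d :: q).reverse = x :: s.reverse := by rw [hs]; simp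
  have ha' : (p ++ c :: (d :: q).reverse).head? = some a := by
    cases p <;> simpa using ha
  have hd : (p ++ c :: (d :: q).reverse).getLast? = some d :=
    List.getLast?_eq_some_iff.2 ⟨p ++ c :: q.reverse, by simp⟩
  rw [cycleEdges_eq_cons_pathEdges ha hx, cycleEdges_eq_cons_pathEdges ha' hd,
    pathEdges_append_cons p c (d :: q), pathEdges_append_cons p c, pathEdges_cons_cons, hrev,
    pathEdges_cons_cons, ← hrev, pathEdges_reverse]
  simp only [← Multiset.singleton_add, Multiset.insert_eq_cons]
  abel

lemma countP_tail_add_countP_dropLast_le (p q : V → Prop) [DecidablePred p] [DecidablePred q]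
    (F : Sym2 V → Prop) [DecidablePred F] (l : List V)
    (h : ∀ s c d t, l = s ++ c :: d :: t → q c → p d → F s(c, d)) :
    l.tail.countP p + l.dropLast.countP q ≤ (l.length - 1) + (pathEdges l).countP F := by
  induction l with
  | nil => simp
  | cons a l ih =>
    cases l with
    | nil => simp
    | cons b l =>
      have := ih fun s c d t hl => h (a :: s) c d t (by simp [hl])
      have hab := h [] a b l rfl
      simp only [List.tail_cons, List.dropLast_cons_cons, List.countP_cons, List.length_cons,
        pathEdges_cons_cons, Multiset.countP_cons, decide_eq_true_eq] at this ⊢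
      split_ifs <;> first | omega | (exfalso; tauto)

lemma exists_walk_of_pathEdges (G : SimpleGraph V) (t : List V) :
    ∀ h x : V, (∀ e ∈ pathEdges (h :: (t ++ [x])), e ∈ G.edgeSet) →
      ∃ p : G.Walk h x, p.support = h :: (t ++ [x]) ∧
        (p.edges : Multiset (Sym2 V)) = pathEdges (h :: (t ++ [x])) := by
  induction t with
  | nil =>
    intro h x hG
    have hx : G.Adj h x := hG s(h, x) (by simp [pathEdges])
    exact ⟨.cons hx .nil, by simp, by simp [pathEdges]⟩
  | cons b t ih =>
    intro h x hG
    rw [List.cons_append, pathEdges_cons_cons] at hG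
    have hb : G.Adj h b := hG s(h, b) (by simp)
    obtain ⟨p, hs, he⟩ := ih b x fun e he => hG e (by simp [he])
    refine ⟨.cons hb p, by simp [hs], ?_⟩
    rw [List.cons_append, pathEdges_cons_cons, ← he]
    simp

/-- A cyclic order on all vertices (at least three) along edges of `G` is a Hamilton cycle. -/
lemma exists_isHamiltonianCycle_of_cycleEdges [DecidableEq V] (G : SimpleGraph V) (l : List V)
    (hnd : l.Nodup) (hmem : ∀ v, v ∈ l) (hlen : 3 ≤ l.length)
    (hG : ∀ e ∈ cycleEdges l, e ∈ G.edgeSet) :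
    ∃ (v : V) (H : G.Walk v v), H.IsHamiltonianCycle ∧
      (H.edges : Multiset (Sym2 V)) = cycleEdges l := by
  obtain _ | ⟨h, t⟩ := l
  · simp at hlen
  obtain rfl | ⟨t, x, rfl⟩ := t.eq_nil_or_concat'
  · simp at hlen
  obtain _ | ⟨b, t⟩ := t
  · simp at hlen
  have hcyc := cycleEdges_eq_cons_pathEdges (l := h :: (b :: t ++ [x])) (a := h) (b := x)
    rfl (List.getLast?_eq_some_iff.2 ⟨h :: b :: t, by simp⟩)
  rw [hcyc] at hG ⊢
  have hx : G.Adj x h := hG s(x, h) (by simp)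
  obtain ⟨p, hs, he⟩ := exists_walk_of_pathEdges G (b :: t) h x
    fun e he => hG e (Multiset.mem_cons_of_mem he)
  have hp : p.IsPath := by exact SimpleGraph.Walk.IsPath.mk' (by rw [hs]; exact hnd)
  have hxh : s(x, h) ∉ p.edges := by
    rw [← Multiset.mem_coe, he, List.cons_append, pathEdges_cons_cons, Multiset.mem_cons]
    rintro (hh | hh)
    · simp only [List.cons_append, List.nodup_cons, List.mem_cons, List.mem_append] at hnd
      rcases Sym2.eq_iff.1 hh with ⟨rfl, rfl⟩ | ⟨rfl, -⟩ <;> simp at hnd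
    · rw [Sym2.eq_swap] at hh
      exact (List.nodup_cons.1 hnd).1 (mem_of_mem_pathEdges hh)
  refine ⟨x, .cons hx p, ⟨(SimpleGraph.Walk.cons_isCycle_iff p hx).2 ⟨hp, hxh⟩, ?_⟩,
    by rw [← he]; rfl⟩
  rw [SimpleGraph.Walk.tail_cons]
  refine SimpleGraph.Walk.IsPath.isHamiltonian_of_mem (by simpa using hp) fun w => ?_
  simpa [hs] using hmem w

/-- A Hamiltonian cyclic order of the complete graph can be turned into a Hamilton cycle of a graph
of large minimum degree while keeping a prescribed set of edges. -/
lemma exists_cycleEdges_subset_of_degree [Fintype V] [DecidableEq V] (G : SimpleGraph V)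
    [DecidableRel G.Adj] (F : Finset (Sym2 V)) (hFG : ∀ e ∈ F, e ∈ G.edgeSet)
    (hdeg : ∀ u v, Fintype.card V + F.card ≤ G.degree u + G.degree v) (l : List V)
    (hnd : l.Nodup) (hmem : ∀ v, v ∈ l) (hlen : 2 ≤ l.length) (hF : ∀ e ∈ F, e ∈ cycleEdges l) :
    ∃ l' : List V, l'.Nodup ∧ (∀ v, v ∈ l') ∧ (∀ e ∈ F, e ∈ cycleEdges l') ∧
      ∀ e ∈ cycleEdges l', e ∈ G.edgeSet := by
  induction hN : (cycleEdges l).countP (· ∉ G.edgeSet) using Nat.strong_induction_on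
    generalizing l with
  | _ N ih =>
    by_cases hG : ∀ e ∈ cycleEdges l, e ∈ G.edgeSet
    · exact ⟨l, hnd, hmem, hF, hG⟩
    push Not at hG
    obtain ⟨e, he, heG⟩ := hG
    induction e with
    | _ x a =>
    obtain ⟨t, hperm, hcyc⟩ := exists_perm_closing_edge hlen he
    have hnd' := hperm.nodup_iff.1 hnd
    set L := a :: (t ++ [x]) with hL
    have hmem' : ∀ v, v ∈ L := fun v => hperm.mem_iff.1 (hmem v)
    rw [← hcyc] at hF hN
    have hlenL : L.length = Fintype.card V := by
      rw [← List.toFinset_card_of_nodup hnd',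
        Finset.eq_univ_iff_forall.2 fun v => List.mem_toFinset.2 (hmem' v), Finset.card_univ]
    have hdeg₁ : G.degree a ≤ L.tail.countP (G.Adj a ·) := by
      rw [List.countP_eq_length_filter]
      refine le_trans (Finset.card_le_card fun v hv => ?_) (List.toFinset_card_le _)
      rw [SimpleGraph.mem_neighborFinset] at hv
      have := hmem' v
      rw [hL, List.mem_cons] at this
      simpa [hv, hL] using this.resolve_left hv.ne'
    have hdeg₂ : G.degree x ≤ L.dropLast.countP (G.Adj · x) := by
      rw [List.countP_eq_length_filter]
      refine le_trans (Finset.card_le_card fun v hv => ?_) (List.toFinset_card_le _)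
      rw [SimpleGraph.mem_neighborFinset] at hv
      have := hmem' v
      have hL' : L = (a :: t) ++ [x] := rfl
      rw [hL', List.mem_append, List.mem_singleton] at this
      rw [List.mem_toFinset, List.mem_filter, hL', List.dropLast_concat]
      exact ⟨this.resolve_right hv.ne', by simpa using hv.symm⟩
    have hFcard : (pathEdges L).countP (· ∈ F) ≤ F.card := by
      rw [Multiset.countP_eq_card_filter,
        ← Multiset.toFinset_card_of_nodup ((nodup_pathEdges hnd').filter _)]
      exact Finset.card_le_card fun e he => by simpa using (by simpa using he : _ ∧ _).2
    obtain ⟨s, c, d, q, hsplit, hcx, had, hcdF⟩ : ∃ s c d q, L = s ++ c :: d :: q ∧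
        G.Adj c x ∧ G.Adj a d ∧ s(c, d) ∉ F := by
      by_contra! hcon
      have := countP_tail_add_countP_dropLast_le (G.Adj a ·) (G.Adj · x) (· ∈ F) L hcon
      have := hdeg a x
      have : 0 < L.length := by simp [hL]
      omega
    have hswap := cycleEdges_reverse_segment (a := a) (x := x) (p := s) (c := c) (d := d) (q := q)
      (by rw [← hsplit]; rfl) (by rw [← hsplit]; exact List.getLast?_eq_some_iff.2 ⟨a :: t, rfl⟩)
    rw [← hsplit] at hswap
    have hperm' : (s ++ c :: (d :: q).reverse).Perm L := by
      rw [hsplit]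
      exact ((List.reverse_perm _).cons _).append_left _
    refine ih _ ?_ (s ++ c :: (d :: q).reverse) (hperm'.nodup_iff.2 hnd')
      (fun v => hperm'.mem_iff.2 (hmem' v)) ?_ ?_ rfl
    · have := congrArg (Multiset.countP (· ∉ G.edgeSet)) hswap
      have hcx' : s(c, x) ∈ G.edgeSet := hcx
      have hda' : s(d, a) ∈ G.edgeSet := had.symm
      simp only [Multiset.countP_add, Multiset.insert_eq_cons, Multiset.countP_cons, ←
        Multiset.cons_zero, Multiset.countP_zero, heG, hcx', hda', not_true, not_false_eq_true,
        if_true, if_false] at this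
      omega
    · rw [hperm'.length_eq, ← hperm.length_eq]
      exact hlen
    · intro e he
      have : e ∈ cycleEdges (s ++ c :: (d :: q).reverse) + {s(x, a), s(c, d)} := by
        rw [hswap]
        exact Multiset.mem_add.2 (Or.inl (hF e he))
      simp only [Multiset.mem_add, Multiset.insert_eq_cons, Multiset.mem_cons,
        Multiset.mem_singleton] at this
      rcases this with h | rfl | rfl
      · exact h
      · exact absurd (hFG _ he) heG
      · exact absurd he hcdF

/-- If a cyclic order contains the edges `v₂v₁`, `v₁v₃`, `v₄v₅`, then moving `v₁` between `v₄` and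
`v₅` replaces these edges by `v₂v₃`, `v₁v₄`, `v₁v₅`. -/
lemma exists_perm_move_vertex {l : List V} (hnd : l.Nodup) {v₁ v₂ v₃ v₄ v₅ : V}
    (hv : [v₁, v₂, v₃, v₄, v₅].Nodup) (h₂₁ : s(v₂, v₁) ∈ cycleEdges l)
    (h₁₃ : s(v₁, v₃) ∈ cycleEdges l) (h₄₅ : s(v₄, v₅) ∈ cycleEdges l) :
    ∃ l', l'.Perm l ∧ cycleEdges l' + {s(v₂, v₁), s(v₁, v₃), s(v₄, v₅)} =
      cycleEdges l + {s(v₂, v₃), s(v₁, v₄), s(v₁, v₅)} := by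
  simp only [List.nodup_cons, List.mem_cons, not_or, List.not_mem_nil, not_false_eq_true,
    List.nodup_nil, and_true] at hv
  have hlen : 2 ≤ l.length := by
    rcases l with _ | ⟨a, _ | ⟨b, l⟩⟩
    · simp [cycleEdges] at h₁₃
    · simp only [cycleEdges, pathEdges, List.nil_append, Multiset.mem_cons, Multiset.notMem_zero,
        or_false, Sym2.eq_iff] at h₁₃
      grind
    · simp
  obtain ⟨t, hperm, hcyc⟩ := exists_perm_closing_edge hlen h₁₃
  have hnd' := hperm.nodup_iff.1 hnd
  rw [← hcyc] at h₂₁ h₄₅ ⊢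
  have hclose := cycleEdges_eq_cons_pathEdges (l := v₃ :: (t ++ [v₁])) (a := v₃) (b := v₁) rfl
    (List.getLast?_eq_some_iff.2 ⟨v₃ :: t, rfl⟩)
  rw [hclose, Multiset.mem_cons, Sym2.eq_iff] at h₂₁ h₄₅
  replace h₂₁ := h₂₁.resolve_left (by grind)
  replace h₄₅ := h₄₅.resolve_left (by grind)
  obtain ⟨u, rfl⟩ : ∃ u, t = u ++ [v₂] := by
    have hsnoc : v₃ :: (t ++ [v₁]) = (v₃ :: t) ++ [v₁] := rfl
    have hv₁ : v₁ ∉ v₃ :: t := by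
      rw [hsnoc, List.nodup_append] at hnd'
      exact fun h => hnd'.2.2 _ h _ (by simp) rfl
    have hsub : ∃ p, v₃ :: t = p ++ [v₂] := by
      obtain ⟨p, q, h | h⟩ := exists_split_of_mem_pathEdges h₂₁
      · obtain rfl | ⟨q, z, rfl⟩ := q.eq_nil_or_concat'
        · have h' : (v₃ :: t) ++ [v₁] = (p ++ [v₂]) ++ [v₁] := by simpa using h
          exact ⟨p, (List.append_inj' h' rfl).1⟩
        · have h' : (v₃ :: t) ++ [v₁] = (p ++ v₂ :: v₁ :: q) ++ [z] := by simpa using h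
          rw [(List.append_inj' h' rfl).1] at hv₁
          simp at hv₁
      · obtain ⟨q', z, hq⟩ := (List.eq_nil_or_concat' (v₂ :: q)).resolve_left (by simp)
        have h' : (v₃ :: t) ++ [v₁] = (p ++ v₁ :: q') ++ [z] := by simpa [hq] using h
        rw [(List.append_inj' h' rfl).1] at hv₁
        simp at hv₁
    obtain ⟨_ | ⟨b, p⟩, hp⟩ := hsub
    · simp only [List.nil_append, List.cons.injEq] at hp
      exact absurd hp.1.symm hv.2.1.1
    · simp only [List.cons_append, List.cons.injEq] at hp
      exact ⟨p, hp.2⟩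
  have hpath : pathEdges (v₃ :: (u ++ [v₂] ++ [v₁])) =
      pathEdges (v₃ :: (u ++ [v₂])) + {s(v₂, v₁)} := by
    have := pathEdges_append_pair (v₃ :: u) v₂ v₁
    simpa using this
  rw [hpath, Multiset.mem_add, Multiset.mem_singleton, Sym2.eq_iff] at h₄₅
  replace h₄₅ := h₄₅.resolve_right (by grind)
  have key : ∀ x y p q, v₃ :: (u ++ [v₂]) = p ++ x :: y :: q →
      ∃ l', l'.Perm l ∧ cycleEdges l' + {s(v₂, v₁), s(v₁, v₃), s(x, y)} =
        cycleEdges (v₃ :: (u ++ [v₂] ++ [v₁])) + {s(v₂, v₃), s(v₁, x), s(v₁, y)} := by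
    intro x y p q h
    have hhead : (p ++ x :: v₁ :: y :: q).head? = some v₃ := by
      have := congrArg List.head? h
      cases p <;> simpa using this.symm
    have hlast : (p ++ x :: v₁ :: y :: q).getLast? = some v₂ := by
      have h' := congrArg List.getLast? h
      have h'' : (v₃ :: (u ++ [v₂])).getLast? = some v₂ :=
        List.getLast?_eq_some_iff.2 ⟨v₃ :: u, rfl⟩
      rw [h''] at h'
      simpa using h'.symm
    refine ⟨p ++ x :: v₁ :: y :: q, ?_, ?_⟩
    · refine List.Perm.trans ?_ hperm.symm
      have h₁ : v₃ :: (u ++ [v₂] ++ [v₁]) = (p ++ x :: y :: q) ++ [v₁] := by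
        rw [← h]
        simp
      have h₂ : p ++ x :: v₁ :: y :: q = (p ++ [x]) ++ v₁ :: (y :: q) := by simp
      have h₃ : v₁ :: (p ++ x :: y :: q) = v₁ :: ((p ++ [x]) ++ (y :: q)) := by simp
      rw [h₁, h₂]
      refine List.perm_middle.trans ?_
      rw [← h₃]
      exact (List.perm_append_singleton _ _).symm
    · rw [cycleEdges_eq_cons_pathEdges hhead hlast, hclose, hpath, h, pathEdges_append_cons,
        pathEdges_append_cons p x (y :: q)]
      simp only [pathEdges_cons_cons, ← Multiset.singleton_add, Multiset.insert_eq_cons,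
        Sym2.eq_swap (a := x) (b := v₁)]
      abel
  obtain ⟨p, q, h | h⟩ := exists_split_of_mem_pathEdges h₄₅
  · exact key v₄ v₅ p q h
  · obtain ⟨l', h₁, h₂⟩ := key v₅ v₄ p q h
    refine ⟨l', h₁, ?_⟩
    rw [Sym2.eq_swap (a := v₄), h₂]
    simp only [← Multiset.singleton_add, Multiset.insert_eq_cons]
    abel

end ListEdges

/-- Five vertices in the roles of `v₁, …, v₅` in a bowtie. -/
structure VertexQuintuple (V : Type*) where
  (v₁ v₂ v₃ v₄ v₅ : V)

namespace VertexQuintuple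

variable {V : Type*}

/-- The five vertices, ordered such that the edges to be forced into a cycle are consecutive. -/
def verts (b : VertexQuintuple V) : List V := [b.v₂, b.v₁, b.v₃, b.v₄, b.v₅]

/-- The edges `v₂v₁`, `v₁v₃`, `v₄v₅`, which are counted positively by `bowtieF`. -/
def posEdges (b : VertexQuintuple V) : List (Sym2 V) :=
  [s(b.v₂, b.v₁), s(b.v₁, b.v₃), s(b.v₄, b.v₅)]

/-- The five vertices span a bowtie of `G` on which `bowtieF` is positive for the color `k`. -/
def IsPosBad {r : ℕ} (G : SimpleGraph V) (χ : Sym2 V → Fin r) (b : VertexQuintuple V)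
    (k : Fin r) : Prop :=
  IsBowtie G b.v₁ b.v₂ b.v₃ b.v₄ b.v₅ ∧ 0 < bowtieF χ b.v₁ b.v₂ b.v₃ b.v₄ b.v₅ k

lemma mem_verts_of_mem_posEdges {b : VertexQuintuple V} {e : Sym2 V} (he : e ∈ b.posEdges) {x : V}
    (hx : x ∈ e) : x ∈ b.verts := by
  simp only [posEdges, List.mem_cons, List.not_mem_nil, or_false] at he
  simp only [verts, List.mem_cons, List.not_mem_nil, or_false]
  rcases he with rfl | rfl | rfl <;> rw [Sym2.mem_iff] at hx <;> tauto

lemma mem_edgeSet_of_mem_posEdges {G : SimpleGraph V} {b : VertexQuintuple V}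
    (hb : IsBowtie G b.v₁ b.v₂ b.v₃ b.v₄ b.v₅) {e : Sym2 V} (he : e ∈ b.posEdges) :
    e ∈ G.edgeSet := by
  obtain ⟨-, h₁₂, h₁₃, -, -, -, h₄₅⟩ := hb
  simp only [posEdges, List.mem_cons, List.not_mem_nil, or_false] at he
  rcases he with rfl | rfl | rfl
  exacts [h₁₂.symm, h₁₃, h₄₅]

lemma mem_cycleEdges_of_append {s t : List V} {b : VertexQuintuple V} {e : Sym2 V}
    (he : e ∈ b.posEdges) : e ∈ cycleEdges (s ++ (b.verts ++ t)) := by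
  rw [cycleEdges_append_comm]
  simp only [posEdges, List.mem_cons, List.not_mem_nil, or_false] at he
  simp only [verts, List.cons_append, List.nil_append, cycleEdges, pathEdges_cons_cons,
    Multiset.mem_cons]
  tauto

variable {r : ℕ} {G : SimpleGraph V} {χ : Sym2 V → Fin r}

/-- Rerouting a Hamilton cycle through disjoint bad bowties lowers the number of edges of the
given color by at least the number of these bowties. -/
lemma exists_perm_countP_add_length_le (k : Fin r) (L : List (VertexQuintuple V)) :
    ∀ l : List V, l.Nodup → (∀ b ∈ L, IsPosBad G χ b k) → (L.flatMap verts).Nodup →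
      (∀ b ∈ L, ∀ e ∈ b.posEdges, e ∈ cycleEdges l) → (∀ e ∈ cycleEdges l, e ∈ G.edgeSet) →
      ∃ l' : List V, l'.Perm l ∧ (∀ e ∈ cycleEdges l', e ∈ G.edgeSet) ∧
        (cycleEdges l').countP (χ · = k) + L.length ≤ (cycleEdges l).countP (χ · = k) := by
  induction L with
  | nil => exact fun l _ _ _ _ hG => ⟨l, .refl _, hG, by simp⟩
  | cons b L ih =>
    intro l hnd hbad hdisj hpos hG
    obtain ⟨hbow, hf⟩ := hbad b (by simp)
    have hpos_b := hpos b (by simp)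
    obtain ⟨l', hperm, hcyc⟩ := exists_perm_move_vertex hnd hbow.1
      (hpos_b _ (by simp [posEdges])) (hpos_b _ (by simp [posEdges]))
      (hpos_b _ (by simp [posEdges]))
    rw [List.flatMap_cons, List.nodup_append] at hdisj
    have hG' : ∀ e ∈ cycleEdges l', e ∈ G.edgeSet := by
      intro e he
      have : e ∈ cycleEdges l + {s(b.v₂, b.v₃), s(b.v₁, b.v₄), s(b.v₁, b.v₅)} := by
        rw [← hcyc]
        exact Multiset.mem_add.2 (Or.inl he)
      simp only [Multiset.mem_add, Multiset.insert_eq_cons, Multiset.mem_cons,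
        Multiset.mem_singleton] at this
      obtain ⟨-, -, -, h₁₄, h₁₅, h₂₃, -⟩ := hbow
      rcases this with h | rfl | rfl | rfl
      exacts [hG e h, h₂₃, h₁₄, h₁₅]
    have hpos' : ∀ c ∈ L, ∀ e ∈ c.posEdges, e ∈ cycleEdges l' := by
      intro c hc e he
      have : e ∈ cycleEdges l' + {s(b.v₂, b.v₁), s(b.v₁, b.v₃), s(b.v₄, b.v₅)} := by
        rw [hcyc]
        exact Multiset.mem_add.2 (Or.inl (hpos c (by simp [hc]) e he))
      refine (Multiset.mem_add.1 this).resolve_right fun he' => ?_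
      have heb : e ∈ b.posEdges := by
        simpa [posEdges] using he'
      induction e with
      | _ x y =>
      have hx : x ∈ s(x, y) := Sym2.mem_mk_left x y
      exact hdisj.2.2 x (mem_verts_of_mem_posEdges heb hx) x
        (List.mem_flatMap.2 ⟨c, hc, mem_verts_of_mem_posEdges he hx⟩) rfl
    obtain ⟨l'', hperm', hG'', hcount⟩ := ih l' (hperm.nodup_iff.2 hnd)
      (fun c hc => hbad c (by simp [hc])) hdisj.2.1 hpos' hG'
    refine ⟨l'', hperm'.trans hperm, hG'', ?_⟩
    have h := congrArg (Multiset.countP (χ · = k)) hcyc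
    simp only [Multiset.countP_add, Multiset.insert_eq_cons, Multiset.countP_cons, ←
      Multiset.cons_zero, Multiset.countP_zero] at h
    rw [bowtieF, Sym2.eq_swap (a := b.v₁) (b := b.v₂)] at hf
    rw [List.length_cons]
    split_ifs at h hf <;> omega

/-- Either few vertices meet all bad bowties, or there are many disjoint bad bowties. -/
lemma exists_cover_or_exists_disjoint [DecidableEq V] (G : SimpleGraph V) (χ : Sym2 V → Fin r)
    (N : ℕ) :
    (∃ S : Finset V, S.card ≤ 5 * N ∧
      ∀ v₁ v₂ v₃ v₄ v₅ : V, v₁ ∉ S → v₂ ∉ S → v₃ ∉ S → v₄ ∉ S → v₅ ∉ S →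
        IsBowtie G v₁ v₂ v₃ v₄ v₅ → ∀ k : Fin r, bowtieF χ v₁ v₂ v₃ v₄ v₅ k = 0) ∨
    ∃ L : List (VertexQuintuple V × Fin r), L.length = N ∧ (∀ p ∈ L, IsPosBad G χ p.1 p.2) ∧
      (L.flatMap fun p => p.1.verts).Nodup := by
  induction N with
  | zero => exact Or.inr ⟨[], by simp⟩
  | succ N ih =>
    obtain ⟨S, hS, h⟩ | ⟨L, hlen, hbad, hdisj⟩ := ih
    · exact Or.inl ⟨S, by omega, h⟩
    rw [or_iff_not_imp_left]
    intro hcon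
    push Not at hcon
    obtain ⟨v₁, v₂, v₃, v₄, v₅, h₁, h₂, h₃, h₄, h₅, hbow, k, hk⟩ :=
      hcon (L.flatMap fun p => p.1.verts).toFinset (by
        refine (List.toFinset_card_le _).trans ?_
        have : (fun p : VertexQuintuple V × Fin r => p.1.verts.length) = fun _ => 5 := rfl
        rw [List.length_flatMap, this, List.map_const', List.sum_replicate, hlen]
        simp only [smul_eq_mul]
        omega)
    rw [List.mem_toFinset] at h₁ h₂ h₃ h₄ h₅
    obtain ⟨b, hb, hbv⟩ : ∃ b : VertexQuintuple V, IsPosBad G χ b k ∧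
        ∀ x ∈ b.verts, x ∉ L.flatMap fun p => p.1.verts := by
      rcases lt_or_gt_of_ne hk with hneg | hpos
      · obtain ⟨hnd, e₁₂, e₁₃, e₁₄, e₁₅, e₂₃, e₄₅⟩ := hbow
        refine ⟨⟨v₁, v₄, v₅, v₂, v₃⟩, ⟨⟨?_, e₁₄, e₁₅, e₁₂, e₁₃, e₄₅, e₂₃⟩, ?_⟩, ?_⟩
        · simp only [List.nodup_cons, List.mem_cons, not_or, List.not_mem_nil, not_false_eq_true,
            List.nodup_nil, and_true] at hnd ⊢
          grind
        · simp only [bowtieF] at hneg ⊢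
          linarith
        · intro x hx
          simp only [verts, List.mem_cons, List.not_mem_nil, or_false] at hx
          rcases hx with rfl | rfl | rfl | rfl | rfl <;> assumption
      · exact ⟨⟨v₁, v₂, v₃, v₄, v₅⟩, ⟨hbow, hpos⟩, fun x hx => by
          simp only [verts, List.mem_cons, List.not_mem_nil, or_false] at hx
          rcases hx with rfl | rfl | rfl | rfl | rfl <;> assumption⟩
    refine ⟨(b, k) :: L, by simp [hlen], ?_, ?_⟩
    · intro p hp
      rcases List.mem_cons.1 hp with rfl | hp
      exacts [hb, hbad p hp]
    · rw [List.flatMap_cons, List.nodup_append]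
      refine ⟨?_, hdisj, ?_⟩
      · have := hb.1.1
        simp only [verts, List.nodup_cons, List.mem_cons, not_or, List.not_mem_nil,
          not_false_eq_true, List.nodup_nil, and_true] at this ⊢
        grind
      · rintro x hx y hy rfl
        exact hbv x hx hy

end VertexQuintuple

open VertexQuintuple in
/-- Removal of bad bowties: if every Hamilton cycle of `G` has color-bias less than `m`, then
there is a set `S` of at most `10rm` vertices whose removal leaves an induced subgraph with
no bad bowtie. -/
theorem statement4 {V : Type*} [Fintype V] [DecidableEq V] (r m : ℕ) (hr : 2 ≤ r) (hm : 1 ≤ m)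
    (G : SimpleGraph V) [DecidableRel G.Adj] (χ : Sym2 V → Fin r)
    (hδ : (Fintype.card V : ℚ) / 2 + 6 * r ^ 2 * m ≤ (G.minDegree : ℚ))
    (hbias : ∀ (v : V) (H : G.Walk v v), H.IsHamiltonianCycle →
      ∀ i : Fin r,
        |((H.edges.filter (fun e => χ e = i)).length : ℚ) - (Fintype.card V : ℚ) / r| < m) :
    ∃ S : Finset V, S.card ≤ 10 * r * m ∧
      ∀ v₁ v₂ v₃ v₄ v₅ : V, v₁ ∉ S → v₂ ∉ S → v₃ ∉ S → v₄ ∉ S → v₅ ∉ S →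
        IsBowtie G v₁ v₂ v₃ v₄ v₅ → ∀ k : Fin r, bowtieF χ v₁ v₂ v₃ v₄ v₅ k = 0 := by
  refine (exists_cover_or_exists_disjoint G χ (2 * r * m)).elim
    (fun ⟨S, hS, h⟩ => ⟨S, by linarith, h⟩) ?_
  rintro ⟨L, hlen, hbad, hdisj⟩
  exfalso
  obtain ⟨k, hk⟩ : ∃ k : Fin r, 2 * m ≤ (L.filter (·.2 = k)).length := by
    by_contra! hcon
    have hsum : ∑ k : Fin r, (L.filter (·.2 = k)).length = L.length := by
      have := Multiset.sum_count_eq_card (s := Finset.univ) (m := ((L.map Prod.snd : List (Fin r)) :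
        Multiset (Fin r))) fun a _ => Finset.mem_univ a
      simp only [Multiset.coe_card, List.length_map, Multiset.coe_count] at this
      rw [← this]
      refine Finset.sum_congr rfl fun k _ => ?_
      rw [List.count, List.countP_map, List.countP_eq_length_filter]
      congr 2
    have hlt : ∑ k : Fin r, (L.filter (·.2 = k)).length < ∑ _k : Fin r, 2 * m :=
      Finset.sum_lt_sum_of_nonempty ⟨⟨0, by omega⟩, Finset.mem_univ _⟩ fun k _ => hcon k
    rw [hsum, hlen, Finset.sum_const, Finset.card_univ, Fintype.card_fin, smul_eq_mul] at hlt
    linarith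
  set K := (L.filter (·.2 = k)).map Prod.fst with hK
  have hKlen : 2 * m ≤ K.length := by rwa [hK, List.length_map]
  have hKlen' : K.length ≤ 2 * r * m := by
    rw [hK, List.length_map, ← hlen]
    exact List.length_filter_le _ _
  have hKbad : ∀ b ∈ K, IsPosBad G χ b k := by
    intro b hb
    obtain ⟨⟨b, k'⟩, hp, rfl⟩ := List.mem_map.1 hb
    rw [List.mem_filter] at hp
    have hk' : k' = k := by simpa using hp.2
    exact hk' ▸ hbad _ hp.1
  have hKdisj : (K.flatMap verts).Nodup := by
    rw [hK, List.flatMap_map]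
    exact hdisj.sublist (List.filter_sublist.flatMap _)
  set F := (K.flatMap posEdges).toFinset with hF
  have hFcard : F.card ≤ 3 * (2 * r * m) := by
    refine (List.toFinset_card_le _).trans ?_
    have : (fun b : VertexQuintuple V => b.posEdges.length) = fun _ => 3 := rfl
    rw [List.length_flatMap, this, List.map_const', List.sum_replicate, smul_eq_mul]
    omega
  have hFmem : ∀ {e}, e ∈ F ↔ ∃ b ∈ K, e ∈ b.posEdges := by simp [hF]
  have hdeg : ∀ u v, Fintype.card V + F.card ≤ G.degree u + G.degree v := by
    intro u v
    have hu : (G.minDegree : ℚ) ≤ G.degree u := by exact_mod_cast G.minDegree_le_degree u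
    have hv : (G.minDegree : ℚ) ≤ G.degree v := by exact_mod_cast G.minDegree_le_degree v
    have hF' : (F.card : ℚ) ≤ 3 * (2 * r * m) := by exact_mod_cast hFcard
    have hrm : (r : ℚ) * m ≤ r ^ 2 * m := by
      have : r * m ≤ r ^ 2 * m := Nat.mul_le_mul_right _ (Nat.le_self_pow (by norm_num) r)
      exact_mod_cast this
    have hrm₀ : (0 : ℚ) ≤ r * m := by positivity
    have : (Fintype.card V + F.card : ℚ) ≤ G.degree u + G.degree v := by linarith
    exact_mod_cast this
  obtain ⟨b, hb⟩ : ∃ b, b ∈ K := List.exists_mem_of_length_pos (by omega)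
  set l₀ := K.flatMap verts ++ (Finset.univ.filter (· ∉ K.flatMap verts)).toList with hl₀
  have hl₀nd : l₀.Nodup := by
    rw [hl₀, List.nodup_append]
    refine ⟨hKdisj, Finset.nodup_toList _, ?_⟩
    rintro x hx y hy rfl
    exact (Finset.mem_filter.1 (Finset.mem_toList.1 hy)).2 hx
  have hl₀mem : ∀ v, v ∈ l₀ := by
    intro v
    rw [hl₀, List.mem_append, Finset.mem_toList, Finset.mem_filter]
    exact (em _).imp_right fun h => ⟨Finset.mem_univ v, h⟩
  have hcover : ∀ l : List V, (∀ v, v ∈ l) → 5 ≤ l.length := by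
    intro l hl
    have hsub : b.verts.Subperm l := List.Nodup.subperm
      ((List.nodup_flatMap.1 hKdisj).1 b hb) fun v _ => hl v
    exact hsub.length_le
  obtain ⟨l₁, hnd₁, hmem₁, hF₁, hG₁⟩ := exists_cycleEdges_subset_of_degree G F
    (fun e he => by
      obtain ⟨b, hb, he⟩ := hFmem.1 he
      exact mem_edgeSet_of_mem_posEdges (hKbad b hb).1 he)
    hdeg l₀ hl₀nd hl₀mem (by linarith [hcover l₀ hl₀mem])
    (fun e he => by
      obtain ⟨b, hb, he⟩ := hFmem.1 he
      obtain ⟨s, t, hst⟩ := List.append_of_mem hb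
      rw [hl₀, hst, List.flatMap_append, List.flatMap_cons, List.append_assoc, List.append_assoc]
      exact mem_cycleEdges_of_append he)
  obtain ⟨l₂, hperm, hG₂, hcount⟩ := exists_perm_countP_add_length_le k K l₁ hnd₁ hKbad hKdisj
    (fun b hb e he => hF₁ e (hFmem.2 ⟨b, hb, he⟩)) hG₁
  have hmem₂ : ∀ v, v ∈ l₂ := fun v => hperm.mem_iff.2 (hmem₁ v)
  have hcolor : ∀ l : List V, l.Nodup → (∀ v, v ∈ l) → (∀ e ∈ cycleEdges l, e ∈ G.edgeSet) →
      |((cycleEdges l).countP (χ · = k) : ℚ) - (Fintype.card V : ℚ) / r| < m := by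
    intro l hnd hmem hG
    obtain ⟨v, H, hH, hedges⟩ :=
      exists_isHamiltonianCycle_of_cycleEdges G l hnd hmem (by linarith [hcover l hmem]) hG
    have := hbias v H hH k
    rwa [← List.countP_eq_length_filter, ← Multiset.coe_countP, hedges] at this
  have hc₁ := abs_lt.1 (hcolor l₁ hnd₁ hmem₁ hG₁)
  have hc₂ := abs_lt.1 (hcolor l₂ (hperm.nodup_iff.2 hnd₁) hmem₂ hG₂)
  have hle : ((cycleEdges l₂).countP (χ · = k) + 2 * m : ℚ) ≤ (cycleEdges l₁).countP (χ · = k) := by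
    exact_mod_cast (Nat.add_le_add_left hKlen _).trans hcount
  linarith [hc₁.2, hc₂.1]
end
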